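/- Let n ≥ 7 be an integer, let p be a prime number with p > n, and let k be an integer with p ∤ k. Then (unconditionally) there exists a Galois number field K/ℚ whose Galois group is isomorphic to the alternating group Aₙ and whose reduced discriminant is congruent to k modulo p. -/

import Mathlib

/-- The reduced discriminant of a number field: the product of the distinct prime
numbers dividing its discriminant (equivalently, the ramified primes). -/
noncomputable def reducedDiscr (K : Type*) [Field K] [NumberField K] : ℕ :=
  ∏ q ∈ (NumberField.discr K).natAbs.primeFactors, q

section

open NumberField IntermediateField Polynomial
set_option linter.unusedSectionVars false

section inertia

variable {L : Type*} [Field L] [NumberField L] [IsGalois ℚ L]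

/-- The multiplicity of an element fixed by a subgroup `H` of the inertia group. -/
theorem exists_emultiplicity_eq_of_fixed (H : Subgroup Gal(L/ℚ)) (P : Ideal (𝓞 L)) [P.IsPrime]
    (hP : P ≠ ⊥) (hH : H ≤ P.inertia Gal(L/ℚ)) {x : 𝓞 L} (hx : x ≠ 0)
    (hfix : ∀ σ ∈ H, σ • x = x) :
    ∃ m : ℕ, emultiplicity P (Ideal.span {x}) = (Nat.card H * m : ℕ) := by
  let E : IntermediateField ℚ L := FixedPoints.intermediateField (F := ℚ) (E := L) H
  have : IsGaloisGroup H E L := inferInstance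
  have : SMulDistribClass H (𝓞 L) L := ⟨fun g a b => smul_distrib_smul (g : Gal(L/ℚ)) a b⟩
  have : IsGaloisGroup H (𝓞 E) (𝓞 L) := IsGaloisGroup.of_isFractionRing H (𝓞 E) (𝓞 L) E L
  let p : Ideal (𝓞 E) := P.under (𝓞 E)
  have hp : p ≠ ⊥ := Ideal.under_ne_bot (𝓞 E) hP
  have h1 := Ideal.card_inertia_eq_ramificationIdxIn (G := H) p P
  rw [Ideal.ramificationIdxIn_eq_ramificationIdx p P H,
    ← Ideal.ramificationIdx'_eq_ramificationIdx p P hp] at h1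
  have h2 : Nat.card (P.inertia H) = Nat.card H := by
    have : P.inertia H = ⊤ := by
      ext σ; simp only [Subgroup.mem_top, iff_true]
      exact hH σ.2
    rw [this]; simp
  obtain ⟨y, hy⟩ := (IsGaloisGroup.isInvariant (G := H) (A := 𝓞 E)).isInvariant x
    (fun g => hfix g.1 g.2)
  have hy0 : y ≠ 0 := by rintro rfl; simp at hy; exact hx hy.symm
  have hp' := Ideal.prime_of_isPrime hp inferInstance
  have h3 := Ideal.IsDedekindDomain.emultiplicity_map_eq_ramificationIdx'_mul (v := p) (w := P)
    (I := Ideal.span {y}) (by simpa using hy0) hp'.irreducible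
    (Ideal.prime_of_isPrime hP inferInstance).irreducible hP
  rw [Ideal.map_span, Set.image_singleton, hy, ← h1, h2, (FiniteMultiplicity.of_prime_left
    hp' (by simpa using hy0)).emultiplicity_eq_multiplicity] at h3
  exact ⟨_, by rw [h3]; push_cast; rfl⟩

variable (q : ℕ) [hq : Fact q.Prime] (P : Ideal (𝓞 L)) [P.IsPrime]
  [P.LiesOver (Ideal.span {(q : ℤ)})]

include hq in
omit [IsGalois ℚ L] [P.IsPrime] in
theorem ne_bot_of_liesOver_natPrime : P ≠ ⊥ :=
  Ideal.ne_bot_of_liesOver_of_ne_bot (p := Ideal.span {(q : ℤ)})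
    (by simpa using hq.out.ne_zero) P

include hq in
theorem emultiplicity_intCast (z : ℤ) :
    emultiplicity P (Ideal.span {(z : 𝓞 L)}) =
      Nat.card (P.inertia Gal(L/ℚ)) * emultiplicity (q : ℤ) z := by
  have hq0 : Ideal.span {(q : ℤ)} ≠ ⊥ := by simpa using hq.out.ne_zero
  have hqp : Prime (q : ℤ) := Nat.prime_iff_prime_int.1 hq.out
  have hqi : (Ideal.span {(q : ℤ)}).IsPrime := (Ideal.span_singleton_prime hqp.ne_zero).2 hqp
  have hP := ne_bot_of_liesOver_natPrime q P
  rcases eq_or_ne z 0 with rfl | hz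
  · have : Nat.card (P.inertia Gal(L/ℚ)) ≠ 0 := Nat.card_pos.ne'
    rw [Int.cast_zero, Ideal.span_singleton_eq_bot.2 rfl, ← Ideal.zero_eq_bot]
    simp only [emultiplicity_zero]
    exact (ENat.mul_top (by exact_mod_cast this)).symm
  have h1 := Ideal.card_inertia_eq_ramificationIdxIn (G := Gal(L/ℚ)) (Ideal.span {(q : ℤ)}) P
  rw [Ideal.ramificationIdxIn_eq_ramificationIdx _ P Gal(L/ℚ),
    ← Ideal.ramificationIdx'_eq_ramificationIdx _ P hq0] at h1
  have h3 := Ideal.IsDedekindDomain.emultiplicity_map_eq_ramificationIdx'_mul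
    (v := Ideal.span {(q : ℤ)}) (w := P) (I := Ideal.span {z}) (by simpa using hz)
    (Ideal.prime_of_isPrime hq0 inferInstance).irreducible
    (Ideal.prime_of_isPrime hP inferInstance).irreducible hP
  rw [Ideal.map_span, Set.image_singleton, ← h1] at h3
  simp only [algebraMap_int_eq, eq_intCast] at h3
  rw [h3]
  congr 1
  exact emultiplicity_eq_emultiplicity_iff.2 fun k => by
    rw [Ideal.span_singleton_pow, Ideal.dvd_span_singleton, Ideal.mem_span_singleton]

omit [NumberField L] [IsGalois ℚ L] [P.IsPrime] hq in
theorem intCast_mem_iff (z : ℤ) : (z : 𝓞 L) ∈ P ↔ (q : ℤ) ∣ z := by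
  have := Ideal.mem_of_liesOver P (Ideal.span {(q : ℤ)}) z
  rw [Ideal.mem_span_singleton] at this
  rw [this]; simp

end inertia

section discr

theorem natPrime_dvd_discr_iff {K L : Type*} [Field L] [NumberField L] [IsGalois ℚ L] [Field K]
    [NumberField K] [IsGalois ℚ K] [Algebra K L] (q : ℕ) [hq : Fact q.Prime] (P : Ideal (𝓞 L))
    [P.IsPrime] [P.LiesOver (Ideal.span {(q : ℤ)})] :
    (q : ℤ) ∣ discr K ↔ ∃ σ ∈ P.inertia Gal(L/ℚ), ∃ x : K, σ (algebraMap K L x) ≠ algebraMap K L x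
        := by
  have hqp : Prime (q : ℤ) := Nat.prime_iff_prime_int.1 hq.out
  have hqi : (Ideal.span {(q : ℤ)}).IsPrime := (Ideal.span_singleton_prime hqp.ne_zero).2 hqp
  have hqm : (Ideal.span {(q : ℤ)}).IsMaximal := hqi.isMaximal (by simpa using hq.out.ne_zero)
  have : IsGalois K L := IsGalois.tower_top_of_isGalois ℚ K L
  have : IsGaloisGroup Gal(L/K) (𝓞 K) (𝓞 L) :=
    IsGaloisGroup.of_isFractionRing Gal(L/K) (𝓞 K) (𝓞 L) K L
  have hQ : (P.under (𝓞 K)).LiesOver (Ideal.span {(q : ℤ)}) := by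
    constructor
    rw [Ideal.under_under]
    exact Ideal.over_def P _
  have h1 := Ideal.card_inertia_eq_ramificationIdxIn (G := Gal(L/ℚ)) (Ideal.span {(q : ℤ)}) P
  have h2 := Ideal.card_inertia_eq_ramificationIdxIn (G := Gal(L/K)) (P.under (𝓞 K)) P
  have : Nonempty ((P.under (𝓞 K)).primesOver (𝓞 L)) := ⟨⟨P, inferInstance, inferInstance⟩⟩
  have h3 := Ideal.ramificationIdxIn_mul_ramificationIdxIn (p := Ideal.span {(q : ℤ)})
    (P.under (𝓞 K)) Gal(K/ℚ) (𝓞 L) Gal(L/ℚ) Gal(L/K)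
  rw [← h1, ← h2] at h3
  have h4 : ¬ (q : ℤ) ∣ discr K ↔ (Ideal.span {(q : ℤ)}).ramificationIdxIn (𝓞 K) = 1 := by
    rw [not_dvd_discr_iff_forall_liesOver K (𝓞 K) hqp]
    constructor
    · intro h
      rw [Ideal.ramificationIdxIn_eq_ramificationIdx _ (P.under (𝓞 K)) Gal(K/ℚ),
        Ideal.ramificationIdx_eq_one_iff]
      exact h _ (Ideal.IsMaximal.of_liesOver_isMaximal (P.under (𝓞 K)) (Ideal.span {(q : ℤ)})) hQ
    · intro h Q hQ1 hQ2
      rw [Ideal.ramificationIdxIn_eq_ramificationIdx _ Q Gal(K/ℚ)] at h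
      exact Ideal.ramificationIdx_eq_one_iff.1 h
  let f : Gal(L/K) →* Gal(L/ℚ) := 
    { toFun := fun σ => σ.restrictScalars ℚ
      map_one' := rfl
      map_mul' := fun _ _ => rfl }
  have hf : Function.Injective f := fun σ τ h => by
    ext x; exact DFunLike.congr_fun h x
  have hfm : (P.inertia Gal(L/K)).map f ≤ P.inertia Gal(L/ℚ) := by
    rintro _ ⟨σ, hσ, rfl⟩
    exact hσ
  have hcard : Nat.card (P.inertia Gal(L/K)) = Nat.card ((P.inertia Gal(L/K)).map f) :=
    Nat.card_congr ((P.inertia Gal(L/K)).equivMapOfInjective f hf).toEquiv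
  have h5 : (Ideal.span {(q : ℤ)}).ramificationIdxIn (𝓞 K) = 1 ↔
      (P.inertia Gal(L/K)).map f = P.inertia Gal(L/ℚ) := by
    constructor
    · intro h
      rw [h, one_mul, hcard] at h3
      exact Subgroup.eq_of_le_of_card_ge hfm h3.ge
    · intro h
      rw [hcard, h] at h3
      exact Nat.eq_of_mul_eq_mul_right Nat.card_pos (by rw [h3, one_mul])
  rw [← not_iff_not, h4, h5]
  push Not
  constructor
  · intro h σ hσ x
    rw [← h] at hσ
    obtain ⟨τ, -, rfl⟩ := hσ
    exact τ.commutes x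
  · intro h
    refine le_antisymm hfm fun σ hσ => ?_
    refine ⟨AlgEquiv.ofRingEquiv (f := σ.toRingEquiv) (h σ hσ), hσ, ?_⟩
    ext x; rfl

end discr

/-- A labelling by `Fin n` of the pairwise distinct roots of a monic integral polynomial which
splits in a number field. -/
structure RootLabelling (F : ℤ[X]) (n : ℕ) (L : Type*) [Field L] where
  /-- The root with a given label. -/
  root : Fin n → 𝓞 L
  map_eq : F.map (algebraMap ℤ (𝓞 L)) = ∏ i, (X - C (root i))
  injective : Function.Injective root


namespace RootLabelling

variable {F : ℤ[X]} {n : ℕ} {L : Type*} [Field L] [NumberField L] (R : RootLabelling F n L)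

include R in
theorem aeval_eq (x : 𝓞 L) : aeval x F = ∏ i, (x - R.root i) := by
  rw [← eval_map_algebraMap, R.map_eq, eval_prod]
  simp

theorem aeval_root (i : Fin n) : aeval (R.root i) F = 0 := by
  rw [R.aeval_eq]
  exact Finset.prod_eq_zero (Finset.mem_univ i) (sub_self _)

theorem aeval_derivative (i : Fin n) :
    aeval (R.root i) (derivative F) = ∏ j ∈ Finset.univ.erase i, (R.root i - R.root j) := by
  rw [← eval_map_algebraMap, ← derivative_map, R.map_eq, derivative_prod_finset, eval_finsetSum,
    Finset.sum_eq_single i]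
  · simp [eval_prod]
  · intro j _ hj
    rw [eval_mul, eval_prod, Finset.prod_eq_zero (i := i)]
    · simp
    · simp [hj.symm]
    · simp
  · simp

theorem exists_eq_of_aeval_eq_zero {x : 𝓞 L} (hx : aeval x F = 0) : ∃ j, x = R.root j := by
  rw [R.aeval_eq, Finset.prod_eq_zero_iff] at hx
  obtain ⟨j, -, hj⟩ := hx
  exact ⟨j, sub_eq_zero.1 hj⟩

theorem smul_aeval (σ : Gal(L/ℚ)) (x : 𝓞 L) (g : ℤ[X]) : σ • aeval x g = aeval (σ • x) g := by
  have := Polynomial.aeval_algHom_apply (MulSemiringAction.toAlgHom ℤ (𝓞 L) σ) x g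
  simpa using this.symm

theorem exists_smul_root (σ : Gal(L/ℚ)) (i : Fin n) : ∃ j, σ • R.root i = R.root j := by
  apply R.exists_eq_of_aeval_eq_zero
  rw [← smul_aeval, R.aeval_root, smul_zero]

/-- The permutation of the labels induced by a Galois automorphism. -/
noncomputable def perm : Gal(L/ℚ) →* Equiv.Perm (Fin n) where
  toFun σ := Equiv.ofBijective (fun i => (R.exists_smul_root σ i).choose) <|
    Finite.injective_iff_bijective.1 fun i j hij => by
      have hi := (R.exists_smul_root σ i).choose_spec
      have hj := (R.exists_smul_root σ j).choose_spec
      rw [hij, ← hj] at hi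
      exact R.injective (smul_left_cancel σ hi)
  map_one' := by
    ext1 i
    apply R.injective
    have hi := (R.exists_smul_root 1 i).choose_spec
    simpa using hi.symm
  map_mul' σ τ := by
    ext1 i
    apply R.injective
    simp only [Equiv.ofBijective_apply, Equiv.Perm.coe_mul, Function.comp_apply]
    rw [← (R.exists_smul_root (σ * τ) i).choose_spec, ← (R.exists_smul_root σ _).choose_spec,
      ← (R.exists_smul_root τ i).choose_spec, mul_smul]

theorem root_perm (σ : Gal(L/ℚ)) (i : Fin n) : R.root (R.perm σ i) = σ • R.root i :=
  (R.exists_smul_root σ i).choose_spec.symm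

theorem aeval_sub_aeval_mem {P : Ideal (𝓞 L)} {x y : 𝓞 L} (h : x - y ∈ P) (g : ℤ[X]) :
    aeval x g - aeval y g ∈ P := by
  obtain ⟨c, hc⟩ := sub_dvd_eval_sub x y (g.map (algebraMap ℤ (𝓞 L)))
  simp only [eval_map_algebraMap] at hc
  rw [hc]
  exact P.mul_mem_right _ h

theorem aeval_mem_iff {P : Ideal (𝓞 L)} {x y : 𝓞 L} (h : x - y ∈ P) (g : ℤ[X]) :
    aeval x g ∈ P ↔ aeval y g ∈ P := 
  ⟨fun hx => by simpa using P.sub_mem hx (aeval_sub_aeval_mem h g),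
   fun hy => by simpa using P.add_mem (aeval_sub_aeval_mem h g) hy⟩

theorem aeval_intCast_mem_iff {q : ℕ} {P : Ideal (𝓞 L)} [P.LiesOver (Ideal.span {(q : ℤ)})]
    {x : 𝓞 L} {c : ℤ} (h : x - c ∈ P) (g : ℤ[X]) : aeval x g ∈ P ↔ (q : ℤ) ∣ g.eval c := by
  rw [aeval_mem_iff h, ← intCast_mem_iff q P]
  have : aeval (c : 𝓞 L) g = ((g.eval c : ℤ) : 𝓞 L) := by
    have := aeval_algebraMap_apply (𝓞 L) c g
    simpa using this
  rw [this]

variable (q : ℕ) (P : Ideal (𝓞 L)) [P.IsPrime]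

theorem perm_eq_of_aeval_derivative_notMem {σ : Gal(L/ℚ)} (hσ : σ ∈ P.inertia Gal(L/ℚ))
    {i : Fin n} (hi : aeval (R.root i) (derivative F) ∉ P) : R.perm σ i = i := by
  by_contra h
  apply hi
  rw [R.aeval_derivative]
  refine Ideal.mem_of_dvd P (Finset.dvd_prod_of_mem _ (a := R.perm σ i) (by simpa using h)) ?_
  rw [← neg_sub, neg_mem_iff, R.root_perm]
  exact hσ _

variable [P.LiesOver (Ideal.span {(q : ℤ)})]

open scoped Classical in
include q in
theorem card_root_sub_mem {c δ : ℤ} {k : ℕ} {g h : ℤ[X]} 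
    (hF : F = (X - C c) ^ k * g - C δ * h) (hδ : (q : ℤ) ∣ δ) (hg : ¬ (q : ℤ) ∣ g.eval c) :
    (Finset.univ.filter fun i => R.root i - c ∈ P).card = k := by
  let φ : ℤ →+* (𝓞 L ⧸ P) := algebraMap ℤ (𝓞 L ⧸ P)
  have hφ : ∀ z : ℤ, φ z = 0 ↔ (q : ℤ) ∣ z := by
    intro z
    rw [← intCast_mem_iff q P, ← Ideal.Quotient.eq_zero_iff_mem]
    simp [φ]
  have h1 : F.map φ = ∏ i, (X - C (Ideal.Quotient.mk P (R.root i))) := by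
    have := congrArg (Polynomial.map (Ideal.Quotient.mk P)) R.map_eq
    rw [Polynomial.map_map, Polynomial.map_prod] at this
    rw [show φ = (Ideal.Quotient.mk P).comp (algebraMap ℤ (𝓞 L)) from RingHom.ext_int _ _, this]
    simp
  have h2 : F.map φ = (X - C (φ c)) ^ k * g.map φ := by
    rw [hF]
    rw [Polynomial.map_sub, Polynomial.map_mul, Polynomial.map_mul, map_C φ, (hφ δ).2 hδ]
    simp
  have hg' : (g.map φ).eval (φ c) ≠ 0 := by
    rw [eval_map, eval₂_at_apply]
    exact fun h => hg ((hφ _).1 h)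
  have hg0 : g.map φ ≠ 0 := by rintro h; simp [h] at hg'
  have h3 : (F.map φ).rootMultiplicity (φ c) = k := by
    rw [h2, rootMultiplicity_mul (mul_ne_zero (pow_ne_zero _ (X_sub_C_ne_zero _)) hg0),
      rootMultiplicity_X_sub_C_pow, rootMultiplicity_eq_zero hg', add_zero]
  have h4 : ∏ i, (X - C (Ideal.Quotient.mk P (R.root i))) =
      ((Finset.univ.val.map fun i => Ideal.Quotient.mk P (R.root i)).map fun a => X - C a).prod :=
          by
    rw [Multiset.map_map]; rfl
  rw [h1, h4, ← count_roots, roots_multiset_prod_X_sub_C, Multiset.count_map] at h3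
  rw [← h3, Finset.card_def, Finset.filter_val]
  congr 1
  refine Multiset.filter_congr fun i _ => ?_
  rw [eq_comm, ← Ideal.Quotient.eq]
  simp [φ]

end RootLabelling

namespace RootLabelling
variable {F : ℤ[X]} {n : ℕ} {L : Type*} [Field L] [NumberField L] (R : RootLabelling F n L)
  (q : ℕ) (P : Ideal (𝓞 L)) [P.IsPrime] [P.LiesOver (Ideal.span {(q : ℤ)})]

/-- If `F = (X - c) ^ k * g - δ * h` with `g(c)`, `h(c)` prime to `q` and the `q`-adic valuation of
`δ` positive and prime to `k`, then inertia at `q` permutes transitively the `k` roots of `F`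
which are congruent to `c`. -/
theorem exists_mem_inertia_perm_eq [IsGalois ℚ L] [hq : Fact q.Prime] {c δ : ℤ} {k v : ℕ}
    {g h : ℤ[X]} (hF : F = (X - C c) ^ k * g - C δ * h) (hv : 0 < v)
    (hδ : emultiplicity (q : ℤ) δ = v) (hk : k.Coprime v)
    (hg : ¬ (q : ℤ) ∣ g.eval c) (hh : ¬ (q : ℤ) ∣ h.eval c)
    {i j : Fin n} (hi : R.root i - c ∈ P) (hj : R.root j - c ∈ P) :
    ∃ σ ∈ P.inertia Gal(L/ℚ), R.perm σ i = j := by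
  classical
  have hP := ne_bot_of_liesOver_natPrime q P
  have hPp : Prime P := Ideal.prime_of_isPrime hP inferInstance
  set I := P.inertia Gal(L/ℚ) with hI
  have hI0 : 0 < Nat.card I := Nat.card_pos
  have hδ0 : δ ≠ 0 := by
    rintro rfl
    simp at hδ
  have hqδ : (q : ℤ) ∣ δ := by
    have := pow_dvd_of_le_emultiplicity hδ.ge
    exact (dvd_pow_self _ hv.ne').trans this
  set T := Finset.univ.filter fun i => R.root i - c ∈ P with hT
  have hTc : T.card = k := by
    rw [← R.card_root_sub_mem q P hF hqδ hg]
  set w : 𝓞 L → ℕ∞ := fun x => emultiplicity P (Ideal.span {x}) with hw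
  have hw0 : ∀ x ∉ P, w x = 0 := fun x hx => emultiplicity_eq_zero.2 (by
    rwa [Ideal.dvd_span_singleton])
  have hwm : ∀ x y, w (x * y) = w x + w y := fun x y => by
    simp only [hw, ← Ideal.span_singleton_mul_span_singleton, emultiplicity_mul hPp]
  have hwp : ∀ (s : Finset (Fin n)) (f : Fin n → 𝓞 L), w (∏ i ∈ s, f i) = ∑ i ∈ s, w (f i) := by
    intro s f
    simp only [hw, ← Ideal.prod_span_singleton, Finset.emultiplicity_prod hPp]
  have hroot : ∀ i ∈ T, R.root i - c ≠ 0 ∧ k * w (R.root i - c) = Nat.card I * v := by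
    intro i hi
    replace hi : R.root i - c ∈ P := (Finset.mem_filter.1 hi).2
    have h0 := R.aeval_root i
    have h1 : (R.root i - c) ^ k * aeval (R.root i) g = (δ : 𝓞 L) * aeval (R.root i) h := by
      have h1 := congrArg (aeval (R.root i)) hF
      rw [h0] at h1
      simpa [sub_eq_zero] using h1.symm
    have h2 : aeval (R.root i) h ∉ P := by rwa [aeval_intCast_mem_iff (q := q) hi]
    have h3 : aeval (R.root i) g ∉ P := by rwa [aeval_intCast_mem_iff (q := q) hi]
    have h4 : ∀ (x : 𝓞 L) (m : ℕ), w (x ^ m) = m * w x := by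
      intro x m
      simp only [hw, ← Ideal.span_singleton_pow, emultiplicity_pow hPp]
    have h5 := congrArg w h1
    rw [hwm, hwm, hw0 _ h2, hw0 _ h3, add_zero, add_zero, h4, show w δ = _ from
        emultiplicity_intCast q P δ,
      hδ] at h5
    refine ⟨fun h => ?_, h5⟩
    rw [h, zero_pow (by rw [← hTc]; exact (Finset.card_pos.2 ⟨i, by simpa [hT] using hi⟩).ne'),
      zero_mul, eq_comm, mul_eq_zero] at h1
    rcases h1 with h1 | h1
    · exact hδ0 (by exact_mod_cast h1)
    · exact h2 (h1 ▸ P.zero_mem)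
  have hsub : ∀ σ : Gal(L/ℚ), ∀ j, R.root (R.perm σ j) - c = σ • (R.root j - c) := by
    intro σ j
    have : σ • (c : 𝓞 L) = c := by
      have := smul_algebraMap σ (A := 𝓞 L) c
      simpa using this
    rw [smul_sub, R.root_perm, this]
  set O := Finset.univ.filter fun j => ∃ σ ∈ I, R.perm σ i = j with hO
  have hOT : O ⊆ T := by
    intro j hj
    simp only [hO, hT, Finset.mem_filter, Finset.mem_univ, true_and] at hj ⊢
    obtain ⟨σ, hσ, rfl⟩ := hj
    rw [hsub]
    have := hσ (R.root i - c)
    simpa using P.add_mem this hi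
  have hO0 : 0 < O.card := Finset.card_pos.2
    ⟨i, Finset.mem_filter.2 ⟨Finset.mem_univ i, 1, I.one_mem, by simp⟩⟩
  have hfix : ∀ σ ∈ I, σ • (∏ j ∈ O, (R.root j - c)) = ∏ j ∈ O, (R.root j - c) := by
    intro σ hσ
    rw [Finset.smul_prod']
    refine Finset.prod_equiv (R.perm σ) (fun j => ?_) (fun j _ => (hsub σ j).symm)
    simp only [hO, Finset.mem_filter, Finset.mem_univ, true_and]
    constructor
    · rintro ⟨τ, hτ, rfl⟩
      exact ⟨σ * τ, I.mul_mem hσ hτ, by simp⟩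
    · rintro ⟨τ, hτ, h⟩
      exact ⟨σ⁻¹ * τ, I.mul_mem (I.inv_mem hσ) hτ, by simp [h]⟩
  obtain ⟨m, hm⟩ := exists_emultiplicity_eq_of_fixed I P hP le_rfl
    (Finset.prod_ne_zero_iff.2 fun j hj => (hroot j (hOT hj)).1) hfix
  have hsum : (k : ℕ∞) * (Nat.card I * m : ℕ) = O.card * (Nat.card I * v) := by
    rw [← hm]
    change (k : ℕ∞) * w _ = _
    rw [hwp, Finset.mul_sum, Finset.sum_congr rfl fun j hj => (hroot j (hOT hj)).2]
    simp
  have hsum' : Nat.card I * (k * m) = Nat.card I * (O.card * v) := by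
    have : k * (Nat.card I * m) = O.card * (Nat.card I * v) := by exact_mod_cast hsum
    linarith
  have hdvd : k ∣ O.card * v := ⟨m, (Nat.eq_of_mul_eq_mul_left hI0 hsum').symm⟩
  have hle : T.card ≤ O.card := hTc ▸ Nat.le_of_dvd hO0 (hk.dvd_of_dvd_mul_right hdvd)
  have hjO : j ∈ O := by
    rw [Finset.eq_of_subset_of_card_le hOT hle]
    simpa [hT] using hj
  exact (Finset.mem_filter.1 hjO).2

end RootLabelling

theorem exists_mem_pow_of_prod_mem_pow {A : Type*} [CommRing A] [IsDedekindDomain A] {P : Ideal A}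
    [P.IsPrime] (hP : P ≠ ⊥) {n m : ℕ} (hn : 0 < n) (f : Fin n → A)
    (h : ∏ i, f i ∈ P ^ (n * m)) : ∃ i, f i ∈ P ^ m := by
  have hPp : Prime P := Ideal.prime_of_isPrime hP inferInstance
  by_contra! hf
  have h1 : ∀ i, emultiplicity P (Ideal.span {f i}) < m := fun i => by
    rw [emultiplicity_lt_iff_not_dvd, Ideal.dvd_span_singleton]
    exact hf i
  have h2 : ((n * m : ℕ) : ℕ∞) ≤ emultiplicity P (Ideal.span {∏ i, f i}) :=
    le_emultiplicity_of_pow_dvd (Ideal.dvd_span_singleton.2 h)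
  rw [← Ideal.prod_span_singleton, Finset.emultiplicity_prod hPp] at h2
  have h3 : ∀ i, ∃ k : ℕ, emultiplicity P (Ideal.span {f i}) = k := fun i =>
    ⟨_, (ENat.natCast_toNat (h1 i).ne_top).symm⟩
  choose k hk using h3
  simp only [hk] at h1 h2
  have h4 : ∑ i, k i < ∑ i : Fin n, m :=
    Finset.sum_lt_sum_of_nonempty ⟨⟨0, hn⟩, Finset.mem_univ _⟩ fun i _ => by exact_mod_cast h1 i
  have h5 : n * m ≤ ∑ i, k i := by exact_mod_cast h2
  simp at h4
  omega

namespace RootLabelling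
variable {F F' : ℤ[X]} {n : ℕ} {L : Type*} [Field L] [NumberField L] (R : RootLabelling F n L)
  (R' : RootLabelling F' n L)
  (q : ℕ) (P : Ideal (𝓞 L)) [P.IsPrime] [P.LiesOver (Ideal.span {(q : ℤ)})]

/-- A form of Krasner's lemma: if two polynomials are `q`-adically close, inertia at `q` acts
trivially on the roots of one of them if and only if it acts trivially on those of the other. -/
theorem inertia_perm_eq_one_iff [IsGalois ℚ L] [hq : Fact q.Prime] (hn : 0 < n) {D : ℤ} {M : ℕ}
    (hD : ∀ i j, i ≠ j → R.root i - R.root j ∣ (D : 𝓞 L)) (hM : ¬ (q : ℤ) ^ M ∣ D)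
    (hF : C ((q : ℤ) ^ (n * M)) ∣ F' - F) :
    (∀ σ ∈ P.inertia Gal(L/ℚ), R.perm σ = 1) ↔ ∀ σ ∈ P.inertia Gal(L/ℚ), R'.perm σ = 1 := by
  have hP := ne_bot_of_liesOver_natPrime q P
  have hPp : Prime P := Ideal.prime_of_isPrime hP inferInstance
  set I := P.inertia Gal(L/ℚ) with hI
  set m := Nat.card I * M with hm
  have hcast : ∀ (z : ℤ) (M : ℕ), (z : 𝓞 L) ∈ P ^ (Nat.card I * M) ↔ (q : ℤ) ^ M ∣ z := by
    intro z M
    rw [← Ideal.dvd_span_singleton, pow_dvd_iff_le_emultiplicity, emultiplicity_intCast q P,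
      pow_dvd_iff_le_emultiplicity]
    push_cast
    have : (Nat.card I : ℕ∞) ≠ 0 := by exact_mod_cast Nat.card_pos.ne'
    exact ENat.mul_le_mul_left_iff this (ENat.natCast_ne_top _)
  have hsep : ∀ i j, R.root i - R.root j ∈ P ^ m → i = j := by
    intro i j h
    by_contra hij
    refine hM ((hcast D M).1 (Ideal.mem_of_dvd _ (hD i j hij) h))
  have hex : ∀ i, ∃ j, R.root i - R'.root j ∈ P ^ m := by
    intro i
    apply exists_mem_pow_of_prod_mem_pow hP hn
    rw [← R'.aeval_eq]
    obtain ⟨g, hg⟩ := hF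
    have h1 : aeval (R.root i) F' = ((q ^ (n * M) : ℤ) : 𝓞 L) * aeval (R.root i) g := by
      have := congrArg (aeval (R.root i)) hg
      rw [map_sub, R.aeval_root, sub_zero, map_mul, aeval_C] at this
      simpa using this
    rw [h1, show n * m = Nat.card I * (n * M) by rw [hm]; ring]
    exact Ideal.mul_mem_right _ _ ((hcast _ _).2 dvd_rfl)
  choose b hb using hex
  have hbi : Function.Injective b := fun i j hij => by
    apply hsep
    have h1 := hb i
    have h2 := hb j
    rw [hij] at h1
    simpa using Ideal.sub_mem _ h1 h2
  have hbs : Function.Surjective b := Finite.surjective_of_injective hbi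
  have hsm : ∀ σ ∈ I, ∀ x ∈ P ^ m, σ • x ∈ P ^ m := by
    intro σ hσ x hx
    have h1 : P.map (MulSemiringAction.toRingHom Gal(L/ℚ) (𝓞 L) σ) ≤ P := by
      rw [Ideal.map_le_iff_le_comap]
      intro x hx
      simpa using P.add_mem (hσ x) hx
    have h2 := Ideal.mem_map_of_mem (MulSemiringAction.toRingHom Gal(L/ℚ) (𝓞 L) σ) hx
    rw [Ideal.map_pow] at h2
    exact Ideal.pow_right_mono h1 m h2
  have hequiv : ∀ σ ∈ I, ∀ i, b (R.perm σ i) = R'.perm σ (b i) := by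
    intro σ hσ i
    obtain ⟨j, hj⟩ := hbs (R'.perm σ (b i))
    rw [← hj]
    congr 1
    apply hsep
    have h1 := hsm σ hσ _ (hb i)
    rw [smul_sub, ← root_perm, ← root_perm, ← hj] at h1
    simpa using Ideal.sub_mem _ h1 (hb j)
  constructor
  · intro h σ hσ
    ext1 j
    obtain ⟨i, rfl⟩ := hbs j
    rw [← hequiv σ hσ, h σ hσ]
    rfl
  · intro h σ hσ
    ext1 i
    apply hbi
    rw [hequiv σ hσ, h σ hσ]
    rfl

end RootLabelling

theorem exists_numberField_isSplittingField (f : ℚ[X]) :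
    ∃ (K : Type) (_ : Field K) (_ : NumberField K), IsSplittingField ℚ K f := by
  have h0 : CharZero f.SplittingField := inferInstance
  have h2 := IsSplittingField.splittingField f
  have h1 := @IsSplittingField.finiteDimensional _ _ _ _ _ f h2
  refine ⟨f.SplittingField, inferInstance, @NumberField.mk _ _ h0 ?_, ?_⟩
  · convert! h1
  · convert! h2

theorem exists_rootLabelling {F : ℤ[X]} {n : ℕ} (hm : F.Monic) (hn : F.natDegree = n)
    (hs : (F.map (algebraMap ℤ ℚ)).Separable) {L : Type*} [Field L] [NumberField L]
    (hsp : (F.map (algebraMap ℤ L)).Splits) : Nonempty (RootLabelling F n L) := by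
  classical
  have hs' : (F.map (algebraMap ℤ L)).Separable := by
    have := hs.map (f := algebraMap ℚ L)
    rwa [Polynomial.map_map, ← IsScalarTower.algebraMap_eq] at this
  set s := (F.map (algebraMap ℤ L)).roots with hsdef
  have hnd : s.Nodup := nodup_roots hs'
  have hcard : Fintype.card s.toFinset = n := by
    rw [Fintype.card_coe, Multiset.toFinset_card_of_nodup hnd, hsdef,
      ← hsp.natDegree_eq_card_roots, hm.natDegree_map, hn]
  let e : Fin n ≃ s.toFinset := (finCongr hcard.symm).trans (Fintype.equivFin _).symm
  have hcast : ∀ i, IsIntegral ℤ (e i : L) := fun i => by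
    have h1 : (e i : L) ∈ s := Multiset.mem_toFinset.1 (e i).2
    exact ⟨F, hm, by
      have := (mem_roots'.1 h1).2
      rwa [IsRoot.def, eval_map] at this⟩
  let r : Fin n → 𝓞 L := fun i => ⟨e i, hcast i⟩
  have hr : ∀ i, algebraMap (𝓞 L) L (r i) = e i := fun _ => rfl
  refine ⟨⟨r, ?_, ?_⟩⟩
  · apply Polynomial.map_injective (algebraMap (𝓞 L) L) RingOfIntegers.coe_injective
    rw [Polynomial.map_map, ← IsScalarTower.algebraMap_eq, Polynomial.map_prod]
    have h1 := hsp.eq_prod_roots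
    rw [(hm.map _).leadingCoeff, C_1, one_mul] at h1
    rw [h1]
    simp only [Polynomial.map_sub, map_X, map_C, hr]
    have h2 : ∏ i : Fin n, (X - C (e i : L)) = ∏ a ∈ s.toFinset, (X - C a) := by
      rw [e.prod_comp fun a : s.toFinset => X - C (a : L)]
      exact Finset.prod_coe_sort s.toFinset fun a => X - C a
    rw [h2, Finset.prod_multiset_map_count, ← hsdef]
    refine Finset.prod_congr rfl fun a ha => ?_
    rw [Multiset.count_eq_one_of_mem hnd (Multiset.mem_toFinset.1 ha), pow_one]
  · intro i j hij
    apply e.injective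
    have := congrArg (algebraMap (𝓞 L) L) hij
    exact Subtype.ext this

theorem exists_bezout_derivative {F : ℤ[X]} (hs : (F.map (algebraMap ℤ ℚ)).Separable) :
    ∃ D : ℤ, D ≠ 0 ∧ ∃ u v : ℤ[X], u * F + v * derivative F = C D := by
  obtain ⟨a, b, hab⟩ := hs
  obtain ⟨d, hd0, hd⟩ := IsLocalization.integerNormalization_spec (nonZeroDivisors ℤ) a
  obtain ⟨d', hd0', hd'⟩ := IsLocalization.integerNormalization_spec (nonZeroDivisors ℤ) b
  set A := IsLocalization.integerNormalization (nonZeroDivisors ℤ) a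
  set B := IsLocalization.integerNormalization (nonZeroDivisors ℤ) b
  refine ⟨d * d', mul_ne_zero (nonZeroDivisors.ne_zero hd0) (nonZeroDivisors.ne_zero hd0'),
    C d' * A, C d * B, ?_⟩
  apply Polynomial.map_injective (algebraMap ℤ ℚ) Int.cast_injective
  rw [Polynomial.map_add, Polynomial.map_mul, Polynomial.map_mul, Polynomial.map_mul,
    Polynomial.map_mul, hd, hd', ← derivative_map, map_C, map_C, map_C]
  simp only [zsmul_eq_mul, eq_intCast, Int.cast_mul, C_mul]
  have h : ∀ z : ℤ, ((z : ℤ) : ℚ[X]) = C (z : ℚ) := fun z => by simp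
  rw [h, h]
  linear_combination C (d : ℚ) * C (d' : ℚ) * hab

namespace RootLabelling
variable {F : ℤ[X]} {n : ℕ} {L : Type*} [Field L] [NumberField L] (R : RootLabelling F n L)

theorem sub_dvd_of_bezout {D : ℤ} {u v : ℤ[X]} (h : u * F + v * derivative F = C D) {i j : Fin n}
    (hij : i ≠ j) : R.root i - R.root j ∣ (D : 𝓞 L) := by
  have h1 := congrArg (aeval (R.root i)) h
  rw [map_add, map_mul, map_mul, R.aeval_root, mul_zero, zero_add, aeval_C, R.aeval_derivative]
    at h1
  have h2 : (D : 𝓞 L) = algebraMap ℤ (𝓞 L) D := by simp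
  rw [h2, ← h1]
  exact (Finset.dvd_prod_of_mem _ (Finset.mem_erase.2 ⟨hij.symm, Finset.mem_univ j⟩)).mul_left _

include R in
theorem map_algebraMap_eq : F.map (algebraMap ℤ L) = ∏ i, (X - C (R.root i : L)) := by
  rw [IsScalarTower.algebraMap_eq ℤ (𝓞 L) L, ← Polynomial.map_map, R.map_eq, Polynomial.map_prod]
  simp

theorem perm_eq_one_iff {σ : Gal(L/ℚ)} :
    R.perm σ = 1 ↔ ∀ i, σ (R.root i : L) = R.root i := by
  constructor
  · intro h i
    have := R.root_perm σ i
    rw [h] at this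
    exact (congrArg (algebraMap (𝓞 L) L) this).symm
  · intro h
    ext i
    congr 1
    apply R.injective
    rw [root_perm]
    exact RingOfIntegers.ext (h i)

theorem perm_eq_one_iff_of_isSplittingField {K : Type*} [Field K] [Algebra ℚ K]
    [hK : IsSplittingField ℚ K (F.map (algebraMap ℤ ℚ))] (f : K →ₐ[ℚ] L) {σ : Gal(L/ℚ)} :
    R.perm σ = 1 ↔ ∀ x, σ (f x) = f x := by
  have hset : (F.map (algebraMap ℤ ℚ)).rootSet L = Set.range fun i => (R.root i : L) := by
    ext x
    have h0 : (F.map (algebraMap ℤ ℚ)).map (algebraMap ℚ L) = ∏ i, (X - C (R.root i : L)) := by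
      rw [Polynomial.map_map, ← IsScalarTower.algebraMap_eq, R.map_algebraMap_eq]
    have h1 : ∏ i, (X - C (R.root i : L)) ≠ 0 :=
      Finset.prod_ne_zero_iff.2 fun i _ => X_sub_C_ne_zero _
    rw [mem_rootSet', ← eval_map_algebraMap, h0, eval_prod, Finset.prod_eq_zero_iff]
    simp only [eval_sub, eval_X, eval_C, Finset.mem_univ, true_and, sub_eq_zero, ne_eq, h1,
      not_false_eq_true, Set.mem_range]
    exact exists_congr fun _ => eq_comm
  have himg := (hK.splits).image_rootSet f
  rw [perm_eq_one_iff]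
  constructor
  · intro h
    have : (σ : L →ₐ[ℚ] L).comp f = f := by
      refine AlgHom.ext_of_adjoin_eq_top hK.adjoin_rootSet fun x hx => ?_
      have : f x ∈ Set.range fun i => (R.root i : L) := by
        rw [← hset, ← himg]
        exact ⟨x, hx, rfl⟩
      obtain ⟨i, hi⟩ := this
      simp only at hi
      simp [← hi, h i]
    exact fun x => DFunLike.congr_fun this x
  · intro h i
    have : (R.root i : L) ∈ (F.map (algebraMap ℤ ℚ)).rootSet L := hset ▸ ⟨i, rfl⟩
    rw [← himg] at this
    obtain ⟨x, -, hx⟩ := this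
    rw [← hx]
    exact h x

theorem natPrime_dvd_discr_iff [IsGalois ℚ L] (K : Type*) [Field K] [NumberField K]
    [IsGalois ℚ K] [hK : IsSplittingField ℚ K (F.map (algebraMap ℤ ℚ))]
    (q : ℕ) [hq : Fact q.Prime] (P : Ideal (𝓞 L))
    [P.IsPrime] [P.LiesOver (Ideal.span {(q : ℤ)})] :
    (q : ℤ) ∣ discr K ↔ ∃ σ ∈ P.inertia Gal(L/ℚ), R.perm σ ≠ 1 := by
  have hsp : ((F.map (algebraMap ℤ ℚ)).map (algebraMap ℚ L)).Splits := by
    rw [Polynomial.map_map, ← IsScalarTower.algebraMap_eq, R.map_algebraMap_eq]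
    exact Splits.prod fun i _ => Splits.X_sub_C _
  let f : K →ₐ[ℚ] L := IsSplittingField.lift K _ hsp
  let : Algebra K L := f.toRingHom.toAlgebra
  rw [_root_.natPrime_dvd_discr_iff (L := L) q P]
  refine exists_congr fun σ => and_congr_right fun hσ => ?_
  rw [Ne, R.perm_eq_one_iff_of_isSplittingField f]
  push Not
  rfl

end RootLabelling

theorem isGalois_of_isSplittingField_map {F : ℤ[X]} (hs : (F.map (algebraMap ℤ ℚ)).Separable)
    (K : Type*) [Field K] [NumberField K] [IsSplittingField ℚ K (F.map (algebraMap ℤ ℚ))] :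
    IsGalois ℚ K :=
  IsGalois.of_separable_splitting_field hs

theorem exists_prime_liesOver (L : Type*) [Field L] [NumberField L] (q : ℕ) [hq : Fact q.Prime] :
    ∃ P : Ideal (𝓞 L), P.IsPrime ∧ P.LiesOver (Ideal.span {(q : ℤ)}) := by
  have hqp : Prime (q : ℤ) := Nat.prime_iff_prime_int.1 hq.out
  have hqi : (Ideal.span {(q : ℤ)}).IsPrime := (Ideal.span_singleton_prime hqp.ne_zero).2 hqp
  obtain ⟨⟨P, h1, h2⟩⟩ := (Ideal.span {(q : ℤ)}).nonempty_primesOver (S := 𝓞 L)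
  exact ⟨P, h1, h2⟩

/-- Polynomials which are `q`-adically close have splitting fields with the same ramification at
`q`, uniformly in `q`. -/
theorem exists_forall_dvd_discr_iff {F : ℤ[X]} {n : ℕ} (hn : 0 < n) (hm : F.Monic)
    (hd : F.natDegree = n) (hs : (F.map (algebraMap ℤ ℚ)).Separable)
    (K : Type*) [Field K] [NumberField K] [IsSplittingField ℚ K (F.map (algebraMap ℤ ℚ))] :
    ∃ N : ℕ, ∀ (q : ℕ) [Fact q.Prime] (F' : ℤ[X]), F'.Monic → F'.natDegree = n →
      (F'.map (algebraMap ℤ ℚ)).Separable → C ((q : ℤ) ^ N) ∣ F' - F →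
      ∀ (K' : Type*) [Field K'] [NumberField K']
        [IsSplittingField ℚ K' (F'.map (algebraMap ℤ ℚ))],
        (q : ℤ) ∣ discr K' ↔ (q : ℤ) ∣ discr K := by
  obtain ⟨D, hD0, u, v, huv⟩ := exists_bezout_derivative hs
  refine ⟨n * D.natAbs, fun q hq F' hm' hd' hs' hF K' _ _ _ => ?_⟩
  have := isGalois_of_isSplittingField_map hs K
  have := isGalois_of_isSplittingField_map hs' K'
  obtain ⟨L, _, _, hL⟩ := exists_numberField_isSplittingField
    (F.map (algebraMap ℤ ℚ) * F'.map (algebraMap ℤ ℚ))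
  have hne : (F.map (algebraMap ℤ ℚ) * F'.map (algebraMap ℤ ℚ)).map (algebraMap ℚ L) ≠ 0 :=
    (((hm.map _).mul (hm'.map _)).map _).ne_zero
  have hLs := hL.splits
  rw [Polynomial.map_mul] at hLs hne
  have h1 : (F.map (algebraMap ℤ L)).Splits := by
    have := hLs.of_dvd hne (dvd_mul_right _ _)
    rwa [Polynomial.map_map, ← IsScalarTower.algebraMap_eq] at this
  have h2 : (F'.map (algebraMap ℤ L)).Splits := by
    have := hLs.of_dvd hne (dvd_mul_left _ _)
    rwa [Polynomial.map_map, ← IsScalarTower.algebraMap_eq] at this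
  have hLn : Normal ℚ L := Normal.of_isSplittingField
    (F.map (algebraMap ℤ ℚ) * F'.map (algebraMap ℤ ℚ))
  have : IsGalois ℚ L := ⟨⟩
  obtain ⟨R⟩ := exists_rootLabelling hm hd hs h1
  obtain ⟨R'⟩ := exists_rootLabelling hm' hd' hs' h2
  obtain ⟨P, _, _⟩ := exists_prime_liesOver L q
  rw [R.natPrime_dvd_discr_iff K q P, R'.natPrime_dvd_discr_iff K' q P]
  have hM : ¬ (q : ℤ) ^ D.natAbs ∣ D := by
    intro h
    have := Nat.le_of_dvd (Int.natAbs_pos.2 hD0) (Int.natAbs_dvd_natAbs.2 h)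
    rw [Int.natAbs_pow, Int.natAbs_natCast] at this
    exact absurd this (not_le.2 (Nat.lt_pow_self hq.out.one_lt))
  have := RootLabelling.inertia_perm_eq_one_iff R R' q P hn
    (fun i j hij => R.sub_dvd_of_bezout huv hij) hM hF
  rw [← not_iff_not]
  push Not
  exact this.symm

open scoped Pointwise in
theorem isPreprimitive_of_fixed {n : ℕ} (hn : 3 < n) {G : Subgroup (Equiv.Perm (Fin n))}
    [MulAction.IsPretransitive G (Fin n)] {T : Finset (Fin n)}
    (hT : ∀ i ∉ T, ∀ j ∉ T, ∃ g ∈ G, g i = j ∧ ∀ k ∈ T, g k = k)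
    (hc : T.card = 1 ∨ T.card = 2 ∧ Odd n) : MulAction.IsPreprimitive G (Fin n) := by
  classical
  have hT0 : T.Nonempty := Finset.card_pos.1 (by omega)
  obtain ⟨a, ha⟩ := hT0
  refine MulAction.IsPreprimitive.of_isTrivialBlock_base a fun {B} haB hB => ?_
  by_cases h : ∃ i ∈ B, i ∉ T
  · right
    obtain ⟨i, hiB, hi⟩ := h
    have hsub : ∀ j ∉ T, j ∈ B := by
      intro j hj
      obtain ⟨g, hg, hgi, hgk⟩ := hT i hi j hj
      have h1 : (⟨g, hg⟩ : G) • B = B := hB.smul_eq_of_mem haB (by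
        change g a ∈ B
        rwa [hgk a ha])
      rw [← h1, ← hgi]
      exact ⟨i, hiB, rfl⟩
    apply hB.eq_univ_of_card_lt
    have h2 : ((insert a Tᶜ : Finset (Fin n)) : Set (Fin n)) ⊆ B := by
      intro j hj
      rcases Finset.mem_insert.1 (Finset.mem_coe.1 hj) with rfl | hj
      · exact haB
      · exact hsub j (Finset.mem_compl.1 hj)
    have h3 := Set.ncard_le_ncard h2 B.toFinite
    rw [Set.ncard_coe_finset, Finset.card_insert_of_notMem (by simpa using ha), Finset.card_compl,
      Fintype.card_fin] at h3
    rw [Nat.card_fin]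
    omega
  · left
    push Not at h
    have h1 : B ⊆ T := fun i hi => Finset.mem_coe.2 (h i hi)
    have h2 := Set.ncard_le_ncard h1 (Set.toFinite _)
    rw [Set.ncard_coe_finset] at h2
    have h3 := hB.ncard_dvd_card ⟨a, haB⟩
    rw [Nat.card_fin] at h3
    rw [← Set.ncard_le_one_iff_subsingleton]
    by_contra h4
    have h5 : B.ncard = 2 := by omega
    rw [h5] at h3
    rcases hc with hc | ⟨hc, hodd⟩
    · omega
    · exact (Nat.not_even_iff_odd.2 hodd) (even_iff_two_dvd.2 h3)

theorem isThreeCycle_of_fixed {n : ℕ} {g : Equiv.Perm (Fin n)} (h1 : g ≠ 1)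
    (hs : Equiv.Perm.sign g = 1) {T : Finset (Fin n)} (hT : T.card ≤ 3) (hf : ∀ i ∉ T, g i = i) :
    g.IsThreeCycle := by
  rw [← card_support_eq_three_iff]
  have h2 : g.support ⊆ T := fun i hi => by
    by_contra h
    exact Equiv.Perm.mem_support.1 hi (hf i h)
  have h3 := Finset.card_le_card h2
  have h4 : ¬ g.support.card ≤ 1 := by rwa [Equiv.Perm.card_support_le_one]
  have h5 : g.support.card ≠ 2 := by
    rw [Ne, Equiv.Perm.card_support_eq_two]
    intro h
    rw [h.sign_eq] at hs
    exact absurd hs (by decide)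
  omega

theorem eq_one_of_fixed {n : ℕ} {g : Equiv.Perm (Fin n)}
    (hs : Equiv.Perm.sign g = 1) {T : Finset (Fin n)} (hT : T.card ≤ 2) (hf : ∀ i ∉ T, g i = i) :
    g = 1 := by
  by_contra h
  have h1 := (isThreeCycle_of_fixed h hs (hT.trans (by norm_num)) hf).card_support
  have h2 : g.support ⊆ T := fun i hi => by
    by_contra h
    exact Equiv.Perm.mem_support.1 hi (hf i h)
  have h3 := Finset.card_le_card h2
  omega

namespace RootLabelling
variable {F : ℤ[X]} {n : ℕ} {L : Type*} [Field L] [NumberField L] (R : RootLabelling F n L)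

theorem prod_aeval_derivative :
    ∏ i, aeval (R.root i) (derivative F) =
      (-1) ^ (n * (n - 1) / 2) * (Matrix.vandermonde R.root).det ^ 2 := by
  simp_rw [R.aeval_derivative]
  have h := Finset.prod_prod_Ioi_mul_eq_prod_prod_off_diag fun i j => R.root j - R.root i
  simp_rw [← Finset.compl_singleton]
  rw [← h, Matrix.det_vandermonde, ← Finset.prod_pow]
  have h1 : ∀ i : Fin n, ∏ j ∈ Finset.Ioi i, (R.root i - R.root j) * (R.root j - R.root i) =
      (-1) ^ (n - 1 - (i : ℕ)) * (∏ j ∈ Finset.Ioi i, (R.root j - R.root i)) ^ 2 := by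
    intro i
    rw [← Fin.card_Ioi, ← Finset.prod_const, ← Finset.prod_pow, ← Finset.prod_mul_distrib]
    exact Finset.prod_congr rfl fun j _ => by ring
  rw [Finset.prod_congr rfl fun i _ => h1 i, Finset.prod_mul_distrib, Finset.prod_pow_eq_pow_sum]
  congr 2
  rw [← Finset.sum_range_id, ← Finset.sum_range_reflect fun i => i,
    ← Fin.sum_univ_eq_sum_range fun i => n - 1 - i]

theorem sign_perm_eq_one {y z : ℤ} (hy : y ≠ 0)
    (h : (y : 𝓞 L) ^ 2 * ((-1) ^ (n * (n - 1) / 2) * ∏ i, aeval (R.root i) (derivative F)) =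
      (z : 𝓞 L) ^ 2) (σ : Gal(L/ℚ)) : Equiv.Perm.sign (R.perm σ) = 1 := by
  set V := (Matrix.vandermonde R.root).det with hV
  have hV0 : V ≠ 0 := Matrix.det_vandermonde_ne_zero_iff.2 R.injective
  have hσ : σ • V = (Equiv.Perm.sign (R.perm σ) : ℤ) * V := by
    have h1 : σ • V = MulSemiringAction.toRingHom Gal(L/ℚ) (𝓞 L) σ V := rfl
    rw [h1, hV, RingHom.map_det, ← Matrix.det_permute]
    congr 1
    ext i j
    simp only [RingHom.mapMatrix_apply, Matrix.map_apply, Matrix.vandermonde_apply,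
      Matrix.submatrix_apply, id_eq, map_pow, R.root_perm]
    rfl
  rw [R.prod_aeval_derivative, ← hV, ← mul_assoc (_ ^ (n * (n - 1) / 2)), ← pow_add,
      Even.neg_one_pow ⟨_, rfl⟩, one_mul,
    ← mul_pow] at h
  have hy' : (y : 𝓞 L) ≠ 0 := by exact_mod_cast hy
  have hfix : σ • ((y : 𝓞 L) * V) = (y : 𝓞 L) * V := by
    have hcast : ∀ m : ℤ, σ • (m : 𝓞 L) = m := fun m =>
      map_intCast (MulSemiringAction.toRingHom Gal(L/ℚ) (𝓞 L) σ) m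
    rcases sq_eq_sq_iff_eq_or_eq_neg.1 h with h | h
    · rw [h, hcast]
    · rw [h, smul_neg, hcast]
  have hcast : σ • (y : 𝓞 L) = y :=
      map_intCast (MulSemiringAction.toRingHom Gal(L/ℚ) (𝓞 L) σ) y
  rw [smul_mul', hcast, hσ] at hfix
  have h2 := mul_right_cancel₀ hV0 ((mul_left_cancel₀ hy' hfix).trans (one_mul V).symm)
  have h3 : ((Equiv.Perm.sign (R.perm σ) : ℤ)) = 1 := by exact_mod_cast h2
  exact Units.ext h3

theorem perm_injective [IsSplittingField ℚ L (F.map (algebraMap ℤ ℚ))] :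
    Function.Injective R.perm := by
  rw [injective_iff_map_eq_one]
  intro σ hσ
  ext x
  exact (R.perm_eq_one_iff_of_isSplittingField (AlgHom.id ℚ L)).1 hσ x

theorem nonempty_mulEquiv_alternatingGroup [IsSplittingField ℚ L (F.map (algebraMap ℤ ℚ))]
    (hprim : MulAction.IsPreprimitive R.perm.range (Fin n))
    (hsign : ∀ σ, Equiv.Perm.sign (R.perm σ) = 1)
    {τ : Gal(L/ℚ)} (hτ : (R.perm τ).IsThreeCycle) :
    Nonempty (Gal(L/ℚ) ≃* alternatingGroup (Fin n)) := by
  have h1 := Equiv.Perm.alternatingGroup_le_of_isPreprimitive_of_isThreeCycle_mem hprim hτ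
    ⟨τ, rfl⟩
  have h2 : R.perm.range = alternatingGroup (Fin n) := by
    refine le_antisymm ?_ h1
    rintro _ ⟨σ, rfl⟩
    exact Equiv.Perm.mem_alternatingGroup.2 (hsign σ)
  exact ⟨(MonoidHom.ofInjective R.perm_injective).trans (MulEquiv.subgroupCongr h2)⟩

end RootLabelling

/-- If `S + t Q` vanishes to order `k` at `x`, the Wronskian of `S` and `Q` vanishes to order
`k - 1` at `x`, with explicit leading coefficient. -/
theorem eval_of_wronskian_eq {S Q g h : ℤ[X]} {t x : ℤ} {k : ℕ} (hk : 0 < k)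
    (hS : S + C t * Q = (X - C x) ^ k * g)
    (hw : derivative S * Q - S * derivative Q = (X - C x) ^ (k - 1) * h) :
    k * g.eval x * Q.eval x = h.eval x := by
  obtain ⟨k, rfl⟩ := Nat.exists_eq_succ_of_ne_zero hk.ne'
  rw [Nat.succ_sub_one] at hw
  have h1 : derivative (S + C t * Q) * Q - (S + C t * Q) * derivative Q =
      (X - C x) ^ k * h := by
    rw [← hw]
    simp only [derivative_add, derivative_mul, derivative_C]
    ring
  rw [hS, derivative_mul, derivative_X_sub_C_pow] at h1
  have h2 : (X - C x) ^ k * (C ((k : ℤ) + 1) * g * Q + (X - C x) * (derivative g * Q -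
      g * derivative Q)) = (X - C x) ^ k * h := by
    rw [← h1]
    simp only [map_add, C_1, Nat.succ_eq_add_one, Nat.add_sub_cancel]
    push_cast
    simp
    ring
  have h3 := mul_left_cancel₀ (pow_ne_zero k (X_sub_C_ne_zero x)) h2
  rw [← h3]
  simp

/-- A one-parameter family of polynomials `S - ε w ^ 2 Q` whose members have
few critical points. -/
structure CriticalFamily (n : ℕ) where
  (S Q gs gr g0 : ℤ[X])
  (ε a a' c s r : ℤ)
  (κ : ℕ)
  natAbs_ε : ε.natAbs = 1
  monic : S.Monic
  natDegree_S : S.natDegree = n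
  natDegree_Q : Q.natDegree < n
  eq_s : S = (X - C s) ^ 2 * gs
  eq_r : S + C a' * Q = (X - C r) ^ 3 * gr
  eq_zero : S + C a * Q = X ^ κ * g0
  wronskian : derivative S * Q - S * derivative Q =
    C c * (X - C s) * (X - C r) ^ 2 * X ^ (κ - 1)
  four_le_κ : 4 ≤ κ
  ne_zero : c * s * r * (r - s) * a * a' * (a - a') ≠ 0
  isSquare : ∀ (w : ℤ) (L : Type) [Field L] [NumberField L]
    (R : RootLabelling (S - C (ε * w ^ 2) * Q) n L), ∃ y z : ℤ, y ≠ 0 ∧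
      (y : 𝓞 L) ^ 2 * ((-1) ^ (n * (n - 1) / 2) *
        ∏ i, aeval (R.root i) (derivative (S - C (ε * w ^ 2) * Q))) = (z : 𝓞 L) ^ 2

namespace CriticalFamily
variable {n : ℕ} (𝓕 : CriticalFamily n) (w : ℤ)

/-- The member with parameter `w`. -/
noncomputable def poly : ℤ[X] := 𝓕.S - C (𝓕.ε * w ^ 2) * 𝓕.Q

/-- The parameter values for which `0` is a multiple root. -/
def τ : ℤ := 𝓕.a + 𝓕.ε * w ^ 2

/-- The parameter values for which `r` is a multiple root. -/
def ρ : ℤ := 𝓕.a' + 𝓕.ε * w ^ 2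

/-- The primes dividing this integer are excluded from the local analysis. -/
def bad : ℤ := 6 * 𝓕.κ * (𝓕.c * 𝓕.s * 𝓕.r * (𝓕.r - 𝓕.s) * 𝓕.a * 𝓕.a' * (𝓕.a - 𝓕.a'))

theorem bad_ne_zero : 𝓕.bad ≠ 0 :=
  mul_ne_zero (mul_ne_zero (by norm_num) (by have := 𝓕.four_le_κ; positivity)) 𝓕.ne_zero

theorem poly_eq_s : 𝓕.poly w = (X - C 𝓕.s) ^ 2 * 𝓕.gs - C (𝓕.ε * w ^ 2) * 𝓕.Q := by
  rw [poly, ← 𝓕.eq_s]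

theorem poly_eq_r : 𝓕.poly w = (X - C 𝓕.r) ^ 3 * 𝓕.gr - C (𝓕.ρ w) * 𝓕.Q := by
  rw [poly, ← 𝓕.eq_r, ρ, C_add]
  ring

theorem poly_eq_zero : 𝓕.poly w = (X - C 0) ^ 𝓕.κ * 𝓕.g0 - C (𝓕.τ w) * 𝓕.Q := by
  rw [poly, C_0, sub_zero, ← 𝓕.eq_zero, τ, C_add]
  ring

theorem degree_mul_Q_lt : (C (𝓕.ε * w ^ 2) * 𝓕.Q).degree < 𝓕.S.degree := by
  rw [degree_eq_natDegree 𝓕.monic.ne_zero, 𝓕.natDegree_S]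
  refine lt_of_le_of_lt degree_le_natDegree ?_
  exact_mod_cast (natDegree_C_mul_le _ _).trans_lt 𝓕.natDegree_Q

theorem monic_poly : (𝓕.poly w).Monic := 𝓕.monic.sub_of_left (𝓕.degree_mul_Q_lt w)

theorem natDegree_poly : (𝓕.poly w).natDegree = n := by
  rw [poly, natDegree_sub_eq_left_of_natDegree_lt, 𝓕.natDegree_S]
  rw [𝓕.natDegree_S]
  exact (natDegree_C_mul_le _ _).trans_lt 𝓕.natDegree_Q

theorem eval_gs : 2 * 𝓕.gs.eval 𝓕.s * 𝓕.Q.eval 𝓕.s =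
    𝓕.c * (𝓕.s - 𝓕.r) ^ 2 * 𝓕.s ^ (𝓕.κ - 1) := by
  have := eval_of_wronskian_eq (t := 0) (x := 𝓕.s) two_pos (by simpa using 𝓕.eq_s)
    (h := C 𝓕.c * (X - C 𝓕.r) ^ 2 * X ^ (𝓕.κ - 1)) (by rw [𝓕.wronskian]; ring)
  simpa using this

theorem eval_gr : 3 * 𝓕.gr.eval 𝓕.r * 𝓕.Q.eval 𝓕.r =
    𝓕.c * (𝓕.r - 𝓕.s) * 𝓕.r ^ (𝓕.κ - 1) := by
  have := eval_of_wronskian_eq (x := 𝓕.r) three_pos 𝓕.eq_r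
    (h := C 𝓕.c * (X - C 𝓕.s) * X ^ (𝓕.κ - 1)) (by rw [𝓕.wronskian]; ring)
  simpa using this

theorem eval_g0 : 𝓕.κ * 𝓕.g0.eval 0 * 𝓕.Q.eval 0 = - 𝓕.c * 𝓕.s * 𝓕.r ^ 2 := by
  have := eval_of_wronskian_eq (k := 𝓕.κ) (x := 0) (by have := 𝓕.four_le_κ; omega)
    (by simpa using 𝓕.eq_zero)
    (h := C 𝓕.c * (X - C 𝓕.s) * (X - C 𝓕.r) ^ 2) (by rw [𝓕.wronskian]; simp; ring)
  simpa using this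

variable {𝓕} in
theorem c_ne_zero : 𝓕.c ≠ 0 := fun h => 𝓕.ne_zero (by simp [h])
variable {𝓕} in
theorem s_ne_zero : 𝓕.s ≠ 0 := fun h => 𝓕.ne_zero (by simp [h])
variable {𝓕} in
theorem r_ne_zero : 𝓕.r ≠ 0 := fun h => 𝓕.ne_zero (by simp [h])
variable {𝓕} in
theorem r_sub_s_ne_zero : 𝓕.r - 𝓕.s ≠ 0 := fun h => 𝓕.ne_zero (by simp [h])
variable {𝓕} in
theorem ε_ne_zero : 𝓕.ε ≠ 0 := fun h => by have := 𝓕.natAbs_ε; simp [h] at this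

theorem derivative_poly_mul_aeval {A : Type*} [CommRing A] {x : A}
    (hx : aeval x (𝓕.poly w) = 0) :
    aeval x (derivative (𝓕.poly w)) * aeval x 𝓕.Q =
      𝓕.c * (x - 𝓕.s) * (x - 𝓕.r) ^ 2 * x ^ (𝓕.κ - 1) := by
  have h := congrArg (aeval x) 𝓕.wronskian
  have hd : derivative (𝓕.poly w) = derivative 𝓕.S - C (𝓕.ε * w ^ 2) * derivative 𝓕.Q := by
    rw [poly, derivative_sub, derivative_C_mul]
  have hC : ∀ z : ℤ, aeval x (C z) = (z : A) := fun z => by simp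
  rw [poly, map_sub, map_mul, hC] at hx
  simp only [map_sub, map_mul, hC, map_pow, aeval_X] at h
  rw [hd, map_sub, map_mul, hC, ← h]
  linear_combination (aeval x (derivative 𝓕.Q)) * hx

theorem aeval_poly_s {A : Type*} [CommRing A] :
    aeval (𝓕.s : A) (𝓕.poly w) = ((-(𝓕.ε * w ^ 2 * 𝓕.Q.eval 𝓕.s) : ℤ) : A) := by
  rw [poly_eq_s, ← eq_intCast (algebraMap ℤ A), aeval_algebraMap_apply]
  simp

theorem aeval_poly_r {A : Type*} [CommRing A] :
    aeval (𝓕.r : A) (𝓕.poly w) = ((-(𝓕.ρ w * 𝓕.Q.eval 𝓕.r) : ℤ) : A) := by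
  rw [poly_eq_r, ← eq_intCast (algebraMap ℤ A), aeval_algebraMap_apply]
  simp

theorem aeval_poly_zero {A : Type*} [CommRing A] :
    aeval (0 : A) (𝓕.poly w) = ((-(𝓕.τ w * 𝓕.Q.eval 0) : ℤ) : A) := by
  have h : (0 : A) = algebraMap ℤ A 0 := by simp
  rw [poly_eq_zero, h, aeval_algebraMap_apply]
  have := 𝓕.four_le_κ
  simp [show 𝓕.κ ≠ 0 by omega]

variable {w}

theorem aeval_derivative_ne_zero (hw : w * 𝓕.τ w * 𝓕.ρ w ≠ 0) {A : Type*} [Field A] [CharZero A]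
    {x : A} (h1 : aeval x (𝓕.poly w) = 0) : aeval x (derivative (𝓕.poly w)) ≠ 0 := by
  intro h2
  have h3 := 𝓕.derivative_poly_mul_aeval w h1
  rw [h2, zero_mul, eq_comm] at h3
  have hs : 𝓕.Q.eval 𝓕.s ≠ 0 := fun h => by
    have := 𝓕.eval_gs
    rw [h, mul_zero, ← neg_sub 𝓕.r, neg_sq] at this
    exact mul_ne_zero (mul_ne_zero c_ne_zero (pow_ne_zero _ r_sub_s_ne_zero))
      (pow_ne_zero _ s_ne_zero) this.symm
  have hr : 𝓕.Q.eval 𝓕.r ≠ 0 := fun h => by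
    have := 𝓕.eval_gr
    rw [h, mul_zero, eq_comm] at this
    simp [c_ne_zero, r_ne_zero, r_sub_s_ne_zero] at this
  have h0 : 𝓕.Q.eval 0 ≠ 0 := fun h => by
    have := 𝓕.eval_g0
    rw [h, mul_zero, eq_comm] at this
    simp [c_ne_zero, r_ne_zero, s_ne_zero] at this
  simp only [mul_ne_zero_iff] at hw
  rcases mul_eq_zero.1 h3 with h3 | h3
  · rcases mul_eq_zero.1 h3 with h3 | h3
    · rcases mul_eq_zero.1 h3 with h3 | h3
      · exact c_ne_zero (by exact_mod_cast h3)
      · rw [sub_eq_zero.1 h3, aeval_poly_s] at h1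
        have h4 : -(𝓕.ε * w ^ 2 * 𝓕.Q.eval 𝓕.s) = 0 := by exact_mod_cast h1
        simp [ε_ne_zero, hw.1.1, hs] at h4
    · rw [sub_eq_zero.1 (eq_zero_of_pow_eq_zero h3), aeval_poly_r] at h1
      have h4 : -(𝓕.ρ w * 𝓕.Q.eval 𝓕.r) = 0 := by exact_mod_cast h1
      simp [hw.2, hr] at h4
  · rw [eq_zero_of_pow_eq_zero h3, aeval_poly_zero] at h1
    have h4 : -(𝓕.τ w * 𝓕.Q.eval 0) = 0 := by exact_mod_cast h1
    simp [hw.1.2, h0] at h4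

theorem separable (hw : w * 𝓕.τ w * 𝓕.ρ w ≠ 0) :
    ((𝓕.poly w).map (algebraMap ℤ ℚ)).Separable := by
  rw [separable_def, isCoprime_iff_aeval_ne_zero_of_isAlgClosed _ (AlgebraicClosure ℚ)]
  intro x
  by_contra! h
  obtain ⟨h1, h2⟩ := h
  rw [derivative_map] at h2
  rw [aeval_map_algebraMap] at h1 h2
  refine 𝓕.aeval_derivative_ne_zero hw (x := x) ?_ ?_
  · convert! h1
  · convert! h2

end CriticalFamily

namespace CriticalFamily
variable {n : ℕ} (𝓕 : CriticalFamily n) {w : ℤ}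

theorem not_dvd_of_not_dvd_bad {q : ℕ} (hq : q.Prime) (h : ¬ (q : ℤ) ∣ 𝓕.bad) :
    (¬ (q : ℤ) ∣ 𝓕.c ∧ ¬ (q : ℤ) ∣ 𝓕.a ∧ ¬ (q : ℤ) ∣ 𝓕.a' ∧ ¬ (q : ℤ) ∣ 𝓕.a - 𝓕.a') ∧
    (¬ (q : ℤ) ∣ 𝓕.Q.eval 𝓕.s ∧ ¬ (q : ℤ) ∣ 𝓕.Q.eval 𝓕.r ∧ ¬ (q : ℤ) ∣ 𝓕.Q.eval 0) ∧
    (¬ (q : ℤ) ∣ 𝓕.gs.eval 𝓕.s ∧ ¬ (q : ℤ) ∣ 𝓕.gr.eval 𝓕.r ∧ ¬ (q : ℤ) ∣ 𝓕.g0.eval 0) := by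
  have hp : Prime (q : ℤ) := Nat.prime_iff_prime_int.1 hq
  have h1 := 𝓕.eval_gs
  have h2 := 𝓕.eval_gr
  have h3 := 𝓕.eval_g0
  simp only [bad, hp.dvd_mul, not_or] at h
  obtain ⟨⟨h6, hκ⟩, ⟨⟨⟨⟨⟨hc, hs⟩, hr⟩, hrs⟩, ha⟩, ha'⟩, haa⟩ := h
  have hs' : ¬ (q : ℤ) ∣ 2 * 𝓕.gs.eval 𝓕.s * 𝓕.Q.eval 𝓕.s := by
    rw [h1, ← neg_sub 𝓕.r, neg_sq]
    exact hp.not_dvd_mul (hp.not_dvd_mul hc fun h => hrs (hp.dvd_of_dvd_pow h))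
      fun h => hs (hp.dvd_of_dvd_pow h)
  have hr' : ¬ (q : ℤ) ∣ 3 * 𝓕.gr.eval 𝓕.r * 𝓕.Q.eval 𝓕.r := by
    rw [h2]
    exact hp.not_dvd_mul (hp.not_dvd_mul hc hrs) fun h => hr (hp.dvd_of_dvd_pow h)
  have h0' : ¬ (q : ℤ) ∣ 𝓕.κ * 𝓕.g0.eval 0 * 𝓕.Q.eval 0 := by
    rw [h3]
    exact hp.not_dvd_mul (hp.not_dvd_mul (by rwa [dvd_neg]) hs)
      fun h => hr (hp.dvd_of_dvd_pow h)
  simp only [hp.dvd_mul, not_or] at hs' hr' h0'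
  exact ⟨⟨hc, ha, ha', haa⟩, ⟨hs'.2, hr'.2, h0'.2⟩, ⟨hs'.1.2, hr'.1.2, h0'.1.2⟩⟩

theorem dvd_ε_mul_sq {q : ℕ} (hq : q.Prime) : (q : ℤ) ∣ 𝓕.ε * w ^ 2 ↔ (q : ℤ) ∣ w := by
  have hp : Prime (q : ℤ) := Nat.prime_iff_prime_int.1 hq
  rw [hp.dvd_mul, hp.dvd_pow_iff_dvd two_ne_zero]
  refine or_iff_right fun h => hp.not_isUnit (isUnit_of_dvd_unit h ?_)
  rw [Int.isUnit_iff_natAbs_eq, 𝓕.natAbs_ε]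

section inertia
variable {L : Type} [Field L] [NumberField L] [IsGalois ℚ L] (R : RootLabelling (𝓕.poly w) n L)
  {q : ℕ} [hq : Fact q.Prime] (P : Ideal (𝓞 L)) [P.IsPrime] [P.LiesOver (Ideal.span {(q : ℤ)})]

include R in
theorem dvd_of_aeval_derivative_mem (hc : ¬ (q : ℤ) ∣ 𝓕.c) {i : Fin n}
    (h : aeval (R.root i) (derivative (𝓕.poly w)) ∈ P) :
    (R.root i - (𝓕.s : ℤ) ∈ P ∧ (q : ℤ) ∣ w * 𝓕.Q.eval 𝓕.s) ∨
    (R.root i - (𝓕.r : ℤ) ∈ P ∧ (q : ℤ) ∣ 𝓕.ρ w * 𝓕.Q.eval 𝓕.r) ∨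
    (R.root i - ((0 : ℤ) : 𝓞 L) ∈ P ∧ (q : ℤ) ∣ 𝓕.τ w * 𝓕.Q.eval 0) := by
  have hp : Prime (q : ℤ) := Nat.prime_iff_prime_int.1 hq.out
  have h1 := 𝓕.derivative_poly_mul_aeval w (R.aeval_root i)
  have h2 := P.mul_mem_right (aeval (R.root i) 𝓕.Q) h
  have hmem : ∀ x : ℤ, R.root i - (x : 𝓞 L) ∈ P → aeval (x : 𝓞 L) (𝓕.poly w) ∈ P := by
    intro x hx
    have := RootLabelling.aeval_sub_aeval_mem hx (𝓕.poly w)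
    rw [R.aeval_root, zero_sub] at this
    exact neg_mem_iff.1 this
  rw [h1] at h2
  have hc' : (𝓕.c : 𝓞 L) ∉ P := by rwa [intCast_mem_iff q P]
  have hP : P.IsPrime := inferInstance
  rcases hP.mem_or_mem h2 with h2 | h2
  · rcases hP.mem_or_mem h2 with h2 | h2
    · have h3 := (hP.mem_or_mem h2).resolve_left hc'
      refine Or.inl ⟨h3, ?_⟩
      have h4 := hmem _ h3
      rw [aeval_poly_s, intCast_mem_iff q P, dvd_neg, hp.dvd_mul, 𝓕.dvd_ε_mul_sq hq.out] at h4
      exact hp.dvd_mul.2 h4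
    · have h3 := hP.mem_of_pow_mem _ h2
      refine Or.inr (Or.inl ⟨h3, ?_⟩)
      have h4 := hmem _ h3
      rwa [aeval_poly_r, intCast_mem_iff q P, dvd_neg] at h4
  · have h3 := hP.mem_of_pow_mem _ h2
    have h5 : R.root i - ((0 : ℤ) : 𝓞 L) ∈ P := by simpa using h3
    refine Or.inr (Or.inr ⟨h5, ?_⟩)
    have h4 := hmem _ h5
    rwa [Int.cast_zero, aeval_poly_zero, intCast_mem_iff q P, dvd_neg] at h4

include R in
theorem perm_eq_one_of_not_dvd (hc : ¬ (q : ℤ) ∣ 𝓕.c) (hs : ¬ (q : ℤ) ∣ w * 𝓕.Q.eval 𝓕.s)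
    (hr : ¬ (q : ℤ) ∣ 𝓕.ρ w * 𝓕.Q.eval 𝓕.r) (h0 : ¬ (q : ℤ) ∣ 𝓕.τ w * 𝓕.Q.eval 0)
    {σ : Gal(L/ℚ)} (hσ : σ ∈ P.inertia Gal(L/ℚ)) : R.perm σ = 1 := by
  ext i
  congr 1
  refine R.perm_eq_of_aeval_derivative_notMem P hσ fun h => ?_
  rcases 𝓕.dvd_of_aeval_derivative_mem R P hc h with h | h | h
  exacts [hs h.2, hr h.2, h0 h.2]

theorem sign_perm (σ : Gal(L/ℚ)) : Equiv.Perm.sign (R.perm σ) = 1 := by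
  obtain ⟨y, z, hy, h⟩ := 𝓕.isSquare w L R
  exact R.sign_perm_eq_one hy h σ

theorem perm_eq_one_of_good (hg : ¬ (q : ℤ) ∣ 𝓕.bad) (hρ : ¬ (q : ℤ) ∣ 𝓕.ρ w)
    (hτ : ¬ (q : ℤ) ∣ 𝓕.τ w) {σ : Gal(L/ℚ)} (hσ : σ ∈ P.inertia Gal(L/ℚ)) : R.perm σ = 1 := by
  classical
  have hp : Prime (q : ℤ) := Nat.prime_iff_prime_int.1 hq.out
  obtain ⟨⟨hc, ha, ha', haa⟩, ⟨hQs, hQr, hQ0⟩, hgs, hgr, hg0⟩ := 𝓕.not_dvd_of_not_dvd_bad hq.out hg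
  by_cases hw : (q : ℤ) ∣ w
  · have hT := R.card_root_sub_mem q P (𝓕.poly_eq_s w) ((𝓕.dvd_ε_mul_sq hq.out).2 hw) hgs
    refine eq_one_of_fixed (𝓕.sign_perm R σ) hT.le fun i hi => ?_
    refine R.perm_eq_of_aeval_derivative_notMem P hσ fun h => ?_
    rcases 𝓕.dvd_of_aeval_derivative_mem R P hc h with h | h | h
    · exact hi (Finset.mem_filter.2 ⟨Finset.mem_univ _, h.1⟩)
    · exact hp.not_dvd_mul hρ hQr h.2
    · exact hp.not_dvd_mul hτ hQ0 h.2
  · exact 𝓕.perm_eq_one_of_not_dvd R P hc (hp.not_dvd_mul hw hQs) (hp.not_dvd_mul hρ hQr)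
      (hp.not_dvd_mul hτ hQ0) hσ

theorem exists_isThreeCycle (hg : ¬ (q : ℤ) ∣ 𝓕.bad) (hρ : (q : ℤ) ∣ 𝓕.ρ w)
    (hρ' : ¬ (q : ℤ) ^ 3 ∣ 𝓕.ρ w) : ∃ σ ∈ P.inertia Gal(L/ℚ), (R.perm σ).IsThreeCycle := by
  classical
  have hp : Prime (q : ℤ) := Nat.prime_iff_prime_int.1 hq.out
  obtain ⟨⟨hc, ha, ha', haa⟩, ⟨hQs, hQr, hQ0⟩, hgs, hgr, hg0⟩ := 𝓕.not_dvd_of_not_dvd_bad hq.out hg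
  have hw : ¬ (q : ℤ) ∣ w := fun h => ha' <| by
    rw [← 𝓕.dvd_ε_mul_sq hq.out] at h
    exact (dvd_add_left h).1 hρ
  have hτ : ¬ (q : ℤ) ∣ 𝓕.τ w := fun h => haa <| by
    have := dvd_sub h hρ
    rwa [τ, ρ, add_sub_add_right_eq_sub] at this
  have hT := R.card_root_sub_mem q P (𝓕.poly_eq_r w) hρ hgr
  obtain ⟨i, hi, j, hj, hij⟩ := Finset.one_lt_card.1 (by rw [hT]; norm_num)
  obtain ⟨v, hv⟩ : ∃ v : ℕ, emultiplicity (q : ℤ) (𝓕.ρ w) = v :=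
    ENat.ne_top_iff_exists.1 (fun h => hρ' (by
      rw [pow_dvd_iff_le_emultiplicity, h]
      exact le_top)) |>.imp fun v h => h.symm
  have hv0 : 0 < v := by
    rw [← pow_one (q : ℤ), pow_dvd_iff_le_emultiplicity, hv] at hρ
    exact_mod_cast hρ
  have hv3 : v < 3 := by
    rw [pow_dvd_iff_le_emultiplicity, hv] at hρ'
    exact_mod_cast not_le.1 hρ'
  obtain ⟨σ, hσ, hσij⟩ := R.exists_mem_inertia_perm_eq q P (𝓕.poly_eq_r w) hv0 hv
    (by interval_cases v <;> norm_num) hgr hQr (Finset.mem_filter.1 hi).2 (Finset.mem_filter.1 hj).2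
  refine ⟨σ, hσ, isThreeCycle_of_fixed ?_ (𝓕.sign_perm R σ) hT.le fun i hi => ?_⟩
  · rintro h
    rw [h] at hσij
    exact hij hσij
  · refine R.perm_eq_of_aeval_derivative_notMem P hσ fun h => ?_
    rcases 𝓕.dvd_of_aeval_derivative_mem R P hc h with h | h | h
    · exact hp.not_dvd_mul hw hQs h.2
    · exact hi (Finset.mem_filter.2 ⟨Finset.mem_univ _, h.1⟩)
    · exact hp.not_dvd_mul hτ hQ0 h.2

theorem exists_perm_ne_one (hg : ¬ (q : ℤ) ∣ 𝓕.bad) (hτ : (q : ℤ) ∣ 𝓕.τ w)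
    (hτ' : ¬ (q : ℤ) ^ 2 ∣ 𝓕.τ w) : ∃ σ ∈ P.inertia Gal(L/ℚ), R.perm σ ≠ 1 := by
  classical
  obtain ⟨⟨hc, ha, ha', haa⟩, ⟨hQs, hQr, hQ0⟩, hgs, hgr, hg0⟩ := 𝓕.not_dvd_of_not_dvd_bad hq.out hg
  have hT := R.card_root_sub_mem q P (𝓕.poly_eq_zero w) hτ hg0
  have hκ := 𝓕.four_le_κ
  obtain ⟨i, hi, j, hj, hij⟩ := Finset.one_lt_card.1 (by rw [hT]; omega)
  have hv : emultiplicity (q : ℤ) (𝓕.τ w) = (1 : ℕ) := by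
    rw [emultiplicity_eq_coe]
    exact ⟨by simpa using hτ, hτ'⟩
  obtain ⟨σ, hσ, hσij⟩ := R.exists_mem_inertia_perm_eq q P (𝓕.poly_eq_zero w) one_pos hv
    (Nat.coprime_one_right _) hg0 hQ0 (Finset.mem_filter.1 hi).2 (Finset.mem_filter.1 hj).2
  refine ⟨σ, hσ, ?_⟩
  rintro h
  rw [h] at hσij
  exact hij hσij

end inertia

end CriticalFamily

namespace CriticalFamily
variable {n : ℕ} (𝓕 : CriticalFamily n) {w : ℤ}
  (K : Type) [Field K] [NumberField K] [hK : IsSplittingField ℚ K ((𝓕.poly w).map (algebraMap ℤ ℚ))]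

include hK in
theorem exists_rootLabelling (hw : w * 𝓕.τ w * 𝓕.ρ w ≠ 0) :
    Nonempty (RootLabelling (𝓕.poly w) n K) := by
  have h := hK.splits
  rw [Polynomial.map_map, ← IsScalarTower.algebraMap_eq] at h
  exact _root_.exists_rootLabelling (𝓕.monic_poly w) (𝓕.natDegree_poly w) (𝓕.separable hw) h

theorem dvd_discr_iff (hw : w * 𝓕.τ w * 𝓕.ρ w ≠ 0) {q : ℕ} (hq : q.Prime)
    (hg : ¬ (q : ℤ) ∣ 𝓕.bad) (hτ : ¬ (q : ℤ) ^ 2 ∣ 𝓕.τ w) (hρ : ¬ (q : ℤ) ^ 3 ∣ 𝓕.ρ w) :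
    (q : ℤ) ∣ discr K ↔ (q : ℤ) ∣ 𝓕.τ w ∨ (q : ℤ) ∣ 𝓕.ρ w := by
  have := isGalois_of_isSplittingField_map (𝓕.separable hw) K
  have : Fact q.Prime := ⟨hq⟩
  obtain ⟨R⟩ := 𝓕.exists_rootLabelling K hw
  obtain ⟨P, _, _⟩ := exists_prime_liesOver K q
  rw [R.natPrime_dvd_discr_iff K q P]
  constructor
  · contrapose!
    rintro ⟨h1, h2⟩ σ hσ
    exact 𝓕.perm_eq_one_of_good R P hg h2 h1 hσ
  · rintro (h | h)
    · exact 𝓕.exists_perm_ne_one R P hg h hτ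
    · obtain ⟨σ, hσ, h3⟩ := 𝓕.exists_isThreeCycle R P hg h hρ
      exact ⟨σ, hσ, h3.ne_one⟩

theorem not_dvd_discr (hw : w * 𝓕.τ w * 𝓕.ρ w ≠ 0) {q : ℕ} (hq : q.Prime)
    (hc : ¬ (q : ℤ) ∣ 𝓕.c) (hs : ¬ (q : ℤ) ∣ w * 𝓕.Q.eval 𝓕.s)
    (hr : ¬ (q : ℤ) ∣ 𝓕.ρ w * 𝓕.Q.eval 𝓕.r) (h0 : ¬ (q : ℤ) ∣ 𝓕.τ w * 𝓕.Q.eval 0) :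
    ¬ (q : ℤ) ∣ discr K := by
  have := isGalois_of_isSplittingField_map (𝓕.separable hw) K
  have : Fact q.Prime := ⟨hq⟩
  obtain ⟨R⟩ := 𝓕.exists_rootLabelling K hw
  obtain ⟨P, _, _⟩ := exists_prime_liesOver K q
  rw [R.natPrime_dvd_discr_iff K q P]
  push Not
  exact fun σ hσ => 𝓕.perm_eq_one_of_not_dvd R P hc hs hr h0 hσ

theorem nonempty_mulEquiv_alternatingGroup (hw : w * 𝓕.τ w * 𝓕.ρ w ≠ 0)
    (hprim : ∀ (L : Type) [Field L] [NumberField L] [IsGalois ℚ L]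
      (R : RootLabelling (𝓕.poly w) n L), MulAction.IsPreprimitive R.perm.range (Fin n))
    {q : ℕ} (hq : q.Prime) (hg : ¬ (q : ℤ) ∣ 𝓕.bad) (hρ : (q : ℤ) ∣ 𝓕.ρ w)
    (hρ' : ¬ (q : ℤ) ^ 3 ∣ 𝓕.ρ w) : Nonempty (Gal(K/ℚ) ≃* alternatingGroup (Fin n)) := by
  have := isGalois_of_isSplittingField_map (𝓕.separable hw) K
  have : Fact q.Prime := ⟨hq⟩
  obtain ⟨R⟩ := 𝓕.exists_rootLabelling K hw
  obtain ⟨P, _, _⟩ := exists_prime_liesOver K q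
  obtain ⟨σ, hσ, h3⟩ := 𝓕.exists_isThreeCycle R P hg hρ hρ'
  exact R.nonempty_mulEquiv_alternatingGroup (hprim K R) (𝓕.sign_perm R) h3

/-- The ramification at a given finite set of primes is constant on a residue class. -/
theorem exists_forall_dvd_discr_iff (hn : 0 < n) (hw : w * 𝓕.τ w * 𝓕.ρ w ≠ 0) :
    ∃ N : ℕ, ∀ q : ℕ, q.Prime → ∀ w' : ℤ, w' * 𝓕.τ w' * 𝓕.ρ w' ≠ 0 → (q : ℤ) ^ N ∣ w' - w →
      ∀ (K' : Type) [Field K'] [NumberField K']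
        [IsSplittingField ℚ K' ((𝓕.poly w').map (algebraMap ℤ ℚ))],
        (q : ℤ) ∣ discr K' ↔ (q : ℤ) ∣ discr K := by
  obtain ⟨N, hN⟩ := _root_.exists_forall_dvd_discr_iff hn (𝓕.monic_poly w) (𝓕.natDegree_poly w)
    (𝓕.separable hw) K
  refine ⟨N, fun q hq w' hw' hd K' _ _ _ => ?_⟩
  have : Fact q.Prime := ⟨hq⟩
  refine hN q (𝓕.poly w') (𝓕.monic_poly w') (𝓕.natDegree_poly w') (𝓕.separable hw') ?_ K'
  obtain ⟨e, he⟩ := hd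
  refine ⟨C (-𝓕.ε * e * (w' + w)) * 𝓕.Q, ?_⟩
  have h1 : 𝓕.ε * w' ^ 2 - 𝓕.ε * w ^ 2 = (q : ℤ) ^ N * (𝓕.ε * e * (w' + w)) := by
    linear_combination 𝓕.ε * (w' + w) * he
  have h2 := congrArg (C : ℤ →+* ℤ[X]) h1
  rw [← mul_assoc, ← C_mul, poly, poly]
  rw [neg_mul, neg_mul, mul_neg, ← h1, C_neg, C_sub]
  ring

end CriticalFamily

end

section

set_option linter.unusedSectionVars false

/-- Dirichlet's theorem with a prescribed quadratic residue. -/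
theorem exists_prime_gt_modEq_isSquare {Δ : ℤ} (hΔ : Δ ≠ 0) {p : ℕ} (hp : p.Prime) (hp2 : p ≠ 2)
    (hpΔ : ¬ (p : ℤ) ∣ Δ) {c : ℤ} (hc : ¬ (p : ℤ) ∣ c) (B : ℕ) :
    ∃ ℓ : ℕ, B < ℓ ∧ ℓ.Prime ∧ (ℓ : ℤ) ≡ c [ZMOD p] ∧ IsSquare (Δ : ZMod ℓ) := by
  have hcop : IsCoprime (p : ℤ) (4 * Δ.natAbs : ℕ) := by
    rw [Nat.isCoprime_iff_coprime]
    refine (Nat.Coprime.mul_right ?_ ?_)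
    · rw [Nat.coprime_comm]
      exact Nat.Coprime.pow_left 2 ((Nat.coprime_primes Nat.prime_two hp).2 hp2.symm)
    · rw [hp.coprime_iff_not_dvd, ← Int.natCast_dvd]
      exact hpΔ
  obtain ⟨u, v, huv⟩ := hcop
  set m := 4 * Δ.natAbs with hm
  have hm0 : m ≠ 0 := by positivity
  set x : ℤ := u * p + c * (v * m) with hx
  have hxp : x ≡ c [ZMOD p] := by
    rw [Int.modEq_iff_dvd]
    exact ⟨-u + c * u, by rw [hx]; linear_combination (-c) * huv⟩
  have hxm : x ≡ 1 [ZMOD m] := by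
    rw [Int.modEq_iff_dvd]
    exact ⟨v - c * v, by rw [hx]; linear_combination (-1 : ℤ) * huv⟩
  have hpi : Prime (p : ℤ) := Nat.prime_iff_prime_int.1 hp
  have hxpm : IsCoprime x (p * m : ℕ) := by
    push_cast
    refine IsCoprime.mul_right ?_ ?_
    · rw [isCoprime_comm, hpi.coprime_iff_not_dvd]
      intro h
      exact hc ((Int.ModEq.dvd_iff hxp).1 h)
    · obtain ⟨t, ht⟩ := (Int.modEq_iff_dvd.1 hxm)
      exact ⟨1, t, by linear_combination -ht⟩
  obtain ⟨ℓ, hℓ, hℓp, hmod⟩ := Nat.forall_exists_prime_gt_and_zmodEq (max B (m + 1))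
    (mul_ne_zero hp.ne_zero hm0) hxpm
  push_cast at hmod
  refine ⟨ℓ, (le_max_left _ _).trans_lt hℓ, hℓp, (hmod.of_mul_right _).trans hxp, ?_⟩
  have h1 : (ℓ : ℤ) ≡ 1 [ZMOD m] := (hmod.of_mul_left _).trans hxm
  have : Fact ℓ.Prime := ⟨hℓp⟩
  have hodd : Odd ℓ := hℓp.odd_of_ne_two (by
    have := (le_max_right B (m + 1)).trans_lt hℓ
    omega)
  rw [← legendreSym.eq_one_iff, jacobiSym.legendreSym.to_jacobiSym, jacobiSym.mod_right _ hodd]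
  · have h2 : ℓ % m = 1 := by
      have h3 : ℓ ≡ 1 [MOD m] := by exact_mod_cast h1
      rw [Nat.ModEq, Nat.mod_eq_of_lt (a := 1) (by omega)] at h3
      exact h3
    rw [← hm, h2, jacobiSym.one_right]
  · rw [Ne, ZMod.intCast_zmod_eq_zero_iff_dvd]
    intro h
    have h4 := Nat.le_of_dvd (Int.natAbs_pos.2 hΔ) (Int.natCast_dvd.1 h)
    have := (le_max_right B (m + 1)).trans_lt hℓ
    omega

theorem card_le_of_pairwise_modEq {A : Finset ℕ} {J r : ℕ} (hr : 0 < r) (hA : A ⊆ Finset.range J)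
    (h : ∀ i ∈ A, ∀ j ∈ A, i ≡ j [MOD r]) : (A.card : ℝ) ≤ J / r + 1 := by
  obtain rfl | ⟨v, hv⟩ := A.eq_empty_or_nonempty
  · simp
    positivity
  have h1 : A ⊆ (Finset.range J).filter (· ≡ v [MOD r]) := fun i hi =>
    Finset.mem_filter.2 ⟨hA hi, h i hi v hv⟩
  have h2 := Finset.card_le_card h1
  rw [← Nat.count_eq_card_filter_range, Nat.count_modEq_card _ hr] at h2
  have h3 : A.card ≤ J / r + 1 := by
    split_ifs at h2 <;> omega
  calc (A.card : ℝ) ≤ ((J / r + 1 : ℕ) : ℝ) := by exact_mod_cast h3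
    _ ≤ J / r + 1 := by
      push_cast
      gcongr
      exact Nat.cast_div_le

/-- An arithmetic progression of length `J` prime to `q` contains few integers `w` such that
`q ^ 2` divides `a + ε w ^ 2`. -/
theorem card_filter_sq_dvd_le {a ε w₀ : ℤ} {M J q : ℕ} (hε : ε.natAbs = 1) (hq : q.Prime)
    (hq2 : q ≠ 2) (hqM : ¬ q ∣ M) (hqa : ¬ (q : ℤ) ∣ a) :
    (((Finset.range J).filter fun j : ℕ => (q : ℤ) ^ 2 ∣ a + ε * (w₀ + M * j) ^ 2).card : ℝ) ≤
      2 * (J / (q : ℝ) ^ 2 + 1) := by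
  classical
  have hp : Prime (q : ℤ) := Nat.prime_iff_prime_int.1 hq
  have hq2' : ¬ (q : ℤ) ∣ 2 := by
    intro h
    have h1 : q ∣ 2 := by exact_mod_cast h
    exact hq2 ((Nat.prime_dvd_prime_iff_eq hq Nat.prime_two).1 h1)
  set A := (Finset.range J).filter fun j : ℕ => (q : ℤ) ^ 2 ∣ a + ε * (w₀ + M * j) ^ 2 with hA
  have hsub : A ⊆ Finset.range J := Finset.filter_subset _ _
  have hcop : IsCoprime ((q : ℤ) ^ 2) (M : ℤ) := by
    refine IsCoprime.pow_left ?_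
    rw [Nat.isCoprime_iff_coprime, hq.coprime_iff_not_dvd]
    exact hqM
  have hkey : ∀ i ∈ A, ∀ j ∈ A, i ≡ j [MOD q ^ 2] ∨
      (q : ℤ) ^ 2 ∣ (w₀ + M * i) + (w₀ + M * j) := by
    intro i hi j hj
    have hi' := (Finset.mem_filter.1 hi).2
    have hj' := (Finset.mem_filter.1 hj).2
    have h1 : (q : ℤ) ^ 2 ∣ ε * (((w₀ + M * i) - (w₀ + M * j)) * ((w₀ + M * i) + (w₀ + M * j))) :=
        by
      have := dvd_sub hi' hj'
      rwa [show a + ε * (w₀ + M * i) ^ 2 - (a + ε * (w₀ + M * j) ^ 2) =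
        ε * (((w₀ + M * i) - (w₀ + M * j)) * ((w₀ + M * i) + (w₀ + M * j))) by ring] at this
    rw [(Int.isUnit_iff_natAbs_eq.2 hε).dvd_mul_left] at h1
    by_cases h2 : (q : ℤ) ∣ (w₀ + M * i) + (w₀ + M * j)
    · by_cases h3 : (q : ℤ) ∣ (w₀ + M * i) - (w₀ + M * j)
      · exfalso
        have h4 : (q : ℤ) ∣ 2 * (w₀ + M * i) := by
          have := dvd_add h2 h3
          rwa [show (w₀ + M * i) + (w₀ + M * j) + ((w₀ + M * i) - (w₀ + M * j)) =
            2 * (w₀ + M * i) by ring] at this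
        have h5 := (hp.dvd_mul.1 h4).resolve_left hq2'
        apply hqa
        rw [← dvd_add_left (dvd_mul_of_dvd_right (dvd_pow h5 two_ne_zero) ε)]
        exact (dvd_pow_self _ two_ne_zero).trans hi'
      · right
        exact IsCoprime.dvd_of_dvd_mul_left
          (IsCoprime.pow_left (hp.coprime_iff_not_dvd.2 h3)) h1
    · left
      have h6 : (q : ℤ) ^ 2 ∣ (w₀ + M * i) - (w₀ + M * j) := IsCoprime.dvd_of_dvd_mul_right
          (IsCoprime.pow_left (hp.coprime_iff_not_dvd.2 h2)) h1
      rw [show w₀ + M * i - (w₀ + M * j) = M * ((i : ℤ) - j) by ring] at h6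
      have h7 := hcop.dvd_of_dvd_mul_left h6
      exact (Nat.modEq_iff_dvd.2 (by push_cast; exact h7)).symm
  have hr : 0 < q ^ 2 := by have := hq.pos; positivity
  obtain he | ⟨v, hv⟩ := A.eq_empty_or_nonempty
  · rw [he]
    simp
    positivity
  rw [← Finset.card_filter_add_card_filter_not (s := A) (p := fun i => i ≡ v [MOD q ^ 2])]
  have h1 := card_le_of_pairwise_modEq (A := A.filter fun i => i ≡ v [MOD q ^ 2]) hr
    ((Finset.filter_subset _ _).trans hsub) fun i hi j hj =>
      (Finset.mem_filter.1 hi).2.trans (Finset.mem_filter.1 hj).2.symm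
  have h2 := card_le_of_pairwise_modEq (A := A.filter fun i => ¬ i ≡ v [MOD q ^ 2]) hr
    ((Finset.filter_subset _ _).trans hsub) fun i hi j hj => by
      obtain ⟨hi1, hi2⟩ := Finset.mem_filter.1 hi
      obtain ⟨hj1, hj2⟩ := Finset.mem_filter.1 hj
      have h3 := dvd_sub ((hkey i hi1 v hv).resolve_left hi2) ((hkey j hj1 v hv).resolve_left hj2)
      rw [show w₀ + M * i + (w₀ + M * v) - (w₀ + M * j + (w₀ + M * v)) = M * ((i : ℤ) - j) by ring]
        at h3
      have h7 := hcop.dvd_of_dvd_mul_left h3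
      exact (Nat.modEq_iff_dvd.2 (by push_cast; exact h7)).symm
  push_cast at h1 h2 ⊢
  linarith

open Finset in
theorem sum_inv_sq_le {P : Finset ℕ} (hP : ∀ q ∈ P, 17 ≤ q) :
    ∑ q ∈ P, ((q : ℝ) ^ 2)⁻¹ ≤ 1 / 16 := by
  have hsub : P ⊆ Ioc 16 (P.sup id + 16) := fun q hq =>
    mem_Ioc.2 ⟨hP q hq, (le_sup (f := id) hq).trans (Nat.le_add_right _ _)⟩
  have h1 := sum_le_sum_of_subset_of_nonneg (f := fun q : ℕ => ((q : ℝ) ^ 2)⁻¹) hsub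
    fun _ _ _ => by positivity
  have h2 := sum_Ioc_inv_sq_le_sub (α := ℝ) (k := 16) (n := P.sup id + 16) (by norm_num)
    (Nat.le_add_left _ _)
  have h3 : (0 : ℝ) ≤ ((P.sup id + 16 : ℕ) : ℝ)⁻¹ := by positivity
  push_cast at *
  linarith

open Filter in
theorem eventually_primeCounting_mul_le {C : ℕ} (hC : 0 < C) {δ : ℝ} (hδ : 0 < δ) :
    ∀ᶠ J : ℕ in atTop, (Nat.primeCounting (C * J) : ℝ) ≤ δ * J := by
  have hlim : Tendsto (fun J : ℕ => ((C * J : ℕ) : ℝ)) atTop atTop :=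
    tendsto_natCast_atTop_atTop.comp (tendsto_id.const_mul_atTop' hC)
  have hlog := (Real.tendsto_log_atTop.comp hlim).eventually_ge_atTop ((Real.log 4 + 1) * C / δ)
  filter_upwards [hlim.eventually (Chebyshev.eventually_primeCounting_le one_pos), hlog]
    with J h1 h2
  rw [Nat.floor_natCast] at h1
  refine h1.trans ?_
  have h4 : 0 < Real.log 4 := Real.log_pos (by norm_num)
  have hC' : (0 : ℝ) < C := by exact_mod_cast hC
  have h5 : 0 < (Real.log 4 + 1) * C / δ := by positivity
  rw [Function.comp_apply] at h2
  rw [div_le_iff₀ (h5.trans_le h2)]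
  rw [div_le_iff₀ hδ] at h2
  push_cast at h2 ⊢
  have := mul_le_mul_of_nonneg_right h2 (Nat.cast_nonneg (α := ℝ) J)
  linarith

theorem add_mul_sq_ne_zero {a ε w : ℤ} (hε : ε.natAbs = 1) (hw : |a| < w) : a + ε * w ^ 2 ≠ 0 := by
  intro h
  have h1 : |ε| = 1 := by rw [Int.abs_eq_natAbs, hε]; rfl
  have h2 : |a| = w ^ 2 := by
    rw [show a = -(ε * w ^ 2) by linarith, abs_neg, abs_mul, h1, one_mul, abs_of_nonneg
        (by positivity)]
  have := abs_nonneg a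
  nlinarith

theorem le_of_sq_dvd_add_mul_sq {a ε w : ℤ} (hε : ε.natAbs = 1) (hw : |a| < w) {q : ℕ}
    (h : (q : ℤ) ^ 2 ∣ a + ε * w ^ 2) : (q : ℤ) ≤ 2 * w := by
  have h1 : |ε| = 1 := by rw [Int.abs_eq_natAbs, hε]; rfl
  have h2 := Int.le_of_dvd (abs_pos.2 (add_mul_sq_ne_zero hε hw)) ((dvd_abs _ _).2 h)
  have h3 : |a + ε * w ^ 2| ≤ |a| + w ^ 2 := by
    refine (abs_add_le _ _).trans ?_
    rw [abs_mul, h1, one_mul, abs_of_nonneg (by positivity : (0 : ℤ) ≤ w ^ 2)]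
  have := abs_nonneg a
  nlinarith

open Finset in
/-- A sieve: an arithmetic progression contains large integers `w` at which two quadratic
polynomials `a + ε w ^ 2` and `a' + ε w ^ 2` are squarefree outside the modulus. -/
theorem exists_forall_not_sq_dvd {a a' ε : ℤ} (hε : ε.natAbs = 1) {M : ℕ} (hM : M ≠ 0)
    (hM' : ∀ q : ℕ, q.Prime → ¬ q ∣ M → 17 ≤ q ∧ ¬ (q : ℤ) ∣ a ∧ ¬ (q : ℤ) ∣ a') (w₀ B : ℤ) :
    ∃ w : ℤ, B ≤ w ∧ w ≡ w₀ [ZMOD M] ∧ ∀ q : ℕ, q.Prime → ¬ q ∣ M →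
      ¬ (q : ℤ) ^ 2 ∣ a + ε * w ^ 2 ∧ ¬ (q : ℤ) ^ 2 ∣ a' + ε * w ^ 2 := by
  classical
  set w₁ : ℤ := w₀ + M * (|w₀| + |B| + |a| + |a'| + 1) with hw₁
  have hM1 : (1 : ℤ) ≤ M := by exact_mod_cast Nat.one_le_iff_ne_zero.2 hM
  have hB := le_abs_self B
  have hB0 := abs_nonneg B
  have ha0 := abs_nonneg a
  have ha'0 := abs_nonneg a'
  have hw₁' : |B| + |a| + |a'| + 1 ≤ w₁ := by
    have := neg_abs_le w₀
    have := abs_nonneg w₀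
    nlinarith
  obtain ⟨C, hC⟩ : ∃ C : ℕ, (C : ℤ) = 2 * (w₁ + M) := ⟨(2 * (w₁ + M)).toNat, by
    rw [Int.toNat_of_nonneg (by linarith)]⟩
  have hC0 : 0 < C := by
    have : (0 : ℤ) < C := by linarith
    exact_mod_cast this
  obtain ⟨J, hJ, hJ1⟩ := ((eventually_primeCounting_mul_le hC0 (δ := 1 / 8) (by norm_num)).and
    (Filter.eventually_ge_atTop 1)).exists
  set P := (C * J + 1).primesBelow.filter fun q => ¬ q ∣ M with hP
  set A : ℤ → ℕ → Finset ℕ := fun b q =>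
    (range J).filter fun j : ℕ => (q : ℤ) ^ 2 ∣ b + ε * (w₁ + M * j) ^ 2 with hA
  have hPq : ∀ q ∈ P, q.Prime ∧ ¬ q ∣ M := fun q hq =>
    ⟨Nat.prime_of_mem_primesBelow (mem_filter.1 hq).1, (mem_filter.1 hq).2⟩
  have hP17 : ∀ q ∈ P, 17 ≤ q := fun q hq => (hM' q (hPq q hq).1 (hPq q hq).2).1
  have hPcard : (P.card : ℝ) ≤ 1 / 8 * J := by
    refine le_trans ?_ hJ
    rw [Nat.primeCounting, ← Nat.primesBelow_card_eq_primeCounting']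
    exact_mod_cast card_filter_le _ _
  have hAcard : ∀ q ∈ P, ((A a q).card : ℝ) + (A a' q).card ≤ 4 * J * ((q : ℝ) ^ 2)⁻¹ + 4 := by
    intro q hq
    obtain ⟨h1, h2⟩ := hPq q hq
    obtain ⟨h3, h4, h5⟩ := hM' q h1 h2
    have h6 := card_filter_sq_dvd_le (w₀ := w₁) (J := J) hε h1 (by omega) h2 h4
    have h7 := card_filter_sq_dvd_le (w₀ := w₁) (J := J) hε h1 (by omega) h2 h5
    rw [div_eq_mul_inv] at h6 h7
    linarith
  have hlt : (P.biUnion fun q => A a q ∪ A a' q).card < (range J).card := by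
    have hJ0 : (1 : ℝ) ≤ J := by exact_mod_cast hJ1
    rw [card_range, ← Nat.cast_lt (α := ℝ)]
    calc ((P.biUnion fun q => A a q ∪ A a' q).card : ℝ)
        ≤ ∑ q ∈ P, (((A a q).card : ℝ) + (A a' q).card) := by
          exact_mod_cast card_biUnion_le.trans (sum_le_sum fun q _ => card_union_le _ _)
      _ ≤ ∑ q ∈ P, (4 * J * ((q : ℝ) ^ 2)⁻¹ + 4) := sum_le_sum hAcard
      _ = 4 * J * ∑ q ∈ P, ((q : ℝ) ^ 2)⁻¹ + 4 * P.card := by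
          rw [sum_add_distrib, ← mul_sum, sum_const, nsmul_eq_mul, mul_comm (4 : ℝ) P.card]
      _ ≤ 4 * J * (1 / 16) + 4 * (1 / 8 * J) := by
          gcongr
          exact sum_inv_sq_le hP17
      _ < J := by linarith
  obtain ⟨j, hj, hj'⟩ := exists_mem_notMem_of_card_lt_card hlt
  have hjJ : (j : ℤ) + 1 ≤ J := by exact_mod_cast mem_range.1 hj
  have hj0 : (0 : ℤ) ≤ M * j := by positivity
  have hle : 2 * (w₁ + M * j) ≤ (C * J : ℕ) := by
    push_cast
    rw [hC]
    nlinarith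
  refine ⟨w₁ + M * j, by linarith, ?_, fun q hq hqM => ?_⟩
  · rw [Int.modEq_iff_dvd]
    exact ⟨-(|w₀| + |B| + |a| + |a'| + 1) - j, by rw [hw₁]; ring⟩
  · have hkey : ∀ b : ℤ, |b| < w₁ → (q : ℤ) ^ 2 ∣ b + ε * (w₁ + M * j) ^ 2 → q ∈ P ∧ j ∈ A b q := by
      intro b hb h
      refine ⟨mem_filter.2 ⟨Nat.mem_primesBelow.2 ⟨?_, hq⟩, hqM⟩, mem_filter.2 ⟨hj, h⟩⟩
      have := (le_of_sq_dvd_add_mul_sq hε (by linarith) h).trans hle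
      have : q ≤ C * J := by exact_mod_cast this
      omega
    simp only [mem_biUnion, mem_union, not_exists, not_and, not_or] at hj'
    constructor
    · intro h
      obtain ⟨h1, h2⟩ := hkey a (by linarith) h
      exact (hj' q h1).1 h2
    · intro h
      obtain ⟨h1, h2⟩ := hkey a' (by linarith) h
      exact (hj' q h1).2 h2

theorem Int.exists_modEq_modEq {m n : ℤ} (h : IsCoprime m n) (x y : ℤ) :
    ∃ z : ℤ, z ≡ x [ZMOD m] ∧ z ≡ y [ZMOD n] := by
  obtain ⟨u, v, huv⟩ := h
  refine ⟨v * n * x + u * m * y, Int.modEq_iff_dvd.2 ⟨u * (x - y), ?_⟩,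
    Int.modEq_iff_dvd.2 ⟨v * (y - x), ?_⟩⟩
  · linear_combination (-x) * huv
  · linear_combination (-y) * huv

/-- Hensel lifting of a root of `a + ε w ^ 2`. -/
theorem exists_pow_dvd_add_mul_sq {a ε v : ℤ} {ℓ : ℕ} (hℓ : ℓ.Prime) (hℓ2 : ℓ ≠ 2)
    (hε : ε.natAbs = 1) (ha : ¬ (ℓ : ℤ) ∣ a) (hv : (ℓ : ℤ) ∣ a + ε * v ^ 2) (k : ℕ) :
    ∃ u : ℤ, (ℓ : ℤ) ^ (k + 1) ∣ a + ε * u ^ 2 ∧ ¬ (ℓ : ℤ) ∣ 2 * ε * u := by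
  have hp : Prime (ℓ : ℤ) := Nat.prime_iff_prime_int.1 hℓ
  have h2 : ¬ (ℓ : ℤ) ∣ 2 := by
    intro h
    have h1 : ℓ ∣ 2 := by exact_mod_cast h
    exact hℓ2 ((Nat.prime_dvd_prime_iff_eq hℓ Nat.prime_two).1 h1)
  have hε' : ¬ (ℓ : ℤ) ∣ ε := fun h =>
    hp.not_isUnit (isUnit_of_dvd_unit h (Int.isUnit_iff_natAbs_eq.2 hε))
  have hunit : ∀ u : ℤ, (ℓ : ℤ) ∣ a + ε * u ^ 2 → ¬ (ℓ : ℤ) ∣ 2 * ε * u := fun u hu =>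
    hp.not_dvd_mul (hp.not_dvd_mul h2 hε') fun h =>
      ha ((dvd_add_left (dvd_mul_of_dvd_right (dvd_pow h two_ne_zero) ε)).1 hu)
  induction k with
  | zero => exact ⟨v, by simpa using hv, hunit v hv⟩
  | succ k ih =>
    obtain ⟨u, ⟨m, hm⟩, hu⟩ := ih
    obtain ⟨x, y, hxy⟩ := hp.coprime_iff_not_dvd.2 hu
    have h3 : (ℓ : ℤ) ^ (k + 1 + 1) ∣ a + ε * (u + (ℓ : ℤ) ^ (k + 1) * (-(m * y))) ^ 2 :=
      ⟨m * x + ε * (m * y) ^ 2 * (ℓ : ℤ) ^ k, by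
        linear_combination hm - (ℓ : ℤ) ^ (k + 1) * m * hxy⟩
    exact ⟨_, h3, hunit _ ((dvd_pow_self _ (Nat.succ_ne_zero _)).trans h3)⟩

theorem exists_emultiplicity_add_mul_sq {a ε : ℤ} {ℓ : ℕ} (hℓ : ℓ.Prime) (hℓ2 : ℓ ≠ 2)
    (hε : ε.natAbs = 1) (ha : ¬ (ℓ : ℤ) ∣ a) (hs : IsSquare ((-(ε * a) : ℤ) : ZMod ℓ)) {k : ℕ}
    (hk : 0 < k) : ∃ u : ℤ, (ℓ : ℤ) ^ k ∣ a + ε * u ^ 2 ∧ ¬ (ℓ : ℤ) ^ (k + 1) ∣ a + ε * u ^ 2 := by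
  have : Fact ℓ.Prime := ⟨hℓ⟩
  have hε2 : ε * ε = 1 := by
    have := Int.natAbs_mul_self' ε
    rw [hε] at this
    exact_mod_cast this.symm
  obtain ⟨y, hy⟩ := hs
  obtain ⟨v, rfl⟩ := ZMod.intCast_surjective y
  have hv : (ℓ : ℤ) ∣ a + ε * v ^ 2 := by
    rw [← ZMod.intCast_zmod_eq_zero_iff_dvd]
    have h1 : ((ε * ε : ℤ) : ZMod ℓ) = 1 := by rw [hε2]; simp
    push_cast at hy h1 ⊢
    linear_combination (-(ε : ZMod ℓ)) * hy - (a : ZMod ℓ) * h1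
  obtain ⟨u, hu, hu'⟩ := exists_pow_dvd_add_mul_sq hℓ hℓ2 hε ha hv k
  obtain ⟨m, rfl⟩ : ∃ m, k = m + 1 := ⟨k - 1, by omega⟩
  refine ⟨u + (ℓ : ℤ) ^ (m + 1), ?_, ?_⟩
  · obtain ⟨t, ht⟩ := hu
    exact ⟨ℓ * t + 2 * ε * u + ε * (ℓ : ℤ) ^ (m + 1), by linear_combination ht⟩
  · intro h
    apply hu'
    have h1 : a + ε * (u + (ℓ : ℤ) ^ (m + 1)) ^ 2 = (a + ε * u ^ 2) +
      ((ℓ : ℤ) ^ (m + 1 + 1) * (ε * (ℓ : ℤ) ^ m) + (ℓ : ℤ) ^ (m + 1) * (2 * ε * u)) := by ring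
    rw [h1, dvd_add_right hu, dvd_add_right (dvd_mul_right _ _), pow_succ] at h
    exact (mul_dvd_mul_iff_left (pow_ne_zero _ (by exact_mod_cast hℓ.ne_zero))).1 h

theorem Nat.factorization_prod_id_of_prime {A : Finset ℕ} (hA : ∀ q ∈ A, q.Prime) (q : ℕ) :
    (∏ x ∈ A, x).factorization q = if q ∈ A then 1 else 0 := by
  rw [Nat.factorization_prod fun x hx => (hA x hx).ne_zero, Finsupp.finsetSum_apply]
  rw [Finset.sum_congr rfl fun x hx => by rw [(hA x hx).factorization]]
  simp [Finsupp.single_apply]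

theorem Nat.factorization_natAbs_eq_zero {x : ℤ} {q : ℕ} (h : ¬ (q : ℤ) ∣ x) :
    x.natAbs.factorization q = 0 :=
  Nat.factorization_eq_zero_of_not_dvd (by rwa [Int.natCast_dvd] at h)

theorem Nat.factorization_natAbs_eq {x : ℤ} {q k : ℕ} (hq : q.Prime) (h : (q : ℤ) ^ k ∣ x)
    (h' : ¬ (q : ℤ) ^ (k + 1) ∣ x) : x.natAbs.factorization q = k := by
  have hx : x.natAbs ≠ 0 := by
    rintro hx
    rw [Int.natAbs_eq_zero] at hx
    exact h' (hx ▸ dvd_zero _)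
  have h1 : q ^ k ∣ x.natAbs := Int.natCast_dvd.1 (by exact_mod_cast h)
  have h2 : ¬ q ^ (k + 1) ∣ x.natAbs := fun h3 => h' (by exact_mod_cast Int.natCast_dvd.2 h3)
  rw [hq.pow_dvd_iff_le_factorization hx] at h1 h2
  omega

/-- The `q`-part of `gcd x m` agrees with that of `y` if `x ≡ y` modulo `m` and `q` divides `m`
to a high power. -/
theorem Nat.factorization_gcd_of_modEq {x y : ℤ} {m q N : ℕ} (hq : q.Prime) (hx : x ≠ 0)
    (hy : y ≠ 0)
    (hm : m ≠ 0) (hxy : y ≡ x [ZMOD m]) (hN : x.natAbs ≤ N) (hqm : q ^ N ∣ m) :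
    (Int.gcd x m).factorization q = y.natAbs.factorization q := by
  have h1 : Int.gcd x m = Int.gcd y m := by
    rw [← Int.gcd_emod, ← hxy, Int.gcd_emod]
  have h2 : Int.gcd y m = Nat.gcd y.natAbs m := rfl
  rw [h1, h2, Nat.factorization_gcd (Int.natAbs_ne_zero.2 hy) hm, Finsupp.inf_apply, inf_eq_left]
  have h3 := (hq.pow_dvd_iff_le_factorization hm).1 hqm
  refine le_trans ?_ h3
  by_contra! h4
  have h5 : (q : ℤ) ^ N ∣ y := by
    have := Int.natCast_dvd.2 (((hq.pow_dvd_iff_le_factorization (Int.natAbs_ne_zero.2 hy)).2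
        h4.le))
    exact_mod_cast this
  have h6 : (q : ℤ) ^ N ∣ x := (hxy.of_dvd (by exact_mod_cast hqm)).dvd_iff.1 (by exact_mod_cast h5)
  have h7 := Nat.le_of_dvd (Int.natAbs_pos.2 hx) (Int.natCast_dvd.1 (by exact_mod_cast h6))
  have := Nat.lt_pow_self (n := N) hq.one_lt
  omega

end

section

open NumberField IntermediateField Polynomial
set_option linter.unusedSectionVars false

theorem reducedDiscr_factorization (K : Type*) [Field K] [NumberField K] {q : ℕ} (hq : q.Prime) :
    (reducedDiscr K).factorization q = if (q : ℤ) ∣ discr K then 1 else 0 := by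
  rw [reducedDiscr, Nat.factorization_prod_id_of_prime fun q hq => Nat.prime_of_mem_primeFactors hq]
  simp [Nat.mem_primeFactors, hq, Int.natCast_dvd, discr_ne_zero]

theorem reducedDiscr_ne_zero (K : Type*) [Field K] [NumberField K] : reducedDiscr K ≠ 0 :=
  Finset.prod_ne_zero_iff.2 fun _ hq => (Nat.prime_of_mem_primeFactors hq).ne_zero

namespace CriticalFamily
variable {n : ℕ} (𝓕 : CriticalFamily n) {w : ℤ}

theorem mul_ne_zero_of_lt (h : |𝓕.a| + |𝓕.a'| < w) : w * 𝓕.τ w * 𝓕.ρ w ≠ 0 := by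
  have h1 := abs_nonneg 𝓕.a
  have h2 := abs_nonneg 𝓕.a'
  exact mul_ne_zero (mul_ne_zero (by linarith) (add_mul_sq_ne_zero 𝓕.natAbs_ε (by linarith)))
    (add_mul_sq_ne_zero 𝓕.natAbs_ε (by linarith))

theorem ε_mul_self : 𝓕.ε * 𝓕.ε = 1 := by
  have := Int.natAbs_mul_self' 𝓕.ε
  rw [𝓕.natAbs_ε] at this
  exact_mod_cast this.symm

theorem τ_mul_ρ_pos_of_lt (h : |𝓕.a| + |𝓕.a'| < w) : 0 < 𝓕.τ w * 𝓕.ρ w := by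
  have h3 : |𝓕.ε| = 1 := by rw [Int.abs_eq_natAbs, 𝓕.natAbs_ε]; rfl
  have key : ∀ a : ℤ, |a| < w → 0 < 𝓕.ε * (a + 𝓕.ε * w ^ 2) := by
    intro a ha
    have h4 : |𝓕.ε * a| = |a| := by rw [abs_mul, h3, one_mul]
    have h5 := neg_abs_le (𝓕.ε * a)
    have := abs_nonneg a
    have h6 : 𝓕.ε * (a + 𝓕.ε * w ^ 2) = 𝓕.ε * a + w ^ 2 := by
      linear_combination w ^ 2 * 𝓕.ε_mul_self
    nlinarith
  have h1 := abs_nonneg 𝓕.a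
  have h2 := abs_nonneg 𝓕.a'
  have h7 := mul_pos (key 𝓕.a (by linarith)) (key 𝓕.a' (by linarith))
  rwa [show 𝓕.ε * (𝓕.a + 𝓕.ε * w ^ 2) * (𝓕.ε * (𝓕.a' + 𝓕.ε * w ^ 2)) = 𝓕.τ w * 𝓕.ρ w by
    rw [τ, ρ]; linear_combination (𝓕.a + 𝓕.ε * w ^ 2) * (𝓕.a' + 𝓕.ε * w ^ 2) * 𝓕.ε_mul_self] at h7

theorem τ_modEq {m x y : ℤ} (h : x ≡ y [ZMOD m]) : 𝓕.τ x ≡ 𝓕.τ y [ZMOD m] :=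
  ((h.pow 2).mul_left _).add_left _

theorem ρ_modEq {m x y : ℤ} (h : x ≡ y [ZMOD m]) : 𝓕.ρ x ≡ 𝓕.ρ y [ZMOD m] :=
  ((h.pow 2).mul_left _).add_left _

theorem exists_modEq_lt (w₁ : ℤ) {m : ℤ} (hm : m ≠ 0) (B : ℤ) : ∃ w, w ≡ w₁ [ZMOD m] ∧ B < w := by
  refine ⟨w₁ + m * (m * (|w₁| + |B| + 1)), by simp [Int.ModEq], ?_⟩
  have h1 : 1 ≤ m * m := by
    have := mul_self_pos.2 hm
    linarith
  have h2 := neg_abs_le w₁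
  have h3 := le_abs_self B
  have := abs_nonneg w₁
  have := abs_nonneg B
  nlinarith

/-- The congruence deduced from the factorization of the reduced discriminant. -/
theorem reducedDiscr_modEq {D D₀ τ₀ ρ₀ ℓ p : ℕ} {x y x' y' k : ℤ} (hp : p.Prime)
    (h : D * (τ₀ * ρ₀ * ℓ) = D₀ * (x.natAbs * y.natAbs)) (hxy : 0 < x * y)
    (hx : x ≡ x' [ZMOD p]) (hy : y ≡ y' [ZMOD p]) (hpd : ¬ (p : ℤ) ∣ τ₀ * ρ₀ * ℓ)
    (hℓ : k * (τ₀ * ρ₀ * ℓ) ≡ D₀ * (x' * y') [ZMOD p]) : (D : ℤ) ≡ k [ZMOD p] := by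
  have hpi : Prime (p : ℤ) := Nat.prime_iff_prime_int.1 hp
  have h1 : (D : ℤ) * (τ₀ * ρ₀ * ℓ) = D₀ * (x * y) := by
    rw [← Int.natAbs_mul] at h
    have h2 : ((x * y).natAbs : ℤ) = x * y := Int.natAbs_of_nonneg hxy.le
    rw [← h2]
    exact_mod_cast h
  have h3 : (D : ℤ) * (τ₀ * ρ₀ * ℓ) ≡ k * (τ₀ * ρ₀ * ℓ) [ZMOD p] := by
    rw [h1]
    exact ((hx.mul hy).mul_left _).trans hℓ.symm
  rw [Int.modEq_iff_dvd, ← sub_mul] at h3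
  exact Int.modEq_iff_dvd.2 ((hpi.dvd_mul.1 h3).resolve_right hpd)

set_option maxHeartbeats 400000 in
theorem exists_numberField (hn : 0 < n) {p : ℕ} (hp : p.Prime) (hp2 : p ≠ 2) {k : ℤ}
    (hk : ¬ (p : ℤ) ∣ k) {w₁ m₁ : ℤ} (hm₁ : ¬ (p : ℤ) ∣ m₁)
    (hprim : ∀ w, w ≡ w₁ [ZMOD m₁] → ∀ (L : Type) [Field L] [NumberField L] [IsGalois ℚ L]
      (R : RootLabelling (𝓕.poly w) n L), MulAction.IsPreprimitive R.perm.range (Fin n))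
    {w₂ : ℤ} (hw₂ : ¬ (p : ℤ) ∣ 𝓕.c * (w₂ * 𝓕.Q.eval 𝓕.s) * (𝓕.ρ w₂ * 𝓕.Q.eval 𝓕.r) *
      (𝓕.τ w₂ * 𝓕.Q.eval 0)) (ha' : ¬ (p : ℤ) ∣ 𝓕.a') :
    ∃ (K : Type) (_ : Field K) (_ : NumberField K), IsGalois ℚ K ∧
      Nonempty (Gal(K/ℚ) ≃* alternatingGroup (Fin n)) ∧ (reducedDiscr K : ℤ) ≡ k [ZMOD p] := by
  have hpi : Prime (p : ℤ) := Nat.prime_iff_prime_int.1 hp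
  have hm₁0 : m₁ ≠ 0 := fun h => hm₁ (h ▸ dvd_zero _)
  simp only [hpi.dvd_mul, not_or] at hw₂
  obtain ⟨⟨⟨hpc, hpw, hpQs⟩, hpρ, hpQr⟩, hpτ, hpQ0⟩ := hw₂
  -- the bad primes other than `p` are the prime factors of `T'`
  obtain ⟨e, T, hpT, hT⟩ := Nat.exists_eq_pow_mul_and_not_dvd
    (n := (m₁ * 𝓕.bad * (Nat.factorial 16 : ℕ)).natAbs) (Int.natAbs_ne_zero.2
      (mul_ne_zero (mul_ne_zero hm₁0 𝓕.bad_ne_zero) (by positivity))) p hp.ne_one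
  have hT0 : T ≠ 0 := fun h => hpT (h ▸ dvd_zero _)
  have hgood : ∀ q : ℕ, q.Prime → q ≠ p → ¬ q ∣ T → 17 ≤ q ∧ ¬ (q : ℤ) ∣ 𝓕.bad := by
    intro q hq hqp hqT
    have hqi : Prime (q : ℤ) := Nat.prime_iff_prime_int.1 hq
    have h1 : ¬ (q : ℤ) ∣ m₁ * 𝓕.bad * (Nat.factorial 16 : ℕ) := by
      rw [Int.natCast_dvd, hT, hq.dvd_mul, not_or]
      exact ⟨fun h => hqp ((Nat.prime_dvd_prime_iff_eq hq hp).1 (hq.dvd_of_dvd_pow h)), hqT⟩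
    simp only [hqi.dvd_mul, not_or] at h1
    refine ⟨?_, h1.1.2⟩
    by_contra! h2
    exact h1.2 (by exact_mod_cast (hq.dvd_factorial.2 (by omega : q ≤ 16)))
  have hm₁T : m₁ ∣ (T : ℤ) := by
    have h1 : m₁.natAbs ∣ p ^ e * T := by
      rw [← hT, Int.natAbs_mul, Int.natAbs_mul, mul_assoc]
      exact dvd_mul_right _ _
    refine Int.dvd_natCast.2 (Nat.Coprime.dvd_of_dvd_mul_left ?_ h1)
    refine Nat.Coprime.pow_right _ ((hp.coprime_iff_not_dvd.2 ?_).symm)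
    rwa [← Int.natCast_dvd]
  obtain ⟨wS, hwS1, hwSlt⟩ := exists_modEq_lt w₁ hm₁0 (|𝓕.a| + |𝓕.a'|)
  have hwS := 𝓕.mul_ne_zero_of_lt hwSlt
  obtain ⟨K₀, _, _, hK₀⟩ := exists_numberField_isSplittingField ((𝓕.poly wS).map (algebraMap ℤ ℚ))
  obtain ⟨N, hN⟩ := 𝓕.exists_forall_dvd_discr_iff K₀ hn hwS
  obtain ⟨N', hNN', hτN', hρN', hN'0⟩ : ∃ N', N ≤ N' ∧ (𝓕.τ wS).natAbs ≤ N' ∧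
      (𝓕.ρ wS).natAbs ≤ N' ∧ N' ≠ 0 :=
    ⟨N + (𝓕.τ wS).natAbs + (𝓕.ρ wS).natAbs + 1, by omega, by omega, by omega, by omega⟩
  obtain ⟨M, hM⟩ : ∃ M, M = T ^ N' := ⟨_, rfl⟩
  have hM0 : M ≠ 0 := hM ▸ pow_ne_zero _ hT0
  have hpM : ¬ p ∣ M := fun h => hpT (hp.dvd_of_dvd_pow (hM ▸ h))
  obtain ⟨D₀, hD₀⟩ : ∃ D₀, D₀ = ∏ q ∈ T.primeFactors.filter fun q : ℕ => (q : ℤ) ∣ discr K₀, q :=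
      ⟨_, rfl⟩
  obtain ⟨τ₀, hτ₀⟩ : ∃ τ₀, τ₀ = Int.gcd (𝓕.τ wS) M := ⟨_, rfl⟩
  obtain ⟨ρ₀, hρ₀⟩ : ∃ ρ₀, ρ₀ = Int.gcd (𝓕.ρ wS) M := ⟨_, rfl⟩
  have hD₀prime : ∀ q ∈ T.primeFactors.filter fun q : ℕ => (q : ℤ) ∣ discr K₀, q.Prime := fun q hq
      =>
    Nat.prime_of_mem_primeFactors (Finset.mem_filter.1 hq).1
  have hpD₀ : ¬ p ∣ D₀ := by
    rw [hD₀, hp.prime.dvd_finsetProd_iff]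
    rintro ⟨q, hq, hpq⟩
    rw [Nat.prime_dvd_prime_iff_eq hp (hD₀prime q hq)] at hpq
    exact hpT (hpq ▸ Nat.dvd_of_mem_primeFactors (Finset.mem_filter.1 hq).1)
  have hpτ₀ : ¬ p ∣ τ₀ := fun h => hpM (h.trans (hτ₀ ▸ Int.natCast_dvd_natCast.1
      (Int.gcd_dvd_right ..)))
  have hpρ₀ : ¬ p ∣ ρ₀ := fun h => hpM (h.trans (hρ₀ ▸ Int.natCast_dvd_natCast.1
      (Int.gcd_dvd_right ..)))
  have hτ₀0 : τ₀ ≠ 0 := fun h => hpτ₀ (h ▸ dvd_zero _)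
  have hρ₀0 : ρ₀ ≠ 0 := fun h => hpρ₀ (h ▸ dvd_zero _)
  have hD₀0 : D₀ ≠ 0 := fun h => hpD₀ (h ▸ dvd_zero _)
  -- the auxiliary prime
  have hkp : ¬ (p : ℤ) ∣ k * (τ₀ * ρ₀) :=
    hpi.not_dvd_mul hk (hpi.not_dvd_mul (by exact_mod_cast hpτ₀) (by exact_mod_cast hpρ₀))
  obtain ⟨u, v, huv⟩ := hpi.coprime_iff_not_dvd.2 hkp
  have hpv : ¬ (p : ℤ) ∣ v := fun h => hpi.not_dvd_one
    (huv ▸ dvd_add (dvd_mul_left _ _) (dvd_mul_of_dvd_left h _))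
  obtain ⟨ℓ, hℓB, hℓ, hℓc, hℓs⟩ := exists_prime_gt_modEq_isSquare (Δ := -(𝓕.ε * 𝓕.a'))
    (neg_ne_zero.2 (mul_ne_zero (fun h => by simpa [h] using 𝓕.natAbs_ε)
      fun h => ha' (h ▸ dvd_zero _))) hp hp2
    (by
      rw [dvd_neg, (Int.isUnit_iff_natAbs_eq.2 𝓕.natAbs_ε).dvd_mul_left]
      exact ha')
    (c := D₀ * (𝓕.τ w₂ * 𝓕.ρ w₂) * v)
    (hpi.not_dvd_mul (hpi.not_dvd_mul (by exact_mod_cast hpD₀) (hpi.not_dvd_mul hpτ hpρ)) hpv)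
    (T + p + 2)
  have hℓp : ℓ ≠ p := by omega
  have hℓT : ¬ ℓ ∣ T := fun h => by
    have := Nat.le_of_dvd (Nat.pos_of_ne_zero hT0) h
    omega
  have hpℓ : ¬ p ∣ ℓ := fun h => hℓp ((Nat.prime_dvd_prime_iff_eq hp hℓ).1 h).symm
  have hℓM : ¬ ℓ ∣ M := fun h => hℓT (hℓ.dvd_of_dvd_pow (hM ▸ h))
  have hℓgood := (hgood ℓ hℓ hℓp hℓT).2
  obtain ⟨⟨_, hℓa, hℓa', hℓaa⟩, _, _⟩ := 𝓕.not_dvd_of_not_dvd_bad hℓ hℓgood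
  obtain ⟨u₃, hu₃, hu₃'⟩ := exists_emultiplicity_add_mul_sq hℓ (by omega) 𝓕.natAbs_ε hℓa' hℓs
    two_pos
  obtain ⟨w₄, hw₄S, hw₄p⟩ := Int.exists_modEq_modEq (m := M) (n := p)
    (Nat.isCoprime_iff_coprime.2 ((hp.coprime_iff_not_dvd.2 hpM).symm)) wS w₂
  obtain ⟨w₅, hw₅, hw₅ℓ⟩ := Int.exists_modEq_modEq (m := (M * p : ℕ)) (n := (ℓ ^ 3 : ℕ))
    (Nat.isCoprime_iff_coprime.2 (Nat.Coprime.pow_right 3 ((hℓ.coprime_iff_not_dvd.2 (by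
      rw [hℓ.dvd_mul, not_or]
      exact ⟨hℓM, fun h => hℓp ((Nat.prime_dvd_prime_iff_eq hℓ hp).1 h)⟩)).symm))) w₄ u₃
  obtain ⟨w, hwB, hw₅', hsq⟩ := exists_forall_not_sq_dvd (a := 𝓕.a) (a' := 𝓕.a') 𝓕.natAbs_ε
    (M := M * p * ℓ ^ 3) (mul_ne_zero (mul_ne_zero hM0 hp.ne_zero) (pow_ne_zero _ hℓ.ne_zero))
    (by
      intro q hq hqM
      simp only [hq.dvd_mul, not_or] at hqM
      obtain ⟨h1, h2⟩ := hgood q hq (fun h => hqM.1.2 (h ▸ dvd_rfl))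
        fun h => hqM.1.1 (hM ▸ dvd_pow h hN'0)
      exact ⟨h1, (𝓕.not_dvd_of_not_dvd_bad hq h2).1.2.1, (𝓕.not_dvd_of_not_dvd_bad hq h2).1.2.2.1⟩)
    w₅ (|𝓕.a| + |𝓕.a'| + 1)
  have hw0 := 𝓕.mul_ne_zero_of_lt (w := w) (by linarith)
  have hpos := 𝓕.τ_mul_ρ_pos_of_lt (w := w) (by linarith)
  push_cast at hw₅' hw₅ hw₅ℓ
  have hwℓ : w ≡ u₃ [ZMOD (ℓ : ℤ) ^ 3] := (hw₅'.of_mul_left _).trans hw₅ℓ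
  have hwMp : w ≡ w₄ [ZMOD (M * p : ℤ)] := (hw₅'.of_mul_right _).trans hw₅
  have hwp : w ≡ w₂ [ZMOD p] := (hwMp.of_mul_left _).trans hw₄p
  have hwM : w ≡ wS [ZMOD M] := (hwMp.of_mul_right _).trans hw₄S
  have hτp := 𝓕.τ_modEq hwp
  have hρp := 𝓕.ρ_modEq hwp
  have hpτw : ¬ (p : ℤ) ∣ 𝓕.τ w := fun h => hpτ (hτp.dvd_iff.1 h)
  have hpρw : ¬ (p : ℤ) ∣ 𝓕.ρ w := fun h => hpρ (hρp.dvd_iff.1 h)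
  have hρℓ := 𝓕.ρ_modEq hwℓ
  have hρℓ2 : (ℓ : ℤ) ^ 2 ∣ 𝓕.ρ w :=
    (hρℓ.of_dvd (pow_dvd_pow _ (by norm_num))).dvd_iff.2 hu₃
  have hρℓ3 : ¬ (ℓ : ℤ) ^ 3 ∣ 𝓕.ρ w := fun h => hu₃' (hρℓ.dvd_iff.1 h)
  have hsub : 𝓕.τ w - 𝓕.ρ w = 𝓕.a - 𝓕.a' := by rw [τ, ρ]; ring
  have hτℓ : ¬ (ℓ : ℤ) ∣ 𝓕.τ w := fun h => hℓaa (hsub ▸ dvd_sub h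
    ((dvd_pow_self _ two_ne_zero).trans hρℓ2))
  have hsq' : ∀ q : ℕ, q.Prime → q ≠ p → ¬ q ∣ T → q ≠ ℓ →
      ¬ (q : ℤ) ^ 2 ∣ 𝓕.τ w ∧ ¬ (q : ℤ) ^ 2 ∣ 𝓕.ρ w := by
    intro q hq h1 h2 h3
    refine hsq q hq ?_
    simp only [hq.dvd_mul, not_or]
    exact ⟨⟨fun h => h2 (hq.dvd_of_dvd_pow (hM ▸ h)),
      fun h => h1 ((Nat.prime_dvd_prime_iff_eq hq hp).1 h)⟩,
      fun h => h3 ((Nat.prime_dvd_prime_iff_eq hq hℓ).1 (hq.dvd_of_dvd_pow h))⟩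
  obtain ⟨K, _, _, hK⟩ := exists_numberField_isSplittingField ((𝓕.poly w).map (algebraMap ℤ ℚ))
  have hww₁ : w ≡ w₁ [ZMOD m₁] := by
    refine (hwM.of_dvd (hm₁T.trans ?_)).trans hwS1
    exact Int.natCast_dvd_natCast.2 (hM ▸ dvd_pow_self _ hN'0)
  have hG := isGalois_of_isSplittingField_map (𝓕.separable hw0) K
  have hℓρ : (ℓ : ℤ) ∣ 𝓕.ρ w := (dvd_pow_self _ two_ne_zero).trans hρℓ2
  have hA := 𝓕.nonempty_mulEquiv_alternatingGroup K hw0 (hprim w hww₁) hℓ hℓgood hℓρ hρℓ3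
  refine ⟨K, inferInstance, inferInstance, hG, hA, ?_⟩
  refine reducedDiscr_modEq (D₀ := D₀) (τ₀ := τ₀) (ρ₀ := ρ₀) (ℓ := ℓ) hp ?_ hpos hτp hρp ?_ ?_
  · have hw0' := hw0
    simp only [mul_ne_zero_iff] at hw0' hwS
    obtain ⟨⟨-, hτ0⟩, hρ0⟩ := hw0'
    have hτ0' := Int.natAbs_ne_zero.2 hτ0
    have hρ0' := Int.natAbs_ne_zero.2 hρ0
    refine Nat.eq_of_factorization_eq
      (mul_ne_zero (reducedDiscr_ne_zero K) (mul_ne_zero (mul_ne_zero hτ₀0 hρ₀0) hℓ.ne_zero))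
      (mul_ne_zero hD₀0 (mul_ne_zero hτ0' hρ0')) fun q => ?_
    by_cases hq : q.Prime
    swap
    · rw [Nat.factorization_eq_zero_of_not_prime _ hq, Nat.factorization_eq_zero_of_not_prime _ hq]
    rw [Nat.factorization_mul (reducedDiscr_ne_zero K)
        (mul_ne_zero (mul_ne_zero hτ₀0 hρ₀0) hℓ.ne_zero),
      Nat.factorization_mul (mul_ne_zero hτ₀0 hρ₀0) hℓ.ne_zero, Nat.factorization_mul hτ₀0 hρ₀0,
      Nat.factorization_mul hD₀0 (mul_ne_zero hτ0' hρ0'), Nat.factorization_mul hτ0' hρ0']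
    simp only [Finsupp.add_apply]
    rw [reducedDiscr_factorization K hq, hD₀, Nat.factorization_prod_id_of_prime hD₀prime,
      hℓ.factorization]
    simp only [Finset.mem_filter, Nat.mem_primeFactors, hq, hT0, ne_eq, not_false_eq_true, and_true,
      true_and, Finsupp.single_apply]
    by_cases hqT : q ∣ T
    · have hqM : q ^ N' ∣ M := hM ▸ pow_dvd_pow_of_dvd hqT _
      have hℓq : ℓ ≠ q := fun h => hℓT (h ▸ hqT)
      rw [hτ₀, hρ₀, Nat.factorization_gcd_of_modEq hq hwS.1.2 hτ0 hM0 (𝓕.τ_modEq hwM) hτN' hqM,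
        Nat.factorization_gcd_of_modEq hq hwS.2 hρ0 hM0 (𝓕.ρ_modEq hwM) hρN' hqM]
      have h1 : (q : ℤ) ∣ discr K ↔ (q : ℤ) ∣ discr K₀ := by
        refine hN q hq w hw0 ?_ K
        refine dvd_trans ?_ hwM.symm.dvd
        refine (pow_dvd_pow _ hNN').trans ?_
        exact_mod_cast hqM
      simp [h1, hqT, hℓq]
    · have h1 : τ₀.factorization q = 0 := Nat.factorization_eq_zero_of_not_dvd fun h =>
        hqT (hq.dvd_of_dvd_pow (hM ▸ h.trans (hτ₀ ▸ Int.natCast_dvd_natCast.1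
            (Int.gcd_dvd_right ..))))
      have h2 : ρ₀.factorization q = 0 := Nat.factorization_eq_zero_of_not_dvd fun h =>
        hqT (hq.dvd_of_dvd_pow (hM ▸ h.trans (hρ₀ ▸ Int.natCast_dvd_natCast.1
            (Int.gcd_dvd_right ..))))
      simp only [h1, h2, hqT, false_and, if_false, zero_add]
      by_cases hqp : q = p
      · subst hqp
        have h3 : ¬ (q : ℤ) ∣ discr K := 𝓕.not_dvd_discr K hw0 hq hpc
          (hpi.not_dvd_mul (fun h => hpw (hwp.dvd_iff.1 h)) hpQs)
          (hpi.not_dvd_mul hpρw hpQr) (hpi.not_dvd_mul hpτw hpQ0)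
        simp [h3, hℓp, Nat.factorization_natAbs_eq_zero hpτw, Nat.factorization_natAbs_eq_zero hpρw]
      by_cases hqℓ : q = ℓ
      · subst hqℓ
        have h3 : (q : ℤ) ∣ discr K := (𝓕.dvd_discr_iff K hw0 hq hℓgood
          (fun h => hτℓ ((dvd_pow_self _ two_ne_zero).trans h)) hρℓ3).2
          (Or.inr ((dvd_pow_self _ two_ne_zero).trans hρℓ2))
        simp [h3, Nat.factorization_natAbs_eq_zero hτℓ, Nat.factorization_natAbs_eq hq hρℓ2 hρℓ3]
      obtain ⟨h3, h4⟩ := hsq' q hq hqp hqT hqℓ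
      have hqg := (hgood q hq hqp hqT).2
      have h5 := 𝓕.dvd_discr_iff K hw0 hq hqg h3
        fun h => h4 ((pow_dvd_pow _ (by norm_num)).trans h)
      have h6 : ¬ ((q : ℤ) ∣ 𝓕.τ w ∧ (q : ℤ) ∣ 𝓕.ρ w) := fun h =>
        (𝓕.not_dvd_of_not_dvd_bad hq hqg).1.2.2.2 (hsub ▸ dvd_sub h.1 h.2)
      have h7 : ∀ x : ℤ, ¬ (q : ℤ) ^ 2 ∣ x →
          x.natAbs.factorization q = if (q : ℤ) ∣ x then 1 else 0 := by
        intro x hx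
        split_ifs with h
        · exact Nat.factorization_natAbs_eq hq (by simpa using h) hx
        · exact Nat.factorization_natAbs_eq_zero h
      rw [h7 _ h3, h7 _ h4]
      by_cases h8 : (q : ℤ) ∣ 𝓕.τ w <;> by_cases h9 : (q : ℤ) ∣ 𝓕.ρ w <;>
        simp_all [Ne.symm hqℓ]
  · exact hpi.not_dvd_mul (hpi.not_dvd_mul (by exact_mod_cast hpτ₀) (by exact_mod_cast hpρ₀))
      (by exact_mod_cast hpℓ)
  · have h1 := hℓc.mul_left (k * (τ₀ * ρ₀))
    rw [← mul_assoc k] 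
    refine h1.trans (Int.modEq_iff_dvd.2 ⟨u * (D₀ * (𝓕.τ w₂ * 𝓕.ρ w₂)), ?_⟩)
    linear_combination (-(D₀ * (𝓕.τ w₂ * 𝓕.ρ w₂) : ℤ)) * huv

end CriticalFamily

/-- A zero of `G` at which the Wronskian of `G` and `Q` vanishes to order `k` has multiplicity
at least `k + 1`. -/
theorem pow_succ_dvd_of_wronskian {G Q : ℤ[X]} {t : ℤ} {k : ℕ} (hG : G.eval t = 0) (hG0 : G ≠ 0)
    (hQ : Q.eval t ≠ 0) (h : (X - C t) ^ k ∣ derivative G * Q - G * derivative Q) :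
    (X - C t) ^ (k + 1) ∣ G := by
  rw [← le_rootMultiplicity_iff hG0]
  by_contra! hlt
  obtain ⟨g, hg, hg'⟩ := exists_eq_pow_rootMultiplicity_mul_and_not_dvd G hG0 t
  obtain ⟨m, hm⟩ : ∃ m, rootMultiplicity t G = m + 1 :=
    ⟨_, (Nat.succ_pred_eq_of_pos ((rootMultiplicity_pos hG0).2 hG)).symm⟩
  rw [hm] at hg hlt
  have h1 : derivative G * Q - G * derivative Q = (X - C t) ^ m *
      (((m : ℤ[X]) + 1) * g * Q + (X - C t) * (derivative g * Q - g * derivative Q)) := by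
    rw [hg]
    simp only [derivative_mul, derivative_X_sub_C_pow, Nat.add_sub_cancel, Nat.cast_add,
      Nat.cast_one, C_add, C_1, map_natCast]
    ring
  have h2 : (X - C t) ^ (m + 1) ∣ (X - C t) ^ m *
      (((m : ℤ[X]) + 1) * g * Q + (X - C t) * (derivative g * Q - g * derivative Q)) :=
    h1 ▸ (pow_dvd_pow _ (by omega)).trans h
  rw [pow_succ, mul_dvd_mul_iff_left (pow_ne_zero _ (X_sub_C_ne_zero t)),
    dvd_add_left (dvd_mul_right _ _), dvd_iff_isRoot] at h2
  simp only [IsRoot.def, eval_mul, eval_add, eval_natCast, eval_one] at h2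
  rcases mul_eq_zero.1 h2 with h3 | h3
  · rcases mul_eq_zero.1 h3 with h4 | h4
    · have : (0 : ℤ) < m + 1 := by positivity
      omega
    · exact hg' (dvd_iff_isRoot.2 h4)
  · exact hQ h3

namespace RootLabelling
variable {F : ℤ[X]} {n : ℕ} {L : Type*} [Field L] [NumberField L] (R : RootLabelling F n L)

theorem prod_root_sub (x : ℤ) : ∏ i, (R.root i - (x : 𝓞 L)) = (((-1) ^ n * F.eval x : ℤ) : 𝓞 L) :=
    by
  have h1 := R.aeval_eq (x : 𝓞 L)
  have h2 : aeval (x : 𝓞 L) F = ((F.eval x : ℤ) : 𝓞 L) := by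
    simpa using aeval_algebraMap_apply_eq_algebraMap_eval (A := 𝓞 L) x F
  rw [h2] at h1
  rw [Int.cast_mul, h1]
  push_cast
  rw [show ((-1 : 𝓞 L) ^ n) = ∏ _i : Fin n, (-1 : 𝓞 L) by simp, ← Finset.prod_mul_distrib]
  exact Finset.prod_congr rfl fun i _ => by ring

theorem prod_aeval_derivative_mul_prod_aeval {S Q : ℤ[X]} {u c s r : ℤ} {e : ℕ}
    (hF : F = S - C u * Q)
    (hW : derivative S * Q - S * derivative Q = C c * (X - C s) * (X - C r) ^ 2 * X ^ e) :
    (∏ i, aeval (R.root i) (derivative F)) * ∏ i, aeval (R.root i) Q =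
      ((c ^ n * ((-1) ^ n * F.eval s) * ((-1) ^ n * F.eval r) ^ 2 * ((-1) ^ n * F.eval 0) ^ e : ℤ) :
        𝓞 L) := by
  have hC : ∀ (x : 𝓞 L) (z : ℤ), aeval x (C z) = (z : 𝓞 L) := by simp
  have h1 : ∀ i, aeval (R.root i) (derivative F) * aeval (R.root i) Q =
      c * (R.root i - (s : 𝓞 L)) * (R.root i - (r : 𝓞 L)) ^ 2 * (R.root i - ((0 : ℤ) : 𝓞 L)) ^ e :=
          by
    intro i
    have h2 : derivative F * Q = C c * (X - C s) * (X - C r) ^ 2 * X ^ e + F * derivative Q := by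
      have h5 : derivative F = derivative S - C u * derivative Q := by
        rw [hF, derivative_sub, derivative_C_mul]
      rw [← hW, h5, hF]
      ring
    have h3 := congrArg (aeval (R.root i)) h2
    simp only [map_mul, map_add, map_sub, map_pow, aeval_X, hC, R.aeval_root] at h3
    rw [h3]
    simp
  rw [← Finset.prod_mul_distrib, Finset.prod_congr rfl fun i _ => h1 i]
  simp only [Finset.prod_mul_distrib, Finset.prod_pow, R.prod_root_sub]
  simp

end RootLabelling

namespace CriticalFamily
variable {n : ℕ} (𝓕 : CriticalFamily n) {w : ℤ} {q : ℕ} [hq : Fact q.Prime]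
variable {L : Type} [Field L] [NumberField L] [IsGalois ℚ L] (R : RootLabelling (𝓕.poly w) n L)
  (P : Ideal (𝓞 L)) [P.IsPrime] [P.LiesOver (Ideal.span {(q : ℤ)})]

include P in
/-- Inertia at a prime where all but few of the roots collide at `0`. -/
theorem exists_finset_fixed {k : ℕ} {g h : ℤ[X]} {δ : ℤ} (hF : 𝓕.poly w = X ^ k * g - C δ * h)
    (hδ : (q : ℤ) ∣ δ) (hδ' : ¬ (q : ℤ) ^ 2 ∣ δ) (hg : ¬ (q : ℤ) ∣ g.eval 0)
    (hh : ¬ (q : ℤ) ∣ h.eval 0) (hc : ¬ (q : ℤ) ∣ 𝓕.c) (hs : ¬ (q : ℤ) ∣ w * 𝓕.Q.eval 𝓕.s)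
    (hr : (q : ℤ) ∣ 𝓕.r ∨ ¬ (q : ℤ) ∣ 𝓕.ρ w * 𝓕.Q.eval 𝓕.r) :
    ∃ T : Finset (Fin n), T.card + k = n ∧
      ∀ i ∉ T, ∀ j ∉ T, ∃ g ∈ R.perm.range, g i = j ∧ ∀ k ∈ T, g k = k := by
  classical
  have hF' : 𝓕.poly w = (X - C 0) ^ k * g - C δ * h := by simpa using hF
  have hcard := R.card_root_sub_mem q P hF' hδ hg
  refine ⟨Finset.univ.filter fun i => R.root i ∉ P, ?_, ?_⟩
  · have h1 := Finset.card_filter_add_card_filter_not (s := (Finset.univ : Finset (Fin n)))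
      (p := fun i => R.root i ∈ P)
    simp only [Int.cast_zero, sub_zero] at hcard
    simp only [Finset.card_univ, Fintype.card_fin] at h1
    rw [hcard] at h1
    omega
  · intro i hi j hj
    simp only [Finset.mem_filter, Finset.mem_univ, true_and, not_not] at hi hj
    obtain ⟨σ, hσ, hij⟩ := R.exists_mem_inertia_perm_eq q P hF' one_pos
      (by
        rw [Nat.cast_one, emultiplicity_eq_coe (n := 1) |>.2]
        · rfl
        exact ⟨by simpa using hδ, hδ'⟩) (Nat.coprime_one_right k) hg hh
      (i := i) (j := j) (by simpa using hi) (by simpa using hj)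
    refine ⟨R.perm σ, ⟨σ, rfl⟩, hij, fun l hl => ?_⟩
    simp only [Finset.mem_filter, Finset.mem_univ, true_and] at hl
    refine R.perm_eq_of_aeval_derivative_notMem P hσ fun h => ?_
    rcases 𝓕.dvd_of_aeval_derivative_mem R P hc h with h | h | h
    · exact hs h.2
    · rcases hr with hr | hr
      · exact hl ((Submodule.sub_mem_iff_left _ ((intCast_mem_iff q P _).2 hr)).1 h.1)
      · exact hr h.2
    · exact hl (by simpa using h.1)

end CriticalFamily

namespace CriticalFamily

section
variable {n : ℕ} {S Q g0 : ℤ[X]} {ε a a' c s r : ℤ} {κ : ℕ}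
  (hε : ε.natAbs = 1) (hm : S.Monic) (hd : S.natDegree = n) (hQ : Q.natDegree < n)
  (hs : S.eval s = 0) (hr : S.eval r + a' * Q.eval r = 0) (hQs : Q.eval s ≠ 0)
  (hQr : Q.eval r ≠ 0) (h0 : S + C a * Q = X ^ κ * g0)
  (hW : derivative S * Q - S * derivative Q = C c * (X - C s) * (X - C r) ^ 2 * X ^ (κ - 1))
  (hκ : 4 ≤ κ) (hne : c * s * r * (r - s) * a * a' * (a - a') ≠ 0)
  (hsq : ∀ (w : ℤ) (L : Type) [Field L] [NumberField L]
    (R : RootLabelling (S - C (ε * w ^ 2) * Q) n L), ∃ y z : ℤ, y ≠ 0 ∧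
      (y : 𝓞 L) ^ 2 * ((-1) ^ (n * (n - 1) / 2) *
        ∏ i, aeval (R.root i) (derivative (S - C (ε * w ^ 2) * Q))) = (z : 𝓞 L) ^ 2)

include hm hs hQs hW in
theorem sq_dvd_of_wronskian : (X - C s) ^ 2 ∣ S :=
  pow_succ_dvd_of_wronskian hs hm.ne_zero hQs (k := 1)
    (hW ▸ ⟨C c * (X - C r) ^ 2 * X ^ (κ - 1), by ring⟩)

include hm hd hQ hr hQr hW in
theorem cube_dvd_of_wronskian : (X - C r) ^ 3 ∣ S + C a' * Q := by
  refine pow_succ_dvd_of_wronskian (by simpa using hr) (Monic.add_of_left hm ?_).ne_zero hQr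
      (k := 2)
    ⟨C c * (X - C s) * X ^ (κ - 1), ?_⟩
  · exact degree_lt_degree ((natDegree_C_mul_le _ _).trans_lt (hd ▸ hQ))
  · simp only [derivative_add, derivative_C_mul]
    linear_combination hW

/-- The factorizations required of a critical family follow from the Wronskian. -/
noncomputable def ofWronskian : CriticalFamily n where
  S := S
  Q := Q
  gs := (sq_dvd_of_wronskian hm hs hQs hW).choose
  gr := (cube_dvd_of_wronskian hm hd hQ hr hQr hW).choose
  g0 := g0
  ε := ε
  a := a
  a' := a'
  c := c
  s := s
  r := r
  κ := κ
  natAbs_ε := hε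
  monic := hm
  natDegree_S := hd
  natDegree_Q := hQ
  eq_s := (sq_dvd_of_wronskian hm hs hQs hW).choose_spec
  eq_r := (cube_dvd_of_wronskian hm hd hQ hr hQr hW).choose_spec
  eq_zero := h0
  wronskian := hW
  four_le_κ := hκ
  ne_zero := hne
  isSquare := hsq

end

/-- A parameter at which the family is unramified at `p`. -/
theorem exists_not_dvd {p : ℕ} (hp : p.Prime) (hp3 : 3 < p) {a a' ε : ℤ} (hε : ε.natAbs = 1)
    (haa' : (p : ℤ) ∣ a - a') :
    ∃ w : ℤ, ¬ (p : ℤ) ∣ w ∧ ¬ (p : ℤ) ∣ a + ε * w ^ 2 ∧ ¬ (p : ℤ) ∣ a' + ε * w ^ 2 := by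
  have hpi : Prime (p : ℤ) := Nat.prime_iff_prime_int.1 hp
  have hlt : ∀ m : ℕ, 0 < m → m ≤ 3 → ¬ (p : ℤ) ∣ m := fun m hm hm3 h => by
    have := Nat.le_of_dvd hm (by exact_mod_cast h)
    omega
  have hkey : ∀ w : ℤ, (p : ℤ) ∣ a' + ε * w ^ 2 → (p : ℤ) ∣ a + ε * w ^ 2 := fun w h => by
    have := dvd_add haa' h
    rwa [show a - a' + (a' + ε * w ^ 2) = a + ε * w ^ 2 by ring] at this
  by_cases h1 : (p : ℤ) ∣ a + ε * 1 ^ 2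
  · have h2 : ¬ (p : ℤ) ∣ a + ε * 2 ^ 2 := fun h => by
      have h3 := dvd_sub h h1
      rw [show a + ε * 2 ^ 2 - (a + ε * 1 ^ 2) = ε * (3 : ℕ) by push_cast; ring,
        (Int.isUnit_iff_natAbs_eq.2 hε).dvd_mul_left] at h3
      exact hlt 3 (by norm_num) le_rfl h3
    exact ⟨2, by exact_mod_cast hlt 2 (by norm_num) (by norm_num), h2, fun h => h2 (hkey _ h)⟩
  · exact ⟨1, by exact_mod_cast hlt 1 (by norm_num) (by norm_num), h1, fun h => h1 (hkey _ h)⟩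

end CriticalFamily

/-- The data of a polynomial of even degree `2 e + 4` with critical points `0`, `s` and `r = s t`,
the last one double. -/
structure EvenData where
  e : ℕ
  t : ℤ
  two_le_e : 2 ≤ e
  lt_t : 2 * e + 4 < t

namespace EvenData
variable (D : EvenData)

/-- The simple critical point. -/
def s : ℤ := 8 * (2 * D.e + 3) * (2 * D.e + 2) * (2 * D.e + 1)

/-- The double critical point. -/
def r : ℤ := D.s * D.t

/-- The quadratic coefficient of the cubic factor, up to sign. -/
def c₂ : ℤ := (2 * D.e + 4) * (2 * D.t + 1) * (8 * (2 * D.e + 2) * (2 * D.e + 1))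

/-- The linear coefficient of the cubic factor. -/
def c₁ : ℤ := (2 * D.e + 4) * D.t * (D.t + 2) * (8 * (2 * D.e + 3) * (2 * D.e + 1)) * D.s

/-- The constant coefficient of the cubic factor, up to sign. -/
def c₀ : ℤ := (2 * D.e + 4) * D.t ^ 2 * D.s ^ 2 * (8 * (2 * D.e + 3) * (2 * D.e + 2))

/-- The cubic factor. -/
noncomputable def g : ℤ[X] := X ^ 3 - C D.c₂ * X ^ 2 + C D.c₁ * X - C D.c₀

/-- The value of the polynomial at `s`. -/
def a : ℤ := D.s ^ (2 * D.e + 1) * (D.s ^ 3 - D.c₂ * D.s ^ 2 + D.c₁ * D.s - D.c₀)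

/-- The value of the polynomial at `s` minus its value at `r`. -/
def a' : ℤ := D.a - 16 * D.r ^ (2 * D.e + 1) * D.s ^ 2 * D.t ^ 2 *
    ((2 * D.e + 1) * D.t - (2 * D.e + 4))

/-- The polynomial, normalized to vanish at `s`. -/
noncomputable def S : ℤ[X] := X ^ (2 * D.e + 1) * D.g - C D.a

theorem natDegree_g : D.g.natDegree = 3 := by
  rw [g]; compute_degree!

theorem monic_g : D.g.Monic := by
  rw [g]; monicity!

theorem natDegree_X_pow_mul_g : (X ^ (2 * D.e + 1) * D.g).natDegree = 2 * D.e + 4 := by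
  rw [(monic_X_pow _).natDegree_mul D.monic_g, natDegree_X_pow, natDegree_g]

theorem natDegree_S : D.S.natDegree = 2 * D.e + 4 := by
  rw [S, natDegree_sub_C, natDegree_X_pow_mul_g]

theorem monic_S : D.S.Monic := by
  refine Monic.sub_of_left ((monic_X_pow _).mul D.monic_g) (degree_C_le.trans_lt ?_)
  rw [← natDegree_pos_iff_degree_pos, natDegree_X_pow_mul_g]
  omega

theorem wronskian : derivative D.S * 1 - D.S * derivative 1 =
    C (2 * D.e + 4 : ℤ) * (X - C D.s) * (X - C D.r) ^ 2 * X ^ (2 * D.e + 1 - 1) := by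
  have h2 : C ((2 * D.e + 3) * D.c₂) = C ((2 * D.e + 4) * (2 * D.r + D.s)) := by
    rw [c₂, r, s]; congr 1; ring
  have h1 : C ((2 * D.e + 2) * D.c₁) = C ((2 * D.e + 4) * (D.r ^ 2 + 2 * D.r * D.s)) := by
    rw [c₁, r, s]; congr 1; ring
  have h0 : C ((2 * D.e + 1) * D.c₀) = C ((2 * D.e + 4) * (D.r ^ 2 * D.s)) := by
    rw [c₀, r, s]; congr 1; ring
  rw [S, g, Nat.add_sub_cancel]
  simp only [derivative_sub, derivative_mul, derivative_X_pow, derivative_C, derivative_add,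
    derivative_X, derivative_one, Nat.add_sub_cancel, C_mul, C_add, C_pow, Nat.cast_add,
    Nat.cast_mul, Nat.cast_ofNat, Nat.cast_one, C_1, C_ofNat, map_natCast] at h0 h1 h2 ⊢
  linear_combination X ^ (2 * D.e) * (h1 * X - h2 * X ^ 2 - h0)

theorem cube_r : D.r ^ 3 - D.c₂ * D.r ^ 2 + D.c₁ * D.r - D.c₀ =
    16 * D.s ^ 2 * D.t ^ 2 * ((2 * D.e + 1) * D.t - (2 * D.e + 4)) := by
  rw [c₂, c₁, c₀, r, s]; ring

theorem dvd_a_add : D.t ∣ D.a + 8 * (2 * D.e + 2) * (2 * D.e + 1) * D.s ^ (2 * D.e + 3) := by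
  refine ⟨D.s ^ (2 * D.e + 3) * (- 2 * (2 * D.e + 4) * (8 * (2 * D.e + 2) * (2 * D.e + 1)) +
    (2 * D.e + 4) * (D.t + 2) * (8 * (2 * D.e + 3) * (2 * D.e + 1)) -
    (2 * D.e + 4) * D.t * (8 * (2 * D.e + 3) * (2 * D.e + 2))), ?_⟩
  have h : D.s ^ 3 = 8 * (2 * D.e + 3) * (2 * D.e + 2) * (2 * D.e + 1) * D.s ^ 2 := by
    rw [pow_succ, mul_comm]; rfl
  rw [a, c₂, c₁, c₀, h]
  ring

theorem e_pos : (0 : ℤ) < D.e := by exact_mod_cast (zero_lt_two.trans_le D.two_le_e)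

theorem t_dvd_a_sub_a' : D.t ∣ D.a - D.a' := by
  rw [a']
  exact ⟨16 * D.r ^ (2 * D.e + 1) * D.s ^ 2 * D.t * ((2 * D.e + 1) * D.t - (2 * D.e + 4)), by ring⟩

theorem not_dvd_of_lt {q : ℕ} (hqe : 2 * D.e + 4 < q) {x : ℕ} (hx : 0 < x)
    (hx' : x ≤ 2 * D.e + 4) : ¬ (q : ℤ) ∣ x := fun h => by
  have := Nat.le_of_dvd hx (by exact_mod_cast h)
  omega

theorem not_dvd_s {q : ℕ} (hq : q.Prime) (hqe : 2 * D.e + 4 < q) : ¬ (q : ℤ) ∣ D.s := by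
  have hqi : Prime (q : ℤ) := Nat.prime_iff_prime_int.1 hq
  have := D.two_le_e
  have h8 : ¬ (q : ℤ) ∣ 8 := D.not_dvd_of_lt hqe (x := 8) (by omega) (by omega)
  have h1 := D.not_dvd_of_lt hqe (x := 2 * D.e + 3) (by omega) (by omega)
  have h2 := D.not_dvd_of_lt hqe (x := 2 * D.e + 2) (by omega) (by omega)
  have h3 := D.not_dvd_of_lt hqe (x := 2 * D.e + 1) (by omega) (by omega)
  push_cast at h1 h2 h3
  exact hqi.not_dvd_mul (hqi.not_dvd_mul (hqi.not_dvd_mul h8 h1) h2) h3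

theorem not_dvd_a {q : ℕ} (hq : q.Prime) (hqe : 2 * D.e + 4 < q) (hqt : (q : ℤ) ∣ D.t) :
    ¬ (q : ℤ) ∣ D.a := by
  have hqi : Prime (q : ℤ) := Nat.prime_iff_prime_int.1 hq
  have := D.two_le_e
  have h8 : ¬ (q : ℤ) ∣ 8 := D.not_dvd_of_lt hqe (x := 8) (by omega) (by omega)
  have h2 := D.not_dvd_of_lt hqe (x := 2 * D.e + 2) (by omega) (by omega)
  have h3 := D.not_dvd_of_lt hqe (x := 2 * D.e + 1) (by omega) (by omega)
  push_cast at h2 h3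
  intro h
  exact hqi.not_dvd_mul (hqi.not_dvd_mul (hqi.not_dvd_mul h8 h2) h3)
    (fun h => D.not_dvd_s hq hqe (hqi.dvd_of_dvd_pow h))
    ((dvd_add_right h).1 (hqt.trans D.dvd_a_add))

theorem not_dvd_a' {q : ℕ} (hq : q.Prime) (hqe : 2 * D.e + 4 < q) (hqt : (q : ℤ) ∣ D.t) :
    ¬ (q : ℤ) ∣ D.a' := fun h => D.not_dvd_a hq hqe hqt (by
  have := dvd_add (hqt.trans D.t_dvd_a_sub_a') h
  rwa [sub_add_cancel] at this)

theorem s_pos : 0 < D.s := by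
  have := D.e_pos
  rw [s]
  positivity

theorem eval_S (x : ℤ) : D.S.eval x =
    x ^ (2 * D.e + 1) * (x ^ 3 - D.c₂ * x ^ 2 + D.c₁ * x - D.c₀) - D.a := by
  rw [S, g]; simp

/-- The sign for which the discriminants are squares. -/
def ε : ℤ := (-1) ^ (D.e + 1)

theorem isSquare {w : ℤ} {F : ℤ[X]} (hF : F = D.S - C (D.ε * w ^ 2) * 1) {L : Type} [Field L]
    [NumberField L] (R : RootLabelling F (2 * D.e + 4) L) : ∃ y z : ℤ, y ≠ 0 ∧
      (y : 𝓞 L) ^ 2 * ((-1) ^ ((2 * D.e + 4) * (2 * D.e + 4 - 1) / 2) *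
        ∏ i, aeval (R.root i) (derivative F)) = (z : 𝓞 L) ^ 2 := by
  have h1 := R.prod_aeval_derivative_mul_prod_aeval hF D.wronskian
  have h2 : F.eval D.s = - (D.ε * w ^ 2) := by
    rw [hF, eval_sub, eval_S, a]
    simp
  have h3 : (2 * D.e + 4) * (2 * D.e + 4 - 1) / 2 = (D.e + 2) * (2 * D.e + 3) := by
    rw [show 2 * D.e + 4 - 1 = 2 * D.e + 3 by omega]
    apply Nat.div_eq_of_eq_mul_left two_pos
    ring
  have h4 : (-1 : ℤ) ^ ((D.e + 2) * (2 * D.e + 3)) * -D.ε = 1 := by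
    rw [ε, show -((-1 : ℤ) ^ (D.e + 1)) = (-1) ^ (D.e + 1 + 1) by ring, ← pow_add,
      show (D.e + 2) * (2 * D.e + 3) + (D.e + 1 + 1) = 2 * ((D.e + 2) * (D.e + 2)) by ring, pow_mul]
    simp
  have h5 : (-1 : ℤ) ^ (2 * D.e + 4) = 1 := by
    rw [show 2 * D.e + 4 = 2 * (D.e + 2) by ring, pow_mul]
    simp
  refine ⟨1, (2 * D.e + 4) ^ (D.e + 2) * w * F.eval D.r * F.eval 0 ^ D.e, one_ne_zero, ?_⟩
  rw [h3]
  simp only [map_one, Finset.prod_const_one, mul_one] at h1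
  rw [h1, h2, h5]
  have h6 : (1 : ℤ) ^ 2 * ((-1) ^ ((D.e + 2) * (2 * D.e + 3)) * ((2 * D.e + 4) ^ (2 * D.e + 4) *
      (1 * -(D.ε * w ^ 2)) * (1 * F.eval D.r) ^ 2 * (1 * F.eval 0) ^ (2 * D.e + 1 - 1))) =
      ((2 * D.e + 4) ^ (D.e + 2) * w * F.eval D.r * F.eval 0 ^ D.e) ^ 2 := by
    rw [Nat.add_sub_cancel]
    linear_combination ((2 * D.e + 4) ^ (2 * D.e + 4) * w ^ 2 * (F.eval D.r) ^ 2 *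
      F.eval 0 ^ (2 * D.e)) * h4
  exact_mod_cast congrArg (Int.cast : ℤ → 𝓞 L) h6

/-- The family attached to the data. -/
noncomputable def family (h : D.a ≠ 0) (h' : D.a' ≠ 0) : CriticalFamily (2 * D.e + 4) :=
  CriticalFamily.ofWronskian (S := D.S) (Q := 1) (g0 := D.g) (ε := D.ε) (a := D.a) (a' := D.a')
    (c := 2 * D.e + 4) (s := D.s) (r := D.r) (κ := 2 * D.e + 1)
    (by simp [ε]) D.monic_S D.natDegree_S (by simp)
    (by rw [eval_S, a, sub_self])
    (by rw [eval_S, cube_r, a']; simp; ring)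
    (by simp) (by simp) (by rw [S]; ring) D.wronskian (by have := D.two_le_e; omega)
    (by
      have h1 := D.e_pos
      have h2 := D.lt_t
      have h3 := D.s_pos
      have h4 : 0 < D.t := by linarith
      have h5 : 0 < D.r := mul_pos h3 h4
      have h6 : D.r - D.s ≠ 0 := by
        rw [r, show D.s * D.t - D.s = D.s * (D.t - 1) by ring]
        exact mul_ne_zero h3.ne' (by linarith)
      have h7 : D.a - D.a' ≠ 0 := by
        rw [a', sub_sub_cancel]
        have : 0 < (2 * D.e + 1) * D.t - (2 * D.e + 4) := by nlinarith
        positivity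
      have h8 : (2 * D.e + 4 : ℤ) ≠ 0 := by positivity
      simp only [mul_ne_zero_iff]
      exact ⟨⟨⟨⟨⟨⟨h8, h3.ne'⟩, h5.ne'⟩, h6⟩, h⟩, h'⟩, h7⟩)
    (fun _ _ _ _ R => D.isSquare rfl R)

end EvenData

theorem Nat.Prime.not_sq_int_dvd {q : ℕ} (hq : q.Prime) : ¬ (q : ℤ) ^ 2 ∣ q := fun h => by
  have hqi : _root_.Prime (q : ℤ) := Nat.prime_iff_prime_int.1 hq
  exact hqi.not_dvd_one ((mul_dvd_mul_iff_left hqi.ne_zero).1 (by simpa [pow_two] using h))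

namespace RootLabelling
variable {F : ℤ[X]} {n : ℕ} {L : Type*} [Field L] [NumberField L] [IsGalois ℚ L]
  (R : RootLabelling F n L)

/-- A root which is not an integer is moved by the Galois group. -/
theorem exists_perm_ne (hF : ∀ z : ℤ, F.eval z ≠ 0) (i : Fin n) :
    ∃ σ : Gal(L/ℚ), R.perm σ i ≠ i := by
  by_contra! h
  have h1 : ∀ σ : Gal(L/ℚ), σ (R.root i : L) = R.root i := fun σ => by
    have := R.root_perm σ i
    rw [h] at this
    exact (congrArg (algebraMap (𝓞 L) L) this).symm
  obtain ⟨x, hx⟩ := (IsGalois.mem_range_algebraMap_iff_fixed (F := ℚ) (R.root i : L)).2 h1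
  have h2 : IsIntegral ℤ x := by
    rw [← isIntegral_algebraMap_iff (algebraMap ℚ L).injective, hx]
    exact (R.root i).2
  obtain ⟨z, rfl⟩ := IsIntegrallyClosed.isIntegral_iff.1 h2
  have h3 : R.root i = algebraMap ℤ (𝓞 L) z := RingOfIntegers.ext (by rw [← hx]; simp)
  have h4 := R.aeval_root i
  rw [h3, aeval_algebraMap_apply, map_eq_zero_iff _ (algebraMap ℤ (𝓞 L)).injective_int] at h4
  exact hF z (by simpa using h4)

end RootLabelling

namespace EvenData
variable (D : EvenData)

theorem eight_dvd_s : 8 ∣ D.s := ⟨(2 * D.e + 3) * (2 * D.e + 2) * (2 * D.e + 1), by rw [s]; ring⟩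

/-- The members of the family with parameter congruent to `2` modulo `4` have no integral root. -/
theorem eval_ne_zero {w : ℤ} (hw : w ≡ 2 [ZMOD 4]) (z : ℤ) :
    (D.S - C (D.ε * w ^ 2) * 1).eval z ≠ 0 := by
  intro h
  simp only [eval_sub, D.eval_S, eval_C, mul_one] at h
  have ha : 8 ∣ D.a := (dvd_pow D.eight_dvd_s (by omega)).mul_right _
  have h2 : 8 ∣ D.c₂ := by
    rw [c₂]
    exact Dvd.dvd.mul_left (Dvd.dvd.mul_right (dvd_mul_right 8 _) _) _
  have h1 : 8 ∣ D.c₁ := D.eight_dvd_s.mul_left _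
  have h0 : 8 ∣ D.c₀ := by
    rw [c₀]
    exact Dvd.dvd.mul_left (Dvd.dvd.mul_right (dvd_mul_right 8 _) _) _
  have h3 : (8 : ℤ) ∣ z ^ (2 * D.e + 4) - D.ε * w ^ 2 := by
    obtain ⟨x, hx⟩ := ha
    obtain ⟨x₂, hx₂⟩ := h2
    obtain ⟨x₁, hx₁⟩ := h1
    obtain ⟨x₀, hx₀⟩ := h0
    rw [hx, hx₂, hx₁, hx₀] at h
    exact ⟨x + z ^ (2 * D.e + 1) * (x₂ * z ^ 2 - x₁ * z + x₀), by linear_combination h⟩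
  have hε : D.ε * D.ε = 1 := by
    rw [ε, ← pow_add, ← two_mul, pow_mul]
    simp
  obtain ⟨k, hk⟩ := hw.symm.dvd
  have hw2 : w ^ 2 = 4 * (4 * (k ^ 2 + k) + 1) := by
    rw [show w = 2 + 4 * k by linarith]; ring
  have hz : (2 : ℤ) ∣ z := by
    refine Int.prime_two.dvd_of_dvd_pow (n := 2 * D.e + 4) ?_
    have h4 : (2 : ℤ) ∣ D.ε * w ^ 2 := ⟨D.ε * (2 * (4 * (k ^ 2 + k) + 1)), by rw [hw2]; ring⟩
    have := dvd_add ((show (2 : ℤ) ∣ 8 by norm_num).trans h3) h4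
    rwa [sub_add_cancel] at this
  have h5 : (8 : ℤ) ∣ z ^ (2 * D.e + 4) :=
    (show (8 : ℤ) = 2 ^ 3 by norm_num) ▸ (pow_dvd_pow_of_dvd hz 3).trans (pow_dvd_pow z (by omega))
  have h6 : (8 : ℤ) ∣ D.ε * (D.ε * w ^ 2) := ((dvd_sub_right h5).1 h3).mul_left _
  rw [← mul_assoc, hε, hw2] at h6
  omega

/-- The local expansion of the family at a prime factor of `t`. -/
theorem exists_eq_sub {w q : ℤ} (hq : q ∣ D.t) (hτ : q ∣ D.a + D.ε * w ^ 2)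
    (hτ' : ¬ q ^ 2 ∣ D.a + D.ε * w ^ 2) : ∃ h : ℤ[X], ¬ q ∣ h.eval 0 ∧
      D.S - C (D.ε * w ^ 2) * 1 = X ^ (2 * D.e + 3) * (X - C D.c₂) - C q * h := by
  obtain ⟨x₁, hx₁⟩ : q ∣ D.c₁ := by
    rw [c₁]
    exact Dvd.dvd.mul_right (Dvd.dvd.mul_right (Dvd.dvd.mul_right (hq.mul_left _) _) _) _
  obtain ⟨x₀, hx₀⟩ : q ∣ D.c₀ := by
    rw [c₀]
    exact Dvd.dvd.mul_right (Dvd.dvd.mul_right ((dvd_pow hq two_ne_zero).mul_left _) _) _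
  obtain ⟨y, hy⟩ := hτ
  refine ⟨C y - C x₁ * X ^ (2 * D.e + 2) + C x₀ * X ^ (2 * D.e + 1), ?_, ?_⟩
  · rintro ⟨z, hz⟩
    simp only [eval_add, eval_sub, eval_C, eval_mul, eval_pow, eval_X] at hz
    refine hτ' ⟨z, ?_⟩
    rw [hy, pow_two, mul_assoc, ← hz]
    simp
  · have hy' := congrArg (C : ℤ → ℤ[X]) hy
    simp only [C_add, C_mul] at hy'
    rw [S, g, hx₁, hx₀]
    simp only [C_mul]
    linear_combination (-1 : ℤ[X]) * hy'

set_option maxHeartbeats 400000 in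
/-- A suitable congruence on the parameter makes the Galois group primitive. -/
theorem isPreprimitive (h : D.a ≠ 0) (h' : D.a' ≠ 0) {q : ℕ} (hq : q.Prime)
    (hqe : 2 * D.e + 4 < q) (hqt : (q : ℤ) ∣ D.t) {w : ℤ} (hw : w ≡ 2 [ZMOD 4])
    (hτ : (q : ℤ) ∣ D.a + D.ε * w ^ 2) (hτ' : ¬ (q : ℤ) ^ 2 ∣ D.a + D.ε * w ^ 2)
    (L : Type) [Field L] [NumberField L] [IsGalois ℚ L]
    (R : RootLabelling ((D.family h h').poly w) (2 * D.e + 4) L) :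
    MulAction.IsPreprimitive R.perm.range (Fin (2 * D.e + 4)) := by
  have hqi : Prime (q : ℤ) := Nat.prime_iff_prime_int.1 hq
  have : Fact q.Prime := ⟨hq⟩
  have he := D.two_le_e
  obtain ⟨P, _, _⟩ := exists_prime_liesOver L q
  obtain ⟨H, hH, hF⟩ := D.exists_eq_sub hqt hτ hτ'
  have hc₂ : ¬ (q : ℤ) ∣ D.c₂ := by
    have h1 := D.not_dvd_of_lt hqe (x := 2 * D.e + 4) (by omega) (by omega)
    have h2 := D.not_dvd_of_lt hqe (x := 2 * D.e + 2) (by omega) (by omega)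
    have h3 := D.not_dvd_of_lt hqe (x := 2 * D.e + 1) (by omega) (by omega)
    have h8 := D.not_dvd_of_lt hqe (x := 8) (by omega) (by omega)
    push_cast at h1 h2 h3 h8
    have ht : ¬ (q : ℤ) ∣ 2 * D.t + 1 := fun h =>
      hqi.not_dvd_one ((dvd_add_right (hqt.mul_left 2)).1 h)
    exact hqi.not_dvd_mul (hqi.not_dvd_mul h1 ht) (hqi.not_dvd_mul (hqi.not_dvd_mul h8 h2) h3)
  have hqw : ¬ (q : ℤ) ∣ w := fun hw => D.not_dvd_a hq hqe hqt
    ((dvd_add_left ((dvd_pow hw two_ne_zero).mul_left _)).1 hτ)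
  obtain ⟨T, hT, hfix⟩ := (D.family h h').exists_finset_fixed R P (k := 2 * D.e + 3)
    (g := X - C D.c₂) (h := H) (δ := q) (by exact hF) dvd_rfl hq.not_sq_int_dvd
    (by simpa using hc₂) hH
    (by
      have h1 := D.not_dvd_of_lt hqe (x := 2 * D.e + 4) (by omega) (by omega)
      push_cast at h1
      exact h1)
    (by
      change ¬ (q : ℤ) ∣ w * (1 : ℤ[X]).eval _
      simpa using hqw) (.inl (hqt.mul_left _))
  have hT1 : T.card = 1 := by omega
  obtain ⟨i, rfl⟩ := Finset.card_eq_one.1 hT1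
  obtain ⟨σ, hσ⟩ := R.exists_perm_ne (D.eval_ne_zero hw) i
  have : MulAction.IsPretransitive R.perm.range (Fin (2 * D.e + 4)) := by
    rw [MulAction.isPretransitive_iff_base i]
    intro j
    by_cases hj : j = i
    · exact ⟨1, by rw [one_smul, hj]⟩
    · obtain ⟨g, hg, hgj, -⟩ := hfix (R.perm σ i) (by simpa using hσ) j (by simpa using hj)
      exact ⟨⟨g * R.perm σ, mul_mem hg ⟨σ, rfl⟩⟩, hgj⟩
  exact isPreprimitive_of_fixed (by omega) hfix (.inl hT1)

end EvenData

/-- The case of even degree. -/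
theorem exists_numberField_alternatingGroup_even {e : ℕ} (he : 2 ≤ e) {p : ℕ} (hp : p.Prime)
    (hpe : 2 * e + 4 < p) {k : ℤ} (hk : ¬ (p : ℤ) ∣ k) :
    ∃ (K : Type) (_ : Field K) (_ : NumberField K), IsGalois ℚ K ∧
      Nonempty (Gal(K/ℚ) ≃* alternatingGroup (Fin (2 * e + 4))) ∧
        (reducedDiscr K : ℤ) ≡ k [ZMOD p] := by
  have hpi : Prime (p : ℤ) := Nat.prime_iff_prime_int.1 hp
  have hlt : ∀ x : ℕ, 0 < x → x ≤ 2 * e + 4 → ¬ (p : ℤ) ∣ x := fun x hx hx' h => by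
    have := Nat.le_of_dvd hx (by exact_mod_cast h)
    omega
  have h3 := hlt (2 * e + 3) (by omega) (by omega)
  obtain ⟨q, hqB, hq, -, hsq⟩ := exists_prime_gt_modEq_isSquare
    (Δ := (-1) ^ (e + 1) * (2 * e + 3 : ℕ)) (by positivity) hp (by omega)
    ((IsUnit.pow (e + 1) isUnit_one.neg).dvd_mul_left.not.2 h3) (c := 1) hpi.not_dvd_one p
  obtain ⟨D, rfl, ht⟩ : ∃ D : EvenData, D.e = e ∧ D.t = p * q :=
    ⟨⟨e, p * q, he, by have := hq.one_lt; norm_cast; nlinarith⟩, rfl, rfl⟩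
  have hpt : (p : ℤ) ∣ D.t := ht ▸ dvd_mul_right _ _
  have hqt : (q : ℤ) ∣ D.t := ht ▸ dvd_mul_left _ _
  have hqe : 2 * D.e + 4 < q := by omega
  have hε : D.ε.natAbs = 1 := by simp [EvenData.ε]
  have hqa := D.not_dvd_a hq hqe hqt
  have ha : D.a ≠ 0 := fun h => hqa (h ▸ dvd_zero _)
  have ha' : D.a' ≠ 0 := fun h => D.not_dvd_a' hq hqe hqt (h ▸ dvd_zero _)
  have hsq' : IsSquare ((-(D.ε * D.a) : ℤ) : ZMod q) := by
    have h1 : ((D.a : ℤ) : ZMod q) =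
        ((-(8 * (2 * D.e + 2) * (2 * D.e + 1) * D.s ^ (2 * D.e + 3)) : ℤ) : ZMod q) := by
      rw [ZMod.intCast_eq_intCast_iff_dvd_sub]
      have := (hqt.trans D.dvd_a_add).neg_right
      convert! this using 1
      ring
    have h2 : -(D.ε * -(8 * (2 * D.e + 2) * (2 * D.e + 1) * D.s ^ (2 * D.e + 3))) =
        (-1) ^ (D.e + 1) * (2 * D.e + 3 : ℕ) *
          ((8 * (2 * D.e + 2) * (2 * D.e + 1) * D.s ^ (D.e + 1)) *
          (8 * (2 * D.e + 2) * (2 * D.e + 1) * D.s ^ (D.e + 1))) := by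
      have h3 : D.s ^ (2 * D.e + 3) = D.s ^ (D.e + 1) * D.s ^ (D.e + 1) *
        (8 * (2 * D.e + 3) * (2 * D.e + 2) * (2 * D.e + 1)) := by
        rw [← pow_add, show 2 * D.e + 3 = D.e + 1 + (D.e + 1) + 1 by ring, pow_succ]; rfl
      rw [EvenData.ε, h3]
      push_cast
      ring
    rw [Int.cast_neg, Int.cast_mul, h1, ← Int.cast_mul, ← Int.cast_neg, h2, Int.cast_mul]
    exact hsq.mul ⟨_, Int.cast_mul _ _⟩
  obtain ⟨u, hu, hu'⟩ := exists_emultiplicity_add_mul_sq hq (by omega) hε hqa hsq' one_pos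
  rw [pow_one] at hu
  obtain ⟨w₁, hw₁, hw₁'⟩ := Int.exists_modEq_modEq (m := 4) (n := (q : ℤ) ^ 2)
    (by
      have : Nat.Coprime (2 ^ 2) (q ^ 2) :=
        ((Nat.coprime_primes Nat.prime_two hq).2 (by omega)).pow 2 2
      exact_mod_cast Nat.isCoprime_iff_coprime.2 this) 2 u
  obtain ⟨w₂, hw₂, hτ₂, hρ₂⟩ := CriticalFamily.exists_not_dvd hp (by omega) hε
    (hpt.trans D.t_dvd_a_sub_a')
  refine (D.family ha ha').exists_numberField (by omega) hp (by omega) hk (w₁ := w₁)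
    (m₁ := 4 * q ^ 2) ?_ (fun w hw L _ _ _ R => ?_) (w₂ := w₂) ?_ (D.not_dvd_a' hp hpe hpt)
  · have h4 := hlt 4 (by omega) (by omega)
    refine hpi.not_dvd_mul (by exact_mod_cast h4) fun h => ?_
    have := (Nat.prime_dvd_prime_iff_eq hp hq).1 (by exact_mod_cast hpi.dvd_of_dvd_pow h)
    omega
  · have hwq : D.a + D.ε * w ^ 2 ≡ D.a + D.ε * u ^ 2 [ZMOD q ^ 2] :=
      ((((hw.of_mul_left 4).trans hw₁').pow 2).mul_left _).add_left _
    refine D.isPreprimitive ha ha' hq hqe hqt ((hw.of_mul_right _).trans hw₁) ?_ ?_ L R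
    · exact ((hwq.of_dvd (dvd_pow_self _ two_ne_zero)).dvd_iff).2 hu
    · exact hwq.dvd_iff.not.2 hu'
  · have h1 := hlt (2 * D.e + 4) (by omega) (by omega)
    push_cast at h1
    have hQ : ∀ x, (D.family ha ha').Q.eval x = 1 := fun x => eval_one
    simp only [hQ, mul_one]
    exact hpi.not_dvd_mul (hpi.not_dvd_mul (hpi.not_dvd_mul h1 hw₂) hρ₂) hτ₂

/-- The data of a rational function of odd degree `2 e + 3` with a simple finite pole `b` and
critical points `0`, `s` and `r = - t b`, the last one double. -/
structure OddData where
  e : ℕ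
  t : ℤ
  two_le_e : 2 ≤ e
  lt_t : 2 * e + 3 < t

namespace OddData
variable (D : OddData)

/-- The finite pole. -/
def b : ℤ := (2 * D.e + 1) * (2 * D.e + 2 + 2 * D.e * D.t)

/-- The simple critical point. -/
def s : ℤ := (2 * D.e + 1) * (2 * D.e + 3 + (2 * D.e + 1) * D.t)

/-- The double critical point. -/
def r : ℤ := - D.t * D.b

/-- The linear coefficient of the quadratic factor, up to sign. -/
def A : ℤ := (2 * D.e + 2) * (2 * D.e + 3 + (2 * D.e + 1) * D.t -
  2 * D.t * (2 * D.e + 2 + 2 * D.e * D.t)) - (2 * D.e + 3) * (2 * D.e + 2 + 2 * D.e * D.t)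

/-- The constant coefficient of the quadratic factor. -/
def B : ℤ := (2 * D.e + 2) * (2 * D.e + 3 + (2 * D.e + 1) * D.t) * D.b * D.t ^ 2

/-- The quadratic factor. -/
noncomputable def g : ℤ[X] := X ^ 2 - C D.A * X + C D.B

/-- The value of the rational function at `s`. -/
def a : ℤ := D.s ^ (2 * D.e) *
  ((2 * D.e + 3) * D.s ^ 2 - (2 * D.e + 2) * D.A * D.s + (2 * D.e + 1) * D.B)

/-- The value of the rational function at `s` minus its value at `r`. -/
def a' : ℤ := D.a - 2 * D.r ^ (2 * D.e) * D.t ^ 3 * D.b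

/-- The numerator of the rational function, normalized to vanish at `s`. -/
noncomputable def S : ℤ[X] := X ^ (2 * D.e + 1) * D.g - C D.a * (X - C D.b)

theorem natDegree_g : D.g.natDegree = 2 := by
  rw [g]; compute_degree!

theorem monic_g : D.g.Monic := by
  rw [g]; monicity!

theorem natDegree_X_pow_mul_g : (X ^ (2 * D.e + 1) * D.g).natDegree = 2 * D.e + 3 := by
  rw [(monic_X_pow _).natDegree_mul D.monic_g, natDegree_X_pow, natDegree_g]

theorem natDegree_C_mul_lt :
    (C D.a * (X - C D.b)).natDegree < (X ^ (2 * D.e + 1) * D.g).natDegree := by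
  refine (natDegree_C_mul_le _ _).trans_lt ?_
  rw [natDegree_X_sub_C, natDegree_X_pow_mul_g]
  omega

theorem natDegree_S : D.S.natDegree = 2 * D.e + 3 := by
  rw [S, natDegree_sub_eq_left_of_natDegree_lt D.natDegree_C_mul_lt, natDegree_X_pow_mul_g]

theorem monic_S : D.S.Monic :=
  ((monic_X_pow _).mul D.monic_g).sub_of_left (degree_lt_degree D.natDegree_C_mul_lt)

theorem wronskian : derivative D.S * (X - C D.b) - D.S * derivative (X - C D.b) =
    C (2 * D.e + 2 : ℤ) * (X - C D.s) * (X - C D.r) ^ 2 * X ^ (2 * D.e + 1 - 1) := by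
  have h2 : C ((2 * D.e + 1) * D.A + (2 * D.e + 3) * D.b) =
      C ((2 * D.e + 2) * (2 * D.r + D.s)) := by
    rw [A, r, s, b]; congr 1; ring
  have h1 : C (2 * D.e * D.B + (2 * D.e + 2) * D.A * D.b) =
      C ((2 * D.e + 2) * (D.r ^ 2 + 2 * D.r * D.s)) := by
    rw [A, B, r, s, b]; congr 1; ring
  have h0 : C ((2 * D.e + 1) * D.B * D.b) = C ((2 * D.e + 2) * (D.r ^ 2 * D.s)) := by
    rw [B, r, s, b]; congr 1; ring
  rw [S, g, Nat.add_sub_cancel]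
  simp only [derivative_sub, derivative_mul, derivative_X_pow, derivative_C, derivative_add,
    derivative_X, Nat.add_sub_cancel, C_mul, C_add, C_pow, Nat.cast_add,
    Nat.cast_mul, Nat.cast_ofNat, Nat.cast_one, C_1, C_ofNat, map_natCast] at h0 h1 h2 ⊢
  linear_combination X ^ (2 * D.e) * (h1 * X - h2 * X ^ 2 - h0)

theorem eval_S (x : ℤ) : D.S.eval x =
    x ^ (2 * D.e + 1) * (x ^ 2 - D.A * x + D.B) - D.a * (x - D.b) := by
  rw [S, g]; simp

theorem eval_S_s : D.S.eval D.s = 0 := by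
  rw [eval_S, a]
  have : D.s * (D.s ^ 2 - D.A * D.s + D.B) =
    ((2 * D.e + 3) * D.s ^ 2 - (2 * D.e + 2) * D.A * D.s + (2 * D.e + 1) * D.B) *
      (D.s - D.b) := by
    rw [A, B, s, b]; ring
  linear_combination D.s ^ (2 * D.e) * this

theorem eval_S_r : D.S.eval D.r + D.a' * (D.r - D.b) = 0 := by
  rw [eval_S, a']
  have : D.r * (D.r ^ 2 - D.A * D.r + D.B) = 2 * D.t ^ 3 * D.b * (D.r - D.b) := by
    rw [A, B, r, b]; ring
  linear_combination D.r ^ (2 * D.e) * this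

theorem eval_S_b : - D.S.eval D.b =
    (2 * D.e + 2) * (D.b - D.s) * (D.b - D.r) ^ 2 * D.b ^ (2 * D.e) := by
  simpa using congrArg (eval D.b) D.wronskian

theorem e_pos : (0 : ℤ) < D.e := by exact_mod_cast (zero_lt_two.trans_le D.two_le_e)

theorem t_pos : 0 < D.t := by linarith [D.e_pos, D.lt_t]

theorem b_pos : 0 < D.b := by
  have := D.e_pos
  have := D.t_pos
  rw [b]
  positivity

theorem s_pos : 0 < D.s := by
  have := D.e_pos
  have := D.t_pos
  rw [s]
  positivity

theorem s_sub_b : D.s - D.b = (2 * D.e + 1) * (D.t + 1) := by rw [s, b]; ring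

theorem s_sub_b_ne_zero : D.s - D.b ≠ 0 := by
  have := D.e_pos
  have := D.t_pos
  rw [s_sub_b]
  positivity

theorem r_neg : D.r < 0 := by
  rw [r]
  linarith [mul_pos D.t_pos D.b_pos]

theorem dvd_A : D.t ∣ D.A := ⟨(2 * D.e + 2) * (2 * D.e + 1 -
  2 * (2 * D.e + 2 + 2 * D.e * D.t)) - (2 * D.e + 3) * (2 * D.e), by rw [A]; ring⟩

theorem dvd_B : D.t ∣ D.B := (dvd_pow_self _ two_ne_zero).mul_left _

theorem dvd_r : D.t ∣ D.r := (dvd_neg.2 dvd_rfl).mul_right _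

theorem dvd_a_sub : D.t ∣ D.a - (2 * D.e + 3) * D.s ^ (2 * D.e + 2) := by
  obtain ⟨x, hx⟩ := D.dvd_A
  obtain ⟨y, hy⟩ := D.dvd_B
  exact ⟨D.s ^ (2 * D.e) * ((2 * D.e + 1) * y - (2 * D.e + 2) * x * D.s), by
    rw [a, hx, hy]; ring⟩

theorem t_dvd_a_sub_a' : D.t ∣ D.a - D.a' := by
  rw [a']
  exact ⟨2 * D.r ^ (2 * D.e) * D.t ^ 2 * D.b, by ring⟩

theorem not_dvd_of_lt {q : ℕ} (hqe : 2 * D.e + 3 < q) {x : ℕ} (hx : 0 < x)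
    (hx' : x ≤ 2 * D.e + 3) : ¬ (q : ℤ) ∣ x := fun h => by
  have := Nat.le_of_dvd hx (by exact_mod_cast h)
  omega

section
variable {q : ℕ} (hq : q.Prime) (hqe : 2 * D.e + 3 < q) (hqt : (q : ℤ) ∣ D.t)
include hq hqe hqt

theorem not_dvd_b : ¬ (q : ℤ) ∣ D.b := by
  have hqi : Prime (q : ℤ) := Nat.prime_iff_prime_int.1 hq
  have h1 := D.not_dvd_of_lt hqe (x := 2 * D.e + 1) (by omega) (by omega)
  have h2 := D.not_dvd_of_lt hqe (x := 2 * D.e + 2) (by omega) (by omega)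
  push_cast at h1 h2
  exact hqi.not_dvd_mul h1 fun h => h2 ((dvd_add_left (hqt.mul_left _)).1 h)

theorem not_dvd_s : ¬ (q : ℤ) ∣ D.s := by
  have hqi : Prime (q : ℤ) := Nat.prime_iff_prime_int.1 hq
  have h1 := D.not_dvd_of_lt hqe (x := 2 * D.e + 1) (by omega) (by omega)
  have h2 := D.not_dvd_of_lt hqe (x := 2 * D.e + 3) (by omega) (by omega)
  push_cast at h1 h2
  exact hqi.not_dvd_mul h1 fun h => h2 ((dvd_add_left (hqt.mul_left _)).1 h)

theorem not_dvd_s_sub_b : ¬ (q : ℤ) ∣ D.s - D.b := by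
  have hqi : Prime (q : ℤ) := Nat.prime_iff_prime_int.1 hq
  have h1 := D.not_dvd_of_lt hqe (x := 2 * D.e + 1) (by omega) (by omega)
  push_cast at h1
  rw [s_sub_b]
  exact hqi.not_dvd_mul h1 fun h => hqi.not_dvd_one ((dvd_add_right hqt).1 h)

theorem not_dvd_r_sub_b : ¬ (q : ℤ) ∣ D.r - D.b := fun h =>
  D.not_dvd_b hq hqe hqt ((dvd_sub_right (hqt.trans D.dvd_r)).1 h)

theorem not_dvd_a : ¬ (q : ℤ) ∣ D.a := by
  have hqi : Prime (q : ℤ) := Nat.prime_iff_prime_int.1 hq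
  have h1 := D.not_dvd_of_lt hqe (x := 2 * D.e + 3) (by omega) (by omega)
  push_cast at h1
  exact fun h => hqi.not_dvd_mul h1
    (fun h => D.not_dvd_s hq hqe hqt (hqi.dvd_of_dvd_pow h))
    ((dvd_sub_right h).1 (hqt.trans D.dvd_a_sub))

theorem not_dvd_a' : ¬ (q : ℤ) ∣ D.a' := fun h => D.not_dvd_a hq hqe hqt (by
  have := dvd_add (hqt.trans D.t_dvd_a_sub_a') h
  rwa [sub_add_cancel] at this)

end

/-- The sign for which the discriminants are squares. -/
def ε : ℤ := (-1) ^ D.e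

theorem isSquare {w : ℤ} {F : ℤ[X]} (hF : F = D.S - C (D.ε * w ^ 2) * (X - C D.b)) {L : Type}
    [Field L] [NumberField L] (R : RootLabelling F (2 * D.e + 3) L) : ∃ y z : ℤ, y ≠ 0 ∧
      (y : 𝓞 L) ^ 2 * ((-1) ^ ((2 * D.e + 3) * (2 * D.e + 3 - 1) / 2) *
        ∏ i, aeval (R.root i) (derivative F)) = (z : 𝓞 L) ^ 2 := by
  have h1 := R.prod_aeval_derivative_mul_prod_aeval hF D.wronskian
  have h2 : F.eval D.s = - (D.ε * w ^ 2 * (D.s - D.b)) := by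
    rw [hF, eval_sub, eval_S_s]
    simp
  have hb : F.eval D.b = D.S.eval D.b := by
    rw [hF]
    simp
  have h3 : (2 * D.e + 3) * (2 * D.e + 3 - 1) / 2 = (D.e + 1) * (2 * D.e + 3) := by
    rw [show 2 * D.e + 3 - 1 = 2 * D.e + 2 by omega]
    apply Nat.div_eq_of_eq_mul_left two_pos
    ring
  have h4 : (-1 : ℤ) ^ ((D.e + 1) * (2 * D.e + 3)) * D.ε = -1 := by
    rw [ε, ← pow_add,
      show (D.e + 1) * (2 * D.e + 3) + D.e = 2 * (D.e ^ 2 + 3 * D.e + 1) + 1 by ring, pow_succ,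
      pow_mul]
    simp
  have h5 : (-1 : ℤ) ^ (2 * D.e + 3) = -1 := by
    rw [show 2 * D.e + 3 = 2 * (D.e + 1) + 1 by ring, pow_succ, pow_mul]
    simp
  have h6 : ∏ i, aeval (R.root i) (X - C D.b) =
      (((2 * D.e + 2) * (D.b - D.s) * (D.b - D.r) ^ 2 * D.b ^ (2 * D.e) : ℤ) : 𝓞 L) := by
    rw [← D.eval_S_b, ← hb, ← neg_one_mul, ← h5, ← R.prod_root_sub]
    simp
  have h7 : (-1 : ℤ) ^ (2 * D.e) = 1 := by rw [pow_mul]; simp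
  refine ⟨(D.b - D.r) * D.b ^ D.e, (2 * D.e + 2) ^ (D.e + 1) * w * F.eval D.r * F.eval 0 ^ D.e,
    mul_ne_zero (by linarith [D.b_pos, D.r_neg]) (pow_ne_zero _ D.b_pos.ne'), ?_⟩
  have hne : (((2 * D.e + 2) * (D.b - D.s) : ℤ) : 𝓞 L) ≠ 0 := by
    refine Int.cast_ne_zero.2 (mul_ne_zero (by positivity) ?_)
    rw [← neg_sub]
    exact neg_ne_zero.2 D.s_sub_b_ne_zero
  refine mul_left_cancel₀ hne ?_
  rw [h6, h2, h5, Nat.add_sub_cancel] at h1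
  have h8 : (-1) ^ ((D.e + 1) * (2 * D.e + 3)) * ((2 * D.e + 2) ^ (2 * D.e + 3) *
      (-1 * -(D.ε * w ^ 2 * (D.s - D.b))) * (-1 * F.eval D.r) ^ 2 * (-1 * F.eval 0) ^ (2 * D.e)) =
      (2 * D.e + 2) * (D.b - D.s) *
        ((2 * D.e + 2) ^ (D.e + 1) * w * F.eval D.r * F.eval 0 ^ D.e) ^ 2 := by
    rw [mul_pow (-1) (F.eval 0), h7]
    linear_combination ((2 * D.e + 2) ^ (2 * D.e + 3) * w ^ 2 * (D.s - D.b) * (F.eval D.r) ^ 2 *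
      F.eval 0 ^ (2 * D.e)) * h4
  have h9 := congrArg (Int.cast : ℤ → 𝓞 L) h8
  rw [Int.cast_mul, ← h1] at h9
  rw [h3]
  push_cast at h9 ⊢
  linear_combination h9

/-- The family attached to the data. -/
noncomputable def family (h : D.a ≠ 0) (h' : D.a' ≠ 0) : CriticalFamily (2 * D.e + 3) :=
  CriticalFamily.ofWronskian (S := D.S) (Q := X - C D.b) (g0 := D.g) (ε := D.ε) (a := D.a)
    (a' := D.a') (c := 2 * D.e + 2) (s := D.s) (r := D.r) (κ := 2 * D.e + 1)
    (by simp [ε]) D.monic_S D.natDegree_S (by rw [natDegree_X_sub_C]; omega) D.eval_S_s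
    (by simpa using D.eval_S_r) (by simpa using D.s_sub_b_ne_zero)
    (by simpa using (by linarith [D.b_pos, D.r_neg] : D.r - D.b ≠ 0)) (by rw [S]; ring) D.wronskian
    (by have := D.two_le_e; omega)
    (by
      have h1 := D.s_pos
      have h2 := D.r_neg
      have h3 : D.r - D.s ≠ 0 := by linarith
      have h4 : D.a - D.a' ≠ 0 := by
        rw [a', sub_sub_cancel]
        exact mul_ne_zero (mul_ne_zero (mul_ne_zero two_ne_zero (pow_ne_zero _ h2.ne))
          (pow_ne_zero _ D.t_pos.ne')) D.b_pos.ne'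
      have h5 : (2 * D.e + 2 : ℤ) ≠ 0 := by positivity
      simp only [mul_ne_zero_iff]
      exact ⟨⟨⟨⟨⟨⟨h5, h1.ne'⟩, h2.ne⟩, h3⟩, h⟩, h'⟩, h4⟩)
    (fun _ _ _ _ R => D.isSquare rfl R)

end OddData

/-- A prime at which all but two of the roots collide contributes to primitivity in odd degree. -/
theorem CriticalFamily.isPreprimitive_of_isPretransitive {n : ℕ} (𝓕 : CriticalFamily n)
    (hn : Odd n) (hκ : 2 + 𝓕.κ = n) {q : ℕ} (hq : q.Prime) (hbad : ¬ (q : ℤ) ∣ 𝓕.bad) {w : ℤ}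
    (hτ : (q : ℤ) ∣ 𝓕.τ w) (hτ' : ¬ (q : ℤ) ^ 2 ∣ 𝓕.τ w) {L : Type} [Field L] [NumberField L]
    [IsGalois ℚ L] (R : RootLabelling (𝓕.poly w) n L)
    [MulAction.IsPretransitive R.perm.range (Fin n)] :
    MulAction.IsPreprimitive R.perm.range (Fin n) := by
  have hqi : Prime (q : ℤ) := Nat.prime_iff_prime_int.1 hq
  have : Fact q.Prime := ⟨hq⟩
  obtain ⟨P, _, _⟩ := exists_prime_liesOver L q
  obtain ⟨⟨hc, ha, ha', haa⟩, ⟨hQs, hQr, hQ0⟩, -, -, hg0⟩ := 𝓕.not_dvd_of_not_dvd_bad hq hbad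
  have hw : ¬ (q : ℤ) ∣ w := fun hw => ha
    ((dvd_add_left ((dvd_pow hw two_ne_zero).mul_left _)).1 hτ)
  have hρ : ¬ (q : ℤ) ∣ 𝓕.ρ w := fun h => haa (by
    have := dvd_sub hτ h
    rwa [CriticalFamily.τ, CriticalFamily.ρ, add_sub_add_right_eq_sub] at this)
  obtain ⟨T, hT, hfix⟩ := 𝓕.exists_finset_fixed R P (k := 𝓕.κ) (g := 𝓕.g0) (h := 𝓕.Q)
    (δ := 𝓕.τ w) (by simpa using 𝓕.poly_eq_zero w) hτ hτ' hg0 hQ0 hc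
    (hqi.not_dvd_mul hw hQs) (.inr (hqi.not_dvd_mul hρ hQr))
  have := 𝓕.four_le_κ
  exact isPreprimitive_of_fixed (by omega) hfix (.inr ⟨by omega, hn⟩)

namespace OddData
variable (D : OddData)

/-- The members of the family are Eisenstein at suitable prime factors of `t`. -/
theorem exists_eq_sub {w : ℤ} {q : ℕ} (hq : q.Prime) (hqe : 2 * D.e + 3 < q)
    (hqt : (q : ℤ) ∣ D.t) (hτ : (q : ℤ) ∣ D.a + D.ε * w ^ 2)
    (hτ' : ¬ (q : ℤ) ^ 2 ∣ D.a + D.ε * w ^ 2) : ∃ h : ℤ[X], ¬ (q : ℤ) ∣ h.eval 0 ∧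
      D.S - C (D.ε * w ^ 2) * (X - C D.b) = X ^ (2 * D.e + 3) * 1 - C (q : ℤ) * h := by
  have hqi : Prime (q : ℤ) := Nat.prime_iff_prime_int.1 hq
  obtain ⟨x₁, hx₁⟩ := hqt.trans D.dvd_A
  obtain ⟨x₀, hx₀⟩ := hqt.trans D.dvd_B
  obtain ⟨y, hy⟩ := hτ
  refine ⟨C x₁ * X ^ (2 * D.e + 2) - C x₀ * X ^ (2 * D.e + 1) + C y * (X - C D.b), ?_, ?_⟩
  · simp only [eval_add, eval_sub, eval_C, eval_mul, eval_pow, eval_X, zero_pow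
      (Nat.succ_ne_zero _),
      mul_zero, zero_sub, sub_zero, zero_add, mul_neg, dvd_neg]
    refine hqi.not_dvd_mul (fun h => hτ' ?_) (D.not_dvd_b hq hqe hqt)
    rw [hy, pow_two]
    exact mul_dvd_mul_left _ h
  · have hy' := congrArg (C : ℤ → ℤ[X]) hy
    simp only [C_add, C_mul] at hy'
    rw [S, g, hx₁, hx₀]
    simp only [C_mul]
    linear_combination (-(X - C D.b)) * hy'

/-- Suitable congruences on the parameter make the Galois group transitive. -/
theorem isPretransitive (h : D.a ≠ 0) (h' : D.a' ≠ 0) {q : ℕ} (hq : q.Prime)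
    (hqe : 2 * D.e + 3 < q) (hqt : (q : ℤ) ∣ D.t) {w : ℤ}
    (hτ : (q : ℤ) ∣ D.a + D.ε * w ^ 2) (hτ' : ¬ (q : ℤ) ^ 2 ∣ D.a + D.ε * w ^ 2)
    {L : Type} [Field L] [NumberField L] [IsGalois ℚ L]
    (R : RootLabelling ((D.family h h').poly w) (2 * D.e + 3) L) :
    MulAction.IsPretransitive R.perm.range (Fin (2 * D.e + 3)) := by
  have hqi : Prime (q : ℤ) := Nat.prime_iff_prime_int.1 hq
  have : Fact q.Prime := ⟨hq⟩
  obtain ⟨P, _, _⟩ := exists_prime_liesOver L q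
  obtain ⟨H, hH, hF⟩ := D.exists_eq_sub hq hqe hqt hτ hτ'
  have hqw : ¬ (q : ℤ) ∣ w := fun hw => D.not_dvd_a hq hqe hqt
    ((dvd_add_left ((dvd_pow hw two_ne_zero).mul_left _)).1 hτ)
  have h2 := D.not_dvd_of_lt hqe (x := 2 * D.e + 2) (by omega) (by omega)
  push_cast at h2
  obtain ⟨T, hT, hfix⟩ := (D.family h h').exists_finset_fixed R P (k := 2 * D.e + 3)
    (g := 1) (h := H) (δ := q) hF dvd_rfl hq.not_sq_int_dvd
    (by simpa using hqi.not_dvd_one) hH h2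
    (by
      refine hqi.not_dvd_mul hqw ?_
      change ¬ (q : ℤ) ∣ (X - C D.b).eval D.s
      simpa using D.not_dvd_s_sub_b hq hqe hqt) (.inl (hqt.trans D.dvd_r))
  have hT0 : T = ∅ := Finset.card_eq_zero.1 (by omega)
  refine ⟨fun i j => ?_⟩
  obtain ⟨g, hg, hgj, -⟩ := hfix i (by simp [hT0]) j (by simp [hT0])
  exact ⟨⟨g, hg⟩, hgj⟩

end OddData

/-- The case of odd degree. -/
theorem exists_numberField_alternatingGroup_odd {e : ℕ} (he : 2 ≤ e) {p : ℕ} (hp : p.Prime)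
    (hpe : 2 * e + 3 < p) {k : ℤ} (hk : ¬ (p : ℤ) ∣ k) :
    ∃ (K : Type) (_ : Field K) (_ : NumberField K), IsGalois ℚ K ∧
      Nonempty (Gal(K/ℚ) ≃* alternatingGroup (Fin (2 * e + 3))) ∧
        (reducedDiscr K : ℤ) ≡ k [ZMOD p] := by
  have hpi : Prime (p : ℤ) := Nat.prime_iff_prime_int.1 hp
  have hlt : ∀ x : ℕ, 0 < x → x ≤ 2 * e + 3 → ¬ (p : ℤ) ∣ x := fun x hx hx' h => by
    have := Nat.le_of_dvd hx (by exact_mod_cast h)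
    omega
  have h3 := hlt (2 * e + 3) (by omega) (by omega)
  obtain ⟨q, hqB, hq, -, hsq⟩ := exists_prime_gt_modEq_isSquare
    (Δ := -(-1) ^ e * (2 * e + 3 : ℕ)) (mul_ne_zero (by simp) (by positivity)) hp (by omega)
    ((IsUnit.pow e isUnit_one.neg).neg.dvd_mul_left.not.2 h3) (c := 1) hpi.not_dvd_one p
  obtain ⟨D, rfl, ht⟩ : ∃ D : OddData, D.e = e ∧ D.t = p * q :=
    ⟨⟨e, p * q, he, by have := hq.one_lt; norm_cast; nlinarith⟩, rfl, rfl⟩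
  have hpt : (p : ℤ) ∣ D.t := ht ▸ dvd_mul_right _ _
  have hqt : (q : ℤ) ∣ D.t := ht ▸ dvd_mul_left _ _
  have hqe : 2 * D.e + 3 < q := by omega
  have hε : D.ε.natAbs = 1 := by simp [OddData.ε]
  have hqa := D.not_dvd_a hq hqe hqt
  have ha : D.a ≠ 0 := fun h => hqa (h ▸ dvd_zero _)
  have ha' : D.a' ≠ 0 := fun h => D.not_dvd_a' hq hqe hqt (h ▸ dvd_zero _)
  have hsq' : IsSquare ((-(D.ε * D.a) : ℤ) : ZMod q) := by
    have h1 : ((D.a : ℤ) : ZMod q) = (((2 * D.e + 3) * D.s ^ (2 * D.e + 2) : ℤ) : ZMod q) := by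
      rw [eq_comm, ZMod.intCast_eq_intCast_iff_dvd_sub]
      exact hqt.trans D.dvd_a_sub
    have h2 : -(D.ε * ((2 * D.e + 3) * D.s ^ (2 * D.e + 2))) =
        -(-1) ^ D.e * (2 * D.e + 3 : ℕ) * (D.s ^ (D.e + 1) * D.s ^ (D.e + 1)) := by
      rw [OddData.ε]
      push_cast
      ring
    rw [Int.cast_neg, Int.cast_mul, h1, ← Int.cast_mul, ← Int.cast_neg, h2, Int.cast_mul]
    exact hsq.mul ⟨_, Int.cast_mul _ _⟩
  obtain ⟨u, hu, hu'⟩ := exists_emultiplicity_add_mul_sq hq (by omega) hε hqa hsq' one_pos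
  rw [pow_one] at hu
  obtain ⟨𝓕, h𝓕⟩ : ∃ 𝓕, 𝓕 = D.family ha ha' := ⟨_, rfl⟩
  have h𝓕a : 𝓕.a = D.a := h𝓕 ▸ rfl
  have h𝓕ε : 𝓕.ε = D.ε := h𝓕 ▸ rfl
  obtain ⟨q', hqB', hq', -, hsq''⟩ := exists_prime_gt_modEq_isSquare (Δ := -(D.ε * D.a))
    (neg_ne_zero.2 (mul_ne_zero (by rintro h; simp [h] at hε) ha)) hp (by omega)
    (by
      rw [dvd_neg, (Int.isUnit_iff_natAbs_eq.2 hε).dvd_mul_left]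
      exact D.not_dvd_a hp hpe hpt) (c := 1) hpi.not_dvd_one (q + 𝓕.bad.natAbs)
  have hbad : ¬ (q' : ℤ) ∣ 𝓕.bad := fun h => by
    have := Nat.le_of_dvd (Int.natAbs_pos.2 𝓕.bad_ne_zero) (Int.natCast_dvd.1 h)
    omega
  obtain ⟨u', hu₁, hu₁'⟩ := exists_emultiplicity_add_mul_sq hq' (by omega) hε
    (h𝓕a ▸ (𝓕.not_dvd_of_not_dvd_bad hq' hbad).1.2.1) hsq'' one_pos
  rw [pow_one] at hu₁
  obtain ⟨w₁, hw₁, hw₁'⟩ := Int.exists_modEq_modEq (m := (q : ℤ) ^ 2) (n := (q' : ℤ) ^ 2)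
    (by
      have : Nat.Coprime (q ^ 2) (q' ^ 2) :=
        ((Nat.coprime_primes hq hq').2 (by omega)).pow 2 2
      exact_mod_cast Nat.isCoprime_iff_coprime.2 this) u u'
  obtain ⟨w₂, hw₂, hτ₂, hρ₂⟩ := CriticalFamily.exists_not_dvd hp (by omega) hε
    (hpt.trans D.t_dvd_a_sub_a')
  refine (D.family ha ha').exists_numberField (by omega) hp (by omega) hk (w₁ := w₁)
    (m₁ := q ^ 2 * q' ^ 2) ?_ (fun w hw L _ _ _ R => ?_) (w₂ := w₂) ?_ (D.not_dvd_a' hp hpe hpt)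
  · have hne : ∀ l : ℕ, l.Prime → p < l → ¬ (p : ℤ) ∣ (l : ℤ) ^ 2 := fun l hl hpl h => by
      have := (Nat.prime_dvd_prime_iff_eq hp hl).1 (by exact_mod_cast hpi.dvd_of_dvd_pow h)
      omega
    exact hpi.not_dvd_mul (hne q hq hqB) (hne q' hq' (by omega))
  · have hmod : ∀ {l : ℕ} {v : ℤ}, w ≡ v [ZMOD l ^ 2] →
        D.a + D.ε * w ^ 2 ≡ D.a + D.ε * v ^ 2 [ZMOD l ^ 2] :=
      fun h => ((h.pow 2).mul_left _).add_left _
    have h1 := hmod ((hw.of_mul_right _).trans hw₁)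
    have h2 := hmod ((hw.of_mul_left _).trans hw₁')
    have := D.isPretransitive ha ha' hq hqe hqt
      ((h1.of_dvd (dvd_pow_self _ two_ne_zero)).dvd_iff.2 hu) (h1.dvd_iff.not.2 hu') R
    exact (D.family ha ha').isPreprimitive_of_isPretransitive ⟨D.e + 1, by ring⟩
      (by change 2 + (2 * D.e + 1) = _; ring) hq' (h𝓕 ▸ hbad)
      ((h2.of_dvd (dvd_pow_self _ two_ne_zero)).dvd_iff.2 hu₁) (h2.dvd_iff.not.2 hu₁') R
  · have h1 := hlt (2 * D.e + 2) (by omega) (by omega)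
    push_cast at h1
    have hQ : ∀ x, (D.family ha ha').Q.eval x = x - D.b := fun x => by
      change (X - C D.b).eval x = _
      simp
    simp only [hQ]
    exact hpi.not_dvd_mul (hpi.not_dvd_mul (hpi.not_dvd_mul h1
      (hpi.not_dvd_mul hw₂ (D.not_dvd_s_sub_b hp hpe hpt)))
      (hpi.not_dvd_mul hρ₂ (D.not_dvd_r_sub_b hp hpe hpt)))
      (hpi.not_dvd_mul hτ₂ (by
        rw [zero_sub, dvd_neg]
        exact D.not_dvd_b hp hpe hpt))

end

theorem stmt_14 (n : ℕ) (hn : 7 ≤ n) (p : ℕ) (hp : p.Prime) (hpn : n < p)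
    (k : ℤ) (hk : ¬ ((p : ℤ) ∣ k)) :
    ∃ (K : Type) (_ : Field K) (_ : NumberField K), IsGalois ℚ K ∧
      Nonempty ((K ≃ₐ[ℚ] K) ≃* alternatingGroup (Fin n)) ∧
      (reducedDiscr K : ℤ) ≡ k [ZMOD (p : ℤ)] := by
  obtain ⟨e, rfl | rfl⟩ : ∃ e, n = 2 * e + 4 ∨ n = 2 * e + 3 := ⟨(n - 3) / 2, by omega⟩
  · exact exists_numberField_alternatingGroup_even (by omega) hp hpn hk
  · exact exists_numberField_alternatingGroup_odd (by omega) hp hpn hk
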